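/- Let d ≥ 2, α ∈ ℝ∖{0}, (β, γ) ∈ ℝ²∖{(0,0)}, let (p, r) be an admissible pair, q ∈ [1, ∞] and s ∈ ℝ. Then for every u₀ ∈ M^s_{2,q}(ℝ^d) one has the homogeneous Strichartz estimate in Planchon-type spaces: ‖W(t)u₀‖_{l^{s,q}_□(L^r_t L^p_x)} ≲ ‖u₀‖_{M^s_{2,q}}, with implicit constant independent of u₀. -/

import Mathlib

open MeasureTheory Filter
open scoped ENNReal FourierTransform

noncomputable section

/-- Euclidean space `ℝ^d`. -/
abbrev Sp (d : ℕ) : Type := EuclideanSpace ℝ (Fin d)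

/-- A smooth partition of unity `(σ_k)_{k ∈ ℤ^d}` adapted to the unit cubes
`Q_k = k + (-1/2, 1/2]^d`:  each `σ_k` is smooth, supported in `B_{√d}(k)`,
uniformly bounded below on `Q_k`, and the family sums to `1`. -/
structure BoxPartition (d : ℕ) where
  σ : (Fin d → ℤ) → Sp d → ℂ
  smooth : ∀ k, ContDiff ℝ (⊤ : ℕ∞) (σ k)
  support_subset : ∀ k, Function.support (σ k) ⊆
    Metric.ball ((EuclideanSpace.equiv (Fin d) ℝ).symm (fun i => (k i : ℝ))) (Real.sqrt d)
  lower_bound : ∃ C : ℝ, 0 < C ∧ ∀ k ξ,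
    (∀ i, (EuclideanSpace.equiv (Fin d) ℝ) ξ i - (k i : ℝ) ∈ Set.Ioc (-(1/2) : ℝ) (1/2)) →
    C ≤ ‖σ k ξ‖
  partition : ∀ ξ, HasSum (fun k => σ k ξ) 1

/-- The isometric decomposition (box) operator `□_k = 𝓕⁻¹ σ_k 𝓕`, realized as
convolution with the inverse Fourier transform of `σ_k`. -/
def boxOp {d : ℕ} (P : BoxPartition d) (k : Fin d → ℤ) (f : Sp d → ℂ) : Sp d → ℂ :=
  fun x => ∫ y, 𝓕⁻ (P.σ k) (x - y) * f y

/-- The Japanese bracket `⟨k⟩^s = (1 + |k|²)^{s/2}` as an extended nonnegative real. -/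
def jbr {d : ℕ} (k : Fin d → ℤ) (s : ℝ) : ℝ≥0∞ :=
  ENNReal.ofReal ((1 + ∑ i, ((k i : ℝ))^2) ^ (s/2))

/-- The `ℓ^q` norm of a family of extended nonnegative reals. -/
def lqNorm {ι : Type*} (q : ℝ≥0∞) (a : ι → ℝ≥0∞) : ℝ≥0∞ :=
  if q = ∞ then ⨆ k, a k else (∑' k, a k ^ q.toReal) ^ (1 / q.toReal)

/-- The `L^r(ℝ)` norm (with respect to Lebesgue measure in time) of an
`ℝ≥0∞`-valued function. -/
def timeNorm (r : ℝ≥0∞) (g : ℝ → ℝ≥0∞) : ℝ≥0∞ :=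
  if r = ∞ then essSup g volume else (∫⁻ t, g t ^ r.toReal) ^ (1 / r.toReal)

/-- The modulation space norm `‖f‖_{M^s_{p,q}} = ‖(⟨k⟩^s ‖□_k f‖_{L^p})_k‖_{ℓ^q}`. -/
def modNorm {d : ℕ} (P : BoxPartition d) (s : ℝ) (p q : ℝ≥0∞) (f : Sp d → ℂ) : ℝ≥0∞ :=
  lqNorm q (fun k => jbr k s * eLpNorm (boxOp P k f) p volume)

/-- The Planchon-type space norm
`‖u‖_{l^{s,q}_□(L^r L^p)} = ‖(⟨k⟩^s ‖□_k u‖_{L^r_t L^p_x})_k‖_{ℓ^q}`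
(box operators act in the space variable only). -/
def planchonNorm {d : ℕ} (P : BoxPartition d) (s : ℝ) (q r p : ℝ≥0∞)
    (u : ℝ → Sp d → ℂ) : ℝ≥0∞ :=
  lqNorm q (fun k => jbr k s * timeNorm r (fun t => eLpNorm (boxOp P k (u t)) p volume))

/-- The norm of `X = l^{s,q}_□(L^∞ L²) ∩ l^{s,q}_□(L^r L^p)`. -/
def XNorm {d : ℕ} (P : BoxPartition d) (s : ℝ) (q r p : ℝ≥0∞) (u : ℝ → Sp d → ℂ) : ℝ≥0∞ :=
  planchonNorm P s q ∞ 2 u + planchonNorm P s q r p u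

/-- Membership in `X = l^{s,q}_□(L^∞ L²) ∩ l^{s,q}_□(L^r L^p)`. -/
def InX {d : ℕ} (P : BoxPartition d) (s : ℝ) (q r p : ℝ≥0∞) (u : ℝ → Sp d → ℂ) : Prop :=
  planchonNorm P s q ∞ 2 u < ∞ ∧ planchonNorm P s q r p u < ∞

/-- The first coordinate `x₁` of a point of `ℝ^d`. -/
def firstCoord {d : ℕ} (ξ : Sp d) : ℝ :=
  if h : 0 < d then (EuclideanSpace.equiv (Fin d) ℝ) ξ ⟨0, h⟩ else 0

/-- The dispersion relation `α|ξ|² + βξ₁³ + γξ₁⁴`. -/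
def dispersion {d : ℕ} (α β γ : ℝ) (ξ : Sp d) : ℝ :=
  α * ‖ξ‖ ^ 2 + β * (firstCoord ξ) ^ 3 + γ * (firstCoord ξ) ^ 4

/-- The free Schrödinger propagator with higher-order anisotropic dispersion,
`W(t) = 𝓕⁻¹ e^{i(α|ξ|² + βξ₁³ + γξ₁⁴)t} 𝓕`. -/
def propagator {d : ℕ} (α β γ : ℝ) (t : ℝ) (f : Sp d → ℂ) : Sp d → ℂ :=
  𝓕⁻ (fun ξ => Complex.exp (Complex.I * ((dispersion α β γ ξ * t : ℝ) : ℂ)) * 𝓕 f ξ)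

/-- The Duhamel integral `∫₀ᵗ W(t-τ) F(τ) dτ`. -/
def duhamel {d : ℕ} (α β γ : ℝ) (F : ℝ → Sp d → ℂ) : ℝ → Sp d → ℂ :=
  fun t x => ∫ τ in (0:ℝ)..t, propagator α β γ (t - τ) (F τ) x

/-- The Duhamel integral from `-∞`: `∫_{-∞}^t W(t-τ) F(τ) dτ`. -/
def duhamelFrom {d : ℕ} (α β γ : ℝ) (F : ℝ → Sp d → ℂ) : ℝ → Sp d → ℂ :=
  fun t x => ∫ τ in Set.Iic t, propagator α β γ (t - τ) (F τ) x

/-- A power-like nonlinearity `π^{m+1}(z)`: a fixed product of `m+1` factors,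
each equal to `z` or its complex conjugate, together with a sign `c ∈ {1, -1}`. -/
def powerNonlin (m : ℕ) (c : ℂ) (ε : Fin (m + 1) → Bool) (z : ℂ) : ℂ :=
  c * ∏ j, (if ε j then (starRingEnd ℂ) z else z)

/-- The exponential nonlinearity `f(z) = λ(e^{ρ|z|²} - 1)z`. -/
def expNonlin (lam : ℂ) (ρ : ℝ) (z : ℂ) : ℂ :=
  lam * (Complex.exp (((ρ * ‖z‖ ^ 2 : ℝ) : ℂ)) - 1) * z

/-- `c_γ = 2` if `γ ≠ 0` and `c_γ = 3` if `γ = 0`. -/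
def cgam (γ : ℝ) : ℝ := if γ ≠ 0 then 2 else 3

/-- The effective dimension `d - 1/c_γ`. -/
def dEff (d : ℕ) (γ : ℝ) : ℝ := (d : ℝ) - (cgam γ)⁻¹

/-- The minimal power `m₀ = ⌈4/(d - 1/c_γ)⌉`. -/
def mMin (d : ℕ) (γ : ℝ) : ℤ := ⌈4 / dEff d γ⌉

/-- The interval `I_{m,d} = [1/(2(m+1)), 1/(m₀+1)]` of admissible `1/r`. -/
def Iset (m d : ℕ) (γ : ℝ) : Set ℝ :=
  Set.Icc (1 / (2 * ((m : ℝ) + 1))) (1 / ((mMin d γ : ℝ) + 1))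

/-- The effective nonlinearity `l = min(⌊r⌋ - 1, m)`. -/
def leff (r : ℝ) (m : ℕ) : ℤ := min (⌊r⌋ - 1) (m : ℤ)

/-- The lower endpoint of `J_{r,d}`. -/
def Jlo (r : ℝ) (m d : ℕ) (γ : ℝ) : ℝ :=
  1 / 2 - 2 / (r * dEff d γ) -
    (1 / (2 * ((leff r m : ℝ) + 1))) * ((leff r m : ℝ) - 4 / dEff d γ)

/-- The upper endpoint of `J_{r,d}`. -/
def Jhi (r : ℝ) (d : ℕ) (γ : ℝ) : ℝ := 1 / 2 - 2 / (r * dEff d γ)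

/-- The interval `J_{r,d}` of admissible `1/p`. -/
def Jset (r : ℝ) (m d : ℕ) (γ : ℝ) : Set ℝ := Set.Icc (Jlo r m d γ) (Jhi r d γ)

/-- A pair `(p, r) ∈ [2,∞] × [2,∞]` is admissible if
`2/r + (d - 1/c_γ)/p = (d - 1/c_γ)/2`. -/
def Admissible (d : ℕ) (γ : ℝ) (p r : ℝ≥0∞) : Prop :=
  2 ≤ p ∧ 2 ≤ r ∧ 2 * (r⁻¹).toReal + dEff d γ * (p⁻¹).toReal = dEff d γ * (1 / 2)

/-- The regularity condition on `s`: `s ≥ 0` if `q = 1` and `s > d(1 - 1/q) = d/q'`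
if `q > 1`. -/
def sCond (d : ℕ) (q : ℝ≥0∞) (s : ℝ) : Prop :=
  (q = 1 ∧ 0 ≤ s) ∨ (1 < q ∧ (d : ℝ) * (1 - (q⁻¹).toReal) < s)

/-- `u` is a global mild solution of the higher-order NLS with nonlinearity `f`
and initial datum `u₀`: `u(t) = W(t)u₀ + ∫₀ᵗ W(t-τ) f(u(τ)) dτ`. -/
def IsMildSolution {d : ℕ} (α β γ : ℝ) (f : ℂ → ℂ) (u₀ : Sp d → ℂ)
    (u : ℝ → Sp d → ℂ) : Prop :=
  ∀ t x, u t x = propagator α β γ t u₀ x + duhamel α β γ (fun τ y => f (u τ y)) t x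

/-- `u` solves the final-state (scattering) equation with datum `u₀⁻` at `-∞`:
`u(t) = W(t)u₀⁻ + ∫_{-∞}^t W(t-τ) f(u(τ)) dτ`. -/
def IsMildSolutionFrom {d : ℕ} (α β γ : ℝ) (f : ℂ → ℂ) (u₀ : Sp d → ℂ)
    (u : ℝ → Sp d → ℂ) : Prop :=
  ∀ t x, u t x = propagator α β γ t u₀ x + duhamelFrom α β γ (fun τ y => f (u τ y)) t x

end

lemma integral_fourierInv_mul_eq_flip {d : ℕ} {f g : Sp d → ℂ} (hf : Integrable f)
    (hg : Integrable g) : ∫ x, 𝓕⁻ f x * g x = ∫ x, f x * 𝓕⁻ g x := by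
  have key := VectorFourier.integral_fourierIntegral_smul_eq_flip (μ := volume) (ν := volume)
    (e := Real.fourierChar) (L := -(innerₗ (Sp d))) (f := f) (g := g) Real.continuous_fourierChar
    (by simp only [LinearMap.neg_apply, innerₗ_apply_apply]; fun_prop) hf hg
  have h1 : ∀ x, VectorFourier.fourierIntegral Real.fourierChar volume (-(innerₗ (Sp d))) f x
      = 𝓕⁻ f x := by
    intro x
    simp [VectorFourier.fourierIntegral, Real.fourierInv_eq]
  have h2 : ∀ x, VectorFourier.fourierIntegral Real.fourierChar volume (-(innerₗ (Sp d))).flip g x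
      = 𝓕⁻ g x := by
    intro x
    simp [VectorFourier.fourierIntegral, Real.fourierInv_eq, real_inner_comm]
  simpa only [h1, h2, smul_eq_mul] using key

lemma continuous_fourierInv_of_integrable {d : ℕ} {f : Sp d → ℂ} (hf : Integrable f) :
    Continuous (𝓕⁻ f) := by
  have := VectorFourier.fourierIntegral_continuous (μ := volume)
    (e := Real.fourierChar) (L := -(innerₗ (Sp d))) Real.continuous_fourierChar
    (by simp only [LinearMap.neg_apply, innerₗ_apply_apply]; fun_prop) hf
  convert this using 1
  ext x
  simp [VectorFourier.fourierIntegral, Real.fourierInv_eq]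

/-- Plancherel's theorem for the inverse Fourier integral of a function in `L¹ ∩ L²`. -/
lemma eLpNorm_fourierInv_two {d : ℕ} {f : Sp d → ℂ} (hf : Integrable f) (hf2 : MemLp f 2) :
    eLpNorm (𝓕⁻ f) 2 volume = eLpNorm f 2 volume := by
  set F : Lp ℂ 2 (volume : Measure (Sp d)) := hf2.toLp f with hF
  have hae : 𝓕⁻ f =ᵐ[volume] ((𝓕⁻ F : Lp ℂ 2 (volume : Measure (Sp d))) : Sp d → ℂ) := by
    refine ae_eq_of_integral_contDiff_smul_eq
      (continuous_fourierInv_of_integrable hf).locallyIntegrable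
      ((Lp.memLp _).locallyIntegrable (by norm_num)) fun g hg hgs => ?_
    have hg' : ContDiff ℝ (⊤ : ℕ∞) (fun x => (g x : ℂ)) :=
      Complex.ofRealCLM.contDiff.comp hg
    have hgs' : HasCompactSupport (fun x => (g x : ℂ)) := hgs.comp_left Complex.ofReal_zero
    set φ : SchwartzMap (Sp d) ℂ := hgs'.toSchwartzMap hg' with hφ
    have hφa : ∀ x, φ x = (g x : ℂ) := fun x => rfl
    have h1 : ∫ x, g x • 𝓕⁻ f x = ∫ x, 𝓕⁻ f x * φ x := by
      congr 1; ext x; rw [hφa, Complex.real_smul, mul_comm]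
    have h2 : ∫ x, g x • (𝓕⁻ F : Lp ℂ 2 (volume : Measure (Sp d))) x
        = ∫ x, φ x • (𝓕⁻ F : Lp ℂ 2 (volume : Measure (Sp d))) x := by
      congr 1
    rw [h1, h2, ← Lp.toTemperedDistribution_apply,
      ← Lp.fourierInv_toTemperedDistribution_eq, TemperedDistribution.fourierInv_apply,
      Lp.toTemperedDistribution_apply, integral_fourierInv_mul_eq_flip hf φ.integrable]
    refine integral_congr_ae ?_
    filter_upwards [hf2.coeFn_toLp] with x hx
    rw [hF, hx, smul_eq_mul, mul_comm, SchwartzMap.fourierInv_coe]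
  rw [eLpNorm_congr_ae hae, ← ENNReal.ofReal_toReal (Lp.eLpNorm_ne_top _), ← Lp.norm_def,
    ← Lp.norm_fourier_eq, FourierTransform.fourier_fourierInv_eq, Lp.norm_toLp,
    ENNReal.ofReal_toReal hf2.eLpNorm_ne_top]

lemma BoxPartition.hasCompactSupport {d : ℕ} (P : BoxPartition d) (k : Fin d → ℤ) :
    HasCompactSupport (P.σ k) :=
  HasCompactSupport.intro (isCompact_closedBall _ (Real.sqrt d)) fun x hx => by
    by_contra h
    exact hx (Metric.ball_subset_closedBall (P.support_subset k h))

lemma BoxPartition.continuous {d : ℕ} (P : BoxPartition d) (k : Fin d → ℤ) :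
    Continuous (P.σ k) := (P.smooth k).continuous

lemma fourierInv_sub_eq_fourier {d : ℕ} (f : Sp d → ℂ) (x y : Sp d) :
    𝓕⁻ f (x - y) = 𝓕 (fun ξ => ((Real.fourierChar (inner ℝ ξ x) : Circle) : ℂ) * f ξ) y := by
  rw [Real.fourierInv_eq, Real.fourier_eq]
  congr 1; ext ξ
  rw [inner_sub_right, sub_eq_add_neg, AddChar.map_add_eq_mul, mul_comm, Circle.smul_def,
    Circle.smul_def, Circle.coe_mul, smul_eq_mul, smul_eq_mul, mul_assoc]

lemma integral_fourier_mul_eq_flip {d : ℕ} {f g : Sp d → ℂ} (hf : Integrable f)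
    (hg : Integrable g) : ∫ x, 𝓕 f x * g x = ∫ x, f x * 𝓕 g x := by
  have key := VectorFourier.integral_fourierIntegral_smul_eq_flip (μ := volume) (ν := volume)
    (e := Real.fourierChar) (L := innerₗ (Sp d)) (f := f) (g := g) Real.continuous_fourierChar
    (by simp only [innerₗ_apply_apply]; fun_prop) hf hg
  rw [flip_innerₗ] at key
  exact key

lemma BoxPartition.modulated_continuous {d : ℕ} (P : BoxPartition d) (k : Fin d → ℤ) (x : Sp d) :
    Continuous (fun ξ => ((Real.fourierChar (inner ℝ ξ x) : Circle) : ℂ) * P.σ k ξ) := by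
  have := P.continuous k
  have := Real.continuous_fourierChar
  fun_prop

lemma BoxPartition.modulated_integrable {d : ℕ} (P : BoxPartition d) (k : Fin d → ℤ) (x : Sp d) :
    Integrable (fun ξ => ((Real.fourierChar (inner ℝ ξ x) : Circle) : ℂ) * P.σ k ξ) :=
  (P.modulated_continuous k x).integrable_of_hasCompactSupport (P.hasCompactSupport k).mul_left

/-- The box operator on integrable functions is the Fourier multiplier with symbol `σ_k`. -/
lemma boxOp_of_integrable {d : ℕ} (P : BoxPartition d) (k : Fin d → ℤ) {f : Sp d → ℂ}
    (hf : Integrable f) : boxOp P k f = 𝓕⁻ (fun ξ => P.σ k ξ * 𝓕 f ξ) := by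
  ext x
  simp only [boxOp, fourierInv_sub_eq_fourier]
  rw [integral_fourier_mul_eq_flip (P.modulated_integrable k x) hf, Real.fourierInv_eq]
  congr 1; ext ξ
  rw [Circle.smul_def, smul_eq_mul, mul_assoc]

lemma boxOp_fourierInv {d : ℕ} (P : BoxPartition d) (k : Fin d → ℤ) {h : Sp d → ℂ}
    (hh : Integrable h) : boxOp P k (𝓕⁻ h) = 𝓕⁻ (fun ξ => P.σ k ξ * h ξ) := by
  ext x
  have hintegrable : Integrable (𝓕 (fun ξ => ((Real.fourierChar (inner ℝ ξ x) : Circle) : ℂ) * P.σ k ξ))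
      volume := by
    set φ : SchwartzMap (Sp d) ℂ := (P.hasCompactSupport k).toSchwartzMap (P.smooth k) with hφ
    have : (𝓕 (fun ξ => ((Real.fourierChar (inner ℝ ξ x) : Circle) : ℂ) * P.σ k ξ)) =
        fun y => (𝓕⁻ φ) (x - y) := by
      ext y
      rw [← fourierInv_sub_eq_fourier, SchwartzMap.fourierInv_coe]
      rfl
    rw [this]
    exact (SchwartzMap.integrable (𝓕⁻ φ)).comp_sub_left x
  simp only [boxOp, fourierInv_sub_eq_fourier]
  simp_rw [mul_comm _ (𝓕⁻ h _)]
  rw [integral_fourierInv_mul_eq_flip hh hintegrable,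
    (P.modulated_continuous k x).fourierInv_fourier_eq (P.modulated_integrable k x) hintegrable,
    Real.fourierInv_eq]
  congr 1; ext ξ
  rw [Circle.smul_def, smul_eq_mul]
  ring

/-- An increasing function with slope at least `lam` on `[a, b]` changes sign at most once. -/
lemma exists_sign_change {f : ℝ → ℝ} {a b lam : ℝ} (hab : a ≤ b)
    (hf : ContinuousOn f (Set.Icc a b))
    (hs : ∀ x ∈ Set.Icc a b, ∀ y ∈ Set.Icc a b, x ≤ y → lam * (y - x) ≤ f y - f x) :
    ∃ z ∈ Set.Icc a b, (∀ x ∈ Set.Icc a b, z < x → lam * (x - z) ≤ f x) ∧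
      (∀ x ∈ Set.Icc a b, x < z → f x ≤ -(lam * (z - x))) := by
  have ha : a ∈ Set.Icc a b := ⟨le_rfl, hab⟩
  have hb : b ∈ Set.Icc a b := ⟨hab, le_rfl⟩
  rcases le_total 0 (f a) with h0 | h0
  · exact ⟨a, ha, fun x hx h => by linarith [hs a ha x hx h.le],
      fun x hx h => absurd h (not_lt.2 hx.1)⟩
  rcases le_total (f b) 0 with h1 | h1
  · exact ⟨b, hb, fun x hx h => absurd h (not_lt.2 hx.2),
      fun x hx h => by linarith [hs x hx b hb h.le]⟩
  obtain ⟨z, hz, hz0⟩ := intermediate_value_Icc hab hf ⟨h0, h1⟩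
  exact ⟨z, hz, fun x hx h => by linarith [hs z hz x hx h.le],
    fun x hx h => by linarith [hs x hx z hz h.le]⟩

lemma norm_exp_I_mul_ofReal' (y : ℝ) : ‖Complex.exp (Complex.I * (y : ℂ))‖ = 1 := by
  rw [mul_comm]; exact Complex.norm_exp_ofReal_mul_I y

open Polynomial in
lemma norm_integral_exp_polynomial_le (P : ℝ[X]) (a b : ℝ) (hab : a ≤ b) :
    ‖∫ x in a..b, Complex.exp (Complex.I * ((P.eval x : ℝ) : ℂ))‖ ≤ b - a := by
  have := intervalIntegral.norm_integral_le_of_norm_le_const (a := a) (b := b) (C := 1)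
    (f := fun x => Complex.exp (Complex.I * ((P.eval x : ℝ) : ℂ)))
    (fun x _ => (norm_exp_I_mul_ofReal' _).le)
  rwa [one_mul, abs_of_nonneg (by linarith)] at this

open Polynomial in
lemma norm_integral_exp_neg_polynomial (P : ℝ[X]) (a b : ℝ) :
    ‖∫ x in a..b, Complex.exp (Complex.I * (((-P).eval x : ℝ) : ℂ))‖ =
      ‖∫ x in a..b, Complex.exp (Complex.I * ((P.eval x : ℝ) : ℂ))‖ := by
  have : ∀ x : ℝ, Complex.exp (Complex.I * (((-P).eval x : ℝ) : ℂ)) =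
      (starRingEnd ℂ) (Complex.exp (Complex.I * ((P.eval x : ℝ) : ℂ))) := by
    intro x
    rw [← Complex.exp_conj]
    simp
  simp_rw [this, intervalIntegral.intervalIntegral_eq_integral_uIoc, norm_smul]
  rw [integral_conj, RCLike.norm_conj]

open Polynomial in
/-- First derivative test of van der Corput. -/
lemma vanDerCorput_one (P : ℝ[X]) {a b lam : ℝ} (hab : a ≤ b) (hlam : 0 < lam)
    (h1 : ∀ x ∈ Set.Icc a b, lam ≤ |P.derivative.eval x|)
    (h2 : ∀ x ∈ Set.Icc a b, 0 ≤ P.derivative.derivative.eval x) :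
    ‖∫ x in a..b, Complex.exp (Complex.I * ((P.eval x : ℝ) : ℂ))‖ ≤ 4 / lam := by
  set p' : ℝ → ℝ := fun x => P.derivative.eval x with hp'
  set p'' : ℝ → ℝ := fun x => P.derivative.derivative.eval x with hp''
  have hne : ∀ x ∈ Set.Icc a b, p' x ≠ 0 := fun x hx h => by
    have := h1 x hx; rw [show P.derivative.eval x = 0 from h] at this; simp at this; linarith
  have hu : Set.uIcc a b = Set.Icc a b := Set.uIcc_of_le hab
  have hcp' : Continuous p' := P.derivative.continuous
  have hcp'' : Continuous p'' := P.derivative.derivative.continuous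
  -- the inverse derivative
  have hinv : ∀ x ∈ Set.Icc a b, HasDerivAt (fun y => (p' y)⁻¹) (-(p'' x) / (p' x) ^ 2) x :=
    fun x hx => (P.derivative.hasDerivAt x).inv (hne x hx)
  have hcd : ContinuousOn (fun x => -(p'' x) / (p' x) ^ 2) (Set.uIcc a b) := by
    rw [hu]
    exact hcp''.neg.continuousOn.div (hcp'.pow 2).continuousOn
      fun x hx => pow_ne_zero _ (hne x hx)
  have hFTC : ∫ x in a..b, -(p'' x) / (p' x) ^ 2 = (p' b)⁻¹ - (p' a)⁻¹ :=
    intervalIntegral.integral_eq_sub_of_hasDerivAt (fun x hx => hinv x (hu ▸ hx))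
      hcd.intervalIntegrable
  have hle : ∀ x ∈ Set.Icc a b, |(p' x)⁻¹| ≤ 1 / lam := fun x hx => by
    rw [abs_inv, inv_eq_one_div]
    exact one_div_le_one_div_of_le hlam (h1 x hx)
  have hE : ∀ x, HasDerivAt (fun y : ℝ => Complex.exp (Complex.I * ((P.eval y : ℝ) : ℂ)))
      (Complex.exp (Complex.I * ((P.eval x : ℝ) : ℂ)) * (Complex.I * ((p' x : ℝ) : ℂ))) x :=
    fun x => (((P.hasDerivAt x).ofReal_comp).const_mul Complex.I).cexp
  have hV : ∀ x ∈ Set.uIcc a b, HasDerivAt (fun y : ℝ => (((p' y)⁻¹ : ℝ) : ℂ))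
      (((-(p'' x) / (p' x) ^ 2 : ℝ)) : ℂ) x := fun x hx => (hinv x (hu ▸ hx)).ofReal_comp
  have hcE : Continuous fun y : ℝ => Complex.exp (Complex.I * ((P.eval y : ℝ) : ℂ)) := by
    have := P.continuous
    fun_prop
  have hparts := intervalIntegral.integral_mul_deriv_eq_deriv_mul hV (fun x _ => hE x)
    (Complex.continuous_ofReal.comp_continuousOn hcd).intervalIntegrable
    (Continuous.intervalIntegrable (by fun_prop) _ _)
  have hlhs : ∫ x in a..b, (((p' x)⁻¹ : ℝ) : ℂ) *
      (Complex.exp (Complex.I * ((P.eval x : ℝ) : ℂ)) * (Complex.I * ((p' x : ℝ) : ℂ))) =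
      Complex.I * ∫ x in a..b, Complex.exp (Complex.I * ((P.eval x : ℝ) : ℂ)) := by
    rw [← intervalIntegral.integral_const_mul]
    refine intervalIntegral.integral_congr fun x hx => ?_
    have : ((p' x : ℝ) : ℂ) ≠ 0 := by exact_mod_cast hne x (hu ▸ hx)
    push_cast
    field_simp
  have hn : ‖∫ x in a..b, Complex.exp (Complex.I * ((P.eval x : ℝ) : ℂ))‖ =
      ‖Complex.I * ∫ x in a..b, Complex.exp (Complex.I * ((P.eval x : ℝ) : ℂ))‖ := by
    simp
  have ha : a ∈ Set.Icc a b := ⟨le_rfl, hab⟩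
  have hb : b ∈ Set.Icc a b := ⟨hab, le_rfl⟩
  rw [hn, ← hlhs, hparts]
  have hrem : ‖∫ x in a..b, (((-(p'' x) / (p' x) ^ 2 : ℝ)) : ℂ) *
      Complex.exp (Complex.I * ((P.eval x : ℝ) : ℂ))‖ ≤ (p' a)⁻¹ - (p' b)⁻¹ := by
    have h3 : ∫ x in a..b, p'' x / (p' x) ^ 2 = (p' a)⁻¹ - (p' b)⁻¹ := by
      have : ∫ x in a..b, p'' x / (p' x) ^ 2 = -∫ x in a..b, -(p'' x) / (p' x) ^ 2 := by
        rw [← intervalIntegral.integral_neg]; congr 1; ext x; ring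
      rw [this, hFTC]; ring
    rw [← h3]
    refine intervalIntegral.norm_integral_le_of_norm_le hab ?_ ?_
    · refine Eventually.of_forall fun x hx => ?_
      rw [norm_mul, norm_exp_I_mul_ofReal', mul_one, Complex.norm_real, Real.norm_eq_abs,
        neg_div, abs_neg, abs_of_nonneg (div_nonneg (h2 x ⟨hx.1.le, hx.2⟩) (sq_nonneg _))]
    · refine ContinuousOn.intervalIntegrable ?_
      rw [hu]
      exact hcp''.continuousOn.div (hcp'.pow 2).continuousOn fun x hx => pow_ne_zero _ (hne x hx)
  calc _ ≤ ‖(((p' b)⁻¹ : ℝ) : ℂ) * Complex.exp (Complex.I * ((P.eval b : ℝ) : ℂ))‖ +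
        ‖(((p' a)⁻¹ : ℝ) : ℂ) * Complex.exp (Complex.I * ((P.eval a : ℝ) : ℂ))‖ +
        ((p' a)⁻¹ - (p' b)⁻¹) :=
      (norm_sub_le _ _).trans (add_le_add (norm_sub_le _ _) hrem)
    _ ≤ 1 / lam + 1 / lam + (1 / lam + 1 / lam) := by
      simp only [norm_mul, norm_exp_I_mul_ofReal', mul_one, Complex.norm_real, Real.norm_eq_abs]
      have := hle a ha
      have := hle b hb
      have := le_abs_self (p' a)⁻¹
      have := neg_abs_le (p' b)⁻¹
      linarith
    _ = 4 / lam := by ring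

open Polynomial in
/-- The splitting step in the proof of van der Corput's lemma. -/
lemma vanDerCorput_step (P Q : ℝ[X]) {a b lam δ B : ℝ} (hab : a ≤ b) (hlam : 0 < lam) (hδ : 0 < δ)
    (hB : 0 ≤ B)
    (hQ : ∀ x ∈ Set.Icc a b, lam ≤ Q.derivative.eval x)
    (hpos : ∀ a' b', a ≤ a' → a' ≤ b' → b' ≤ b → (∀ x ∈ Set.Icc a' b', δ ≤ Q.eval x) →
      ‖∫ x in a'..b', Complex.exp (Complex.I * ((P.eval x : ℝ) : ℂ))‖ ≤ B)
    (hneg : ∀ a' b', a ≤ a' → a' ≤ b' → b' ≤ b → (∀ x ∈ Set.Icc a' b', Q.eval x ≤ -δ) →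
      ‖∫ x in a'..b', Complex.exp (Complex.I * ((P.eval x : ℝ) : ℂ))‖ ≤ B) :
    ‖∫ x in a..b, Complex.exp (Complex.I * ((P.eval x : ℝ) : ℂ))‖ ≤ 2 * B + 2 * (δ / lam) := by
  have hs : ∀ x ∈ Set.Icc a b, ∀ y ∈ Set.Icc a b, x ≤ y → lam * (y - x) ≤ Q.eval y - Q.eval x :=
    (convex_Icc a b).mul_sub_le_image_sub_of_le_deriv Q.continuous.continuousOn
      Q.differentiable.differentiableOn fun x hx => by
        rw [Q.deriv]; exact hQ x (interior_subset hx)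
  obtain ⟨z, hz, hz1, hz2⟩ := exists_sign_change hab Q.continuous.continuousOn hs
  set E : ℝ → ℂ := fun x => Complex.exp (Complex.I * ((P.eval x : ℝ) : ℂ)) with hEdef
  have hcE : Continuous E := by
    have := P.continuous
    fun_prop
  have hη : 0 < δ / lam := div_pos hδ hlam
  set c₁ := max a (z - δ / lam) with hc₁
  set c₂ := min b (z + δ / lam) with hc₂
  have hac₁ : a ≤ c₁ := le_max_left _ _
  have hc₁z : c₁ ≤ z := max_le hz.1 (by linarith)
  have hzc₂ : z ≤ c₂ := le_min hz.2 (by linarith)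
  have hc₂b : c₂ ≤ b := min_le_left _ _
  have i1 : ‖∫ x in a..c₁, E x‖ ≤ B := by
    rcases hac₁.eq_or_lt with h | h
    · rw [← h]; simpa using hB
    have hc : c₁ = z - δ / lam := by
      rcases max_choice a (z - δ / lam) with h' | h'
      · exact absurd h (by rw [hc₁, h']; simp)
      · exact h'
    refine hneg a c₁ le_rfl hac₁ (by linarith) fun x hx => ?_
    have hxz : x < z := by linarith [hx.2]
    refine (hz2 x ⟨hx.1, by linarith [hx.2]⟩ hxz).trans ?_
    have : lam * (δ / lam) ≤ lam * (z - x) := by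
      gcongr; linarith [hx.2]
    rw [mul_div_cancel₀ _ hlam.ne'] at this
    linarith
  have i2 : ‖∫ x in c₂..b, E x‖ ≤ B := by
    rcases hc₂b.eq_or_lt with h | h
    · rw [h]; simpa using hB
    have hc : c₂ = z + δ / lam := by
      rcases min_choice b (z + δ / lam) with h' | h'
      · exact absurd h (by rw [hc₂, h']; simp)
      · exact h'
    refine hpos c₂ b (by linarith) hc₂b le_rfl fun x hx => ?_
    have hxz : z < x := by linarith [hx.1]
    refine le_trans ?_ (hz1 x ⟨by linarith [hx.1], hx.2⟩ hxz)
    have : lam * (δ / lam) ≤ lam * (x - z) := by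
      gcongr; linarith [hx.1]
    rwa [mul_div_cancel₀ _ hlam.ne'] at this
  have i3 : ‖∫ x in c₁..c₂, E x‖ ≤ 2 * (δ / lam) := by
    refine (norm_integral_exp_polynomial_le P c₁ c₂ (by linarith)).trans ?_
    have := le_max_right a (z - δ / lam)
    have := min_le_right b (z + δ / lam)
    linarith
  have hsplit : ∫ x in a..b, E x = (∫ x in a..c₁, E x) + (∫ x in c₁..c₂, E x) +
      ∫ x in c₂..b, E x := by
    rw [intervalIntegral.integral_add_adjacent_intervals (hcE.intervalIntegrable _ _)
      (hcE.intervalIntegrable _ _), intervalIntegral.integral_add_adjacent_intervals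
      (hcE.intervalIntegrable _ _) (hcE.intervalIntegrable _ _)]
  rw [hsplit]
  have := norm_add_le ((∫ x in a..c₁, E x) + (∫ x in c₁..c₂, E x)) (∫ x in c₂..b, E x)
  have := norm_add_le (∫ x in a..c₁, E x) (∫ x in c₁..c₂, E x)
  linarith

open Polynomial in
/-- **Van der Corput's lemma** for polynomial phases: a lower bound for the derivative of order
`k + 2` gives decay of order `1 / (k + 2)`. -/
lemma vanDerCorput (k : ℕ) : ∃ C : ℝ, 0 < C ∧ ∀ (P : ℝ[X]) (a b lam : ℝ), a ≤ b → 0 < lam →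
    (∀ x ∈ Set.Icc a b, lam ≤ (derivative^[k + 2] P).eval x) →
    ‖∫ x in a..b, Complex.exp (Complex.I * ((P.eval x : ℝ) : ℂ))‖ ≤
      C * lam ^ (-(1 / ((k : ℝ) + 2))) := by
  induction k with
  | zero =>
    refine ⟨10, by norm_num, fun P a b lam hab hlam h => ?_⟩
    have hδ : 0 < lam ^ (1 / 2 : ℝ) := Real.rpow_pos_of_pos hlam _
    have e1 : (lam ^ (1 / 2 : ℝ)) / lam = lam ^ (-(1 / 2) : ℝ) := by
      rw [div_eq_iff hlam.ne', ← Real.rpow_add_one hlam.ne']; norm_num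
    have e2 : 4 / lam ^ (1 / 2 : ℝ) = 4 * lam ^ (-(1 / 2) : ℝ) := by
      rw [Real.rpow_neg hlam.le]; rfl
    have h' : ∀ x ∈ Set.Icc a b, lam ≤ P.derivative.derivative.eval x := h
    have := vanDerCorput_step P P.derivative (δ := lam ^ (1 / 2 : ℝ))
      (B := 4 / lam ^ (1 / 2 : ℝ)) hab hlam hδ (by positivity) h'
      (fun a' b' h1 h2 h3 h4 => vanDerCorput_one P h2 hδ
        (fun x hx => (h4 x hx).trans (le_abs_self _))
        (fun x hx => hlam.le.trans (h' x ⟨h1.trans hx.1, hx.2.trans h3⟩)))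
      (fun a' b' h1 h2 h3 h4 => vanDerCorput_one P h2 hδ
        (fun x hx => (by linarith [h4 x hx] : _ ≤ -(P.derivative.eval x)).trans (neg_le_abs _))
        (fun x hx => hlam.le.trans (h' x ⟨h1.trans hx.1, hx.2.trans h3⟩)))
    rw [e1, e2] at this
    simp only [Nat.cast_zero, zero_add]
    linarith
  | succ k ih =>
    obtain ⟨C, hC, ih⟩ := ih
    refine ⟨2 * C + 2, by positivity, fun P a b lam hab hlam h => ?_⟩
    set e : ℝ := 1 / ((k : ℝ) + 3) with he
    have hk2 : (0 : ℝ) < (k : ℝ) + 2 := by positivity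
    have hk3 : (0 : ℝ) < (k : ℝ) + 3 := by positivity
    have hδ : 0 < lam ^ (1 - e) := Real.rpow_pos_of_pos hlam _
    have e1 : (lam ^ (1 - e)) / lam = lam ^ (-e) := by
      rw [div_eq_iff hlam.ne', ← Real.rpow_add_one hlam.ne']; congr 1; ring
    have e2 : (lam ^ (1 - e)) ^ (-(1 / ((k : ℝ) + 2))) = lam ^ (-e) := by
      rw [← Real.rpow_mul hlam.le]; congr 1; rw [he]; field_simp; ring
    have h' : ∀ x ∈ Set.Icc a b, lam ≤ (derivative^[k + 2] P).derivative.eval x := by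
      intro x hx
      have := h x hx
      rwa [show k + 1 + 2 = (k + 2) + 1 by ring, Function.iterate_succ_apply'] at this
    have := vanDerCorput_step P (derivative^[k + 2] P) (δ := lam ^ (1 - e))
      (B := C * lam ^ (-e)) hab hlam hδ (by positivity) h'
      (fun a' b' h1 h2 h3 h4 => (ih P a' b' _ h2 hδ h4).trans_eq (by rw [e2]))
      (fun a' b' h1 h2 h3 h4 => by
        rw [← norm_integral_exp_neg_polynomial]
        refine (ih (-P) a' b' _ h2 hδ fun x hx => ?_).trans_eq (by rw [e2])
        rw [iterate_derivative_neg, eval_neg]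
        linarith [h4 x hx])
    rw [e1] at this
    have e3 : (1 / (((k + 1 : ℕ) : ℝ) + 2)) = e := by rw [he]; push_cast; ring
    rw [e3]
    linarith

open Polynomial in
/-- Van der Corput's lemma when the derivative of order `k + 2` is a nonzero constant. -/
lemma vanDerCorput_const (k : ℕ) : ∃ K : ℝ, 0 < K ∧ ∀ (P : ℝ[X]) (a b c : ℝ), a ≤ b → c ≠ 0 →
    derivative^[k + 2] P = C c →
    ‖∫ x in a..b, Complex.exp (Complex.I * ((P.eval x : ℝ) : ℂ))‖ ≤
      K * |c| ^ (-(1 / ((k : ℝ) + 2))) := by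
  obtain ⟨K, hK, h⟩ := vanDerCorput k
  refine ⟨K, hK, fun P a b c hab hc hP => ?_⟩
  rcases lt_or_gt_of_ne hc with h0 | h0
  · rw [← norm_integral_exp_neg_polynomial]
    refine h (-P) a b |c| hab (abs_pos.2 hc) fun x _ => ?_
    rw [iterate_derivative_neg, hP, eval_neg, eval_C, abs_of_neg h0]
  · refine h P a b |c| hab (abs_pos.2 hc) fun x _ => ?_
    rw [hP, eval_C, abs_of_pos h0]

open Polynomial in
lemma oscillatory_quadratic (α : ℝ) (hα : α ≠ 0) : ∃ C : ℝ, 0 < C ∧ ∀ (t y a b : ℝ), t ≠ 0 →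
    a ≤ b → ‖∫ x in a..b, Complex.exp (Complex.I * ((y * x + t * (α * x ^ 2) : ℝ) : ℂ))‖ ≤
      C * |t| ^ (-(1 / 2) : ℝ) := by
  obtain ⟨K, hK, h⟩ := vanDerCorput_const 0
  refine ⟨K * |2 * α| ^ (-(1 / 2) : ℝ), by positivity, fun t y a b ht hab => ?_⟩
  have := h (C y * X + C (t * α) * X ^ 2) a b (t * (2 * α)) hab (by simp [ht, hα]) (by
    simp only [zero_add, Function.iterate_succ, Function.iterate_zero, Function.comp, id]
    simp
    simp only [map_ofNat]
    ring)
  simp only [eval_add, eval_mul, eval_C, eval_X, eval_pow, Nat.cast_zero, zero_add] at this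
  rw [abs_mul, Real.mul_rpow (abs_nonneg _) (abs_nonneg _)] at this
  calc _ = _ := by simp only [mul_assoc]
    _ ≤ _ := this
    _ = _ := by ring

open Polynomial in
lemma oscillatory_higher (α β γ : ℝ) (hβγ : (β, γ) ≠ (0, 0)) : ∃ C : ℝ, 0 < C ∧
    ∀ (t y a b : ℝ), t ≠ 0 → a ≤ b →
      ‖∫ x in a..b, Complex.exp (Complex.I *
        ((y * x + t * (α * x ^ 2 + β * x ^ 3 + γ * x ^ 4) : ℝ) : ℂ))‖ ≤
      C * |t| ^ (-(1 / 2 - (cgam γ)⁻¹ / 2)) := by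
  by_cases hγ : γ = 0
  · have hβ : β ≠ 0 := by rintro rfl; exact hβγ (by rw [hγ])
    obtain ⟨K, hK, h⟩ := vanDerCorput_const 1
    refine ⟨K * |6 * β| ^ (-(1 / 3) : ℝ), by positivity, fun t y a b ht hab => ?_⟩
    have := h (C y * X + C (t * α) * X ^ 2 + C (t * β) * X ^ 3) a b (t * (6 * β)) hab
      (by simp [ht, hβ]) (by
        simp only [Nat.reduceAdd, Function.iterate_succ, Function.iterate_zero, Function.comp, id]
        simp
        simp only [map_ofNat]
        ring)
    simp only [eval_add, eval_mul, eval_C, eval_X, eval_pow, Nat.cast_one] at this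
    rw [abs_mul, Real.mul_rpow (abs_nonneg _) (abs_nonneg _)] at this
    have e : -(1 / 2 - (cgam γ)⁻¹ / 2) = (-(1 / 3) : ℝ) := by simp [cgam, hγ]; norm_num
    rw [e]
    norm_num at this ⊢
    calc _ = _ := by simp only [hγ, Complex.ofReal_zero, zero_mul, add_zero, mul_add, ← mul_assoc, ← add_assoc]
      _ ≤ _ := this
      _ = _ := by ring
  · obtain ⟨K, hK, h⟩ := vanDerCorput_const 2
    refine ⟨K * |24 * γ| ^ (-(1 / 4) : ℝ), by positivity, fun t y a b ht hab => ?_⟩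
    have := h (C y * X + C (t * α) * X ^ 2 + C (t * β) * X ^ 3 + C (t * γ) * X ^ 4) a b
      (t * (24 * γ)) hab (by simp [ht, hγ]) (by
        simp only [Nat.reduceAdd, Function.iterate_succ, Function.iterate_zero, Function.comp, id]
        simp
        simp only [map_ofNat]
        ring)
    simp only [eval_add, eval_mul, eval_C, eval_X, eval_pow, Nat.cast_ofNat] at this
    rw [abs_mul, Real.mul_rpow (abs_nonneg _) (abs_nonneg _)] at this
    have e : -(1 / 2 - (cgam γ)⁻¹ / 2) = (-(1 / 4) : ℝ) := by simp [cgam, hγ]; norm_num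
    rw [e]
    norm_num at this ⊢
    calc _ = _ := by simp only [mul_add, ← mul_assoc, ← add_assoc]
      _ ≤ _ := this
      _ = _ := by ring

lemma ENNReal.mul_le_sq_add_sq (x y : ℝ≥0∞) : x * y ≤ x ^ 2 + y ^ 2 := by
  rcases le_total x y with h | h
  · calc x * y ≤ y * y := by gcongr
      _ = y ^ 2 := (sq y).symm
      _ ≤ _ := le_add_self
  · calc x * y ≤ x * x := by gcongr
      _ = x ^ 2 := (sq x).symm
      _ ≤ _ := le_self_add

/-- A symmetric form of Schur's test for convolution kernels on the line. -/
lemma lintegral_convolution_schur {k f g : ℝ → ℝ≥0∞} (hk : Measurable k) (hf : Measurable f)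
    (hg : Measurable g) :
    ∫⁻ t, ∫⁻ s, k (t - s) * (f t * g s) ≤ (∫⁻ τ, k τ) * ((∫⁻ t, f t ^ 2) + ∫⁻ t, g t ^ 2) := by
  have h1 : ∫⁻ t, ∫⁻ s, k (t - s) * f t ^ 2 = (∫⁻ τ, k τ) * ∫⁻ t, f t ^ 2 := by
    have : ∀ t, ∫⁻ s, k (t - s) * f t ^ 2 = (∫⁻ τ, k τ) * f t ^ 2 := by
      intro t
      rw [lintegral_mul_const _ (by fun_prop), lintegral_sub_left_eq_self k t]
    simp_rw [this]
    rw [lintegral_const_mul _ (by fun_prop)]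
  have h2 : ∫⁻ t, ∫⁻ s, k (t - s) * g s ^ 2 = (∫⁻ τ, k τ) * ∫⁻ t, g t ^ 2 := by
    rw [lintegral_lintegral_swap (by fun_prop)]
    have : ∀ s, ∫⁻ t, k (t - s) * g s ^ 2 = (∫⁻ τ, k τ) * g s ^ 2 := by
      intro s
      rw [lintegral_mul_const _ (by fun_prop), lintegral_sub_right_eq_self k s]
    simp_rw [this]
    rw [lintegral_const_mul _ (by fun_prop)]
  rw [mul_add, ← h1, ← h2, ← lintegral_add_left (by fun_prop)]
  refine lintegral_mono fun t => ?_
  rw [← lintegral_add_left (by fun_prop)]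
  refine lintegral_mono fun s => ?_
  rw [← mul_add]
  gcongr
  exact ENNReal.mul_le_sq_add_sq _ _

section HilbertValued

variable {H : Type*} [NormedAddCommGroup H] [InnerProductSpace ℂ H]

lemma enorm_inner_le (x y : H) : ‖inner ℂ x y‖ₑ ≤ ‖x‖ₑ * ‖y‖ₑ := by
  rw [← ofReal_norm, ← ofReal_norm, ← ofReal_norm, ← ENNReal.ofReal_mul (norm_nonneg _)]
  exact ENNReal.ofReal_le_ofReal (norm_inner_le_norm x y)

lemma enorm_sq_eq_enorm_inner (x : H) : ‖x‖ₑ ^ 2 = ‖inner ℂ x x‖ₑ := by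
  rw [inner_self_eq_norm_sq_to_K]
  rw [← ofReal_norm, ← ofReal_norm, ← ENNReal.ofReal_pow (norm_nonneg _)]
  simp

variable [CompleteSpace H]

lemma enorm_inner_integral_le_lintegral {X : Type*} [MeasurableSpace X] {μ : Measure X} {v : X → H}
    (hv : Integrable v μ) (w : H) : ‖inner ℂ (∫ t, v t ∂μ) w‖ₑ ≤ ∫⁻ t, ‖inner ℂ (v t) w‖ₑ ∂μ := by
  rw [← inner_conj_symm, ← integral_inner hv]
  refine (RCLike.enorm_conj _).le.trans ((enorm_integral_le_lintegral_enorm _).trans ?_)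
  refine lintegral_mono fun t => ?_
  rw [← inner_conj_symm]
  exact (RCLike.enorm_conj _).le

lemma enorm_inner_integral_integral_le {X Y : Type*} [MeasurableSpace X] [MeasurableSpace Y]
    {μ : Measure X} {ν : Measure Y} {v : X → H} {w : Y → H} (hv : Integrable v μ)
    (hw : Integrable w ν) :
    ‖inner ℂ (∫ t, v t ∂μ) (∫ s, w s ∂ν)‖ₑ ≤ ∫⁻ t, ∫⁻ s, ‖inner ℂ (v t) (w s)‖ₑ ∂ν ∂μ := by
  refine (enorm_inner_integral_le_lintegral hv _).trans (lintegral_mono fun t => ?_)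
  rw [← integral_inner hw]
  exact enorm_integral_le_lintegral_enorm _

/-- The `TT*` bound for a set of times. -/
lemma enorm_setIntegral_sq_le {v : ℝ → H} (hv : Integrable v) {k f : ℝ → ℝ≥0∞}
    (hk : Measurable k) (hf : Measurable f)
    (h : ∀ t s, ‖inner ℂ (v t) (v s)‖ₑ ≤ k (t - s) * (f t * f s)) {A : Set ℝ}
    (hA : MeasurableSet A) :
    ‖∫ t in A, v t‖ₑ ^ 2 ≤ 2 * (∫⁻ τ, k τ) * ∫⁻ t in A, f t ^ 2 := by
  rw [enorm_sq_eq_enorm_inner]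
  refine (enorm_inner_integral_integral_le hv.integrableOn hv.integrableOn).trans ?_
  have hfA : Measurable (A.indicator f) := hf.indicator hA
  have key := lintegral_convolution_schur hk hfA hfA
  have e : ∀ t, A.indicator f t ^ 2 = A.indicator (fun t => f t ^ 2) t := by
    intro t; by_cases ht : t ∈ A <;> simp [ht]
  simp_rw [e] at key
  rw [lintegral_indicator hA] at key
  refine le_trans ?_ (key.trans_eq (by ring))
  rw [← lintegral_indicator hA]
  refine lintegral_mono fun t => ?_
  by_cases ht : t ∈ A
  · rw [Set.indicator_of_mem ht, ← lintegral_indicator hA]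
    refine lintegral_mono fun s => ?_
    by_cases hs : s ∈ A
    · simpa [hs, ht] using h t s
    · simp [hs]
  · simp [ht]

/-- The dual form of Bessel's inequality for a continuous family of vectors. -/
lemma enorm_integral_smul_le {X : Type*} [MeasurableSpace X] {μ : Measure X} {h : X → H}
    (hB : ∀ g : H, ∫⁻ x, ‖inner ℂ (h x) g‖ₑ ^ 2 ∂μ ≤ ‖g‖ₑ ^ 2) {F : X → ℂ}
    (hF : Integrable (fun x => F x • h x) μ) (hFm : AEMeasurable F μ)
    (hhm : AEStronglyMeasurable h μ) :
    ‖∫ x, F x • h x ∂μ‖ₑ ≤ (∫⁻ x, ‖F x‖ₑ ^ 2 ∂μ) ^ (1 / 2 : ℝ) := by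
  set V := ∫ x, F x • h x ∂μ
  have h1 : ‖V‖ₑ ^ 2 ≤ (∫⁻ x, ‖F x‖ₑ ^ 2 ∂μ) ^ (1 / 2 : ℝ) * ‖V‖ₑ := by
    rw [enorm_sq_eq_enorm_inner]
    refine (enorm_inner_integral_le_lintegral hF _).trans ?_
    have : ∀ x, ‖inner ℂ (F x • h x) V‖ₑ = ‖F x‖ₑ * ‖inner ℂ (h x) V‖ₑ := by
      intro x
      rw [inner_smul_left, enorm_mul, RCLike.enorm_conj]
    simp_rw [this]
    refine (ENNReal.lintegral_mul_le_Lp_mul_Lq μ Real.HolderConjugate.two_two hFm.enorm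
      (AEMeasurable.enorm ((hhm.inner aestronglyMeasurable_const).aemeasurable))).trans ?_
    simp only [ENNReal.rpow_ofNat]
    gcongr
    calc _ ≤ (‖V‖ₑ ^ 2) ^ (1 / 2 : ℝ) := by gcongr; exact hB V
      _ = ‖V‖ₑ := by
        rw [← ENNReal.rpow_natCast, ← ENNReal.rpow_mul]; norm_num
  by_cases hV : ‖V‖ₑ = 0
  · simp [hV]
  rw [sq] at h1
  exact (ENNReal.mul_le_mul_iff_left hV enorm_ne_top).1 h1

end HilbertValued

lemma setLIntegral_abs_gt_rpow {σ J : ℝ} (hσ : 1 < σ) (hJ : 0 < J) :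
    ∫⁻ τ in {τ : ℝ | J < |τ|}, ENNReal.ofReal |τ| ^ (-σ) =
      ENNReal.ofReal (2 * J ^ (1 - σ) / (σ - 1)) := by
  have e : {τ : ℝ | J < |τ|} = Set.Ioi J ∪ Set.Iio (-J) := by
    ext τ; simp only [Set.mem_ofPred_eq, lt_abs, Set.mem_union, Set.mem_Ioi, Set.mem_Iio]
    constructor <;> rintro (h | h) <;> [left; right; left; right] <;> linarith
  have h1 : ∫⁻ τ in Set.Ioi J, ENNReal.ofReal |τ| ^ (-σ) =
      ENNReal.ofReal (J ^ (1 - σ) / (σ - 1)) := by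
    have : ∫⁻ τ in Set.Ioi J, ENNReal.ofReal |τ| ^ (-σ) =
        ∫⁻ τ in Set.Ioi J, ENNReal.ofReal (τ ^ (-σ)) := by
      refine setLIntegral_congr_fun measurableSet_Ioi fun τ hτ => ?_
      have h0 : 0 < τ := hJ.trans hτ
      rw [abs_of_pos h0, ENNReal.ofReal_rpow_of_pos h0]
    rw [this, ← ofReal_integral_eq_lintegral_ofReal
      (integrableOn_Ioi_rpow_of_lt (by linarith) hJ)]
    · rw [integral_Ioi_rpow_of_lt (by linarith) hJ]
      congr 1
      rw [show -σ + 1 = -(σ - 1) by ring, show 1 - σ = -(σ - 1) by ring, div_neg, neg_div, neg_neg]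
    · filter_upwards [ae_restrict_mem measurableSet_Ioi] with τ hτ
      exact Real.rpow_nonneg (hJ.trans hτ).le _
  have h2 : ∫⁻ τ in Set.Iio (-J), ENNReal.ofReal |τ| ^ (-σ) =
      ENNReal.ofReal (J ^ (1 - σ) / (σ - 1)) := by
    rw [← h1, ← lintegral_indicator measurableSet_Iio, ← lintegral_indicator measurableSet_Ioi,
      ← lintegral_neg_eq_self]
    refine lintegral_congr fun τ => ?_
    simp only [Set.indicator_apply, Set.mem_Iio, Set.mem_Ioi, abs_neg, neg_lt_neg_iff]
  rw [e, lintegral_union measurableSet_Iio, h1, h2, ← ENNReal.ofReal_add]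
  · congr 1; ring
  · have := Real.rpow_pos_of_pos hJ (1 - σ); have : 0 < σ - 1 := by linarith
    positivity
  · have := Real.rpow_pos_of_pos hJ (1 - σ); have : 0 < σ - 1 := by linarith
    positivity
  · rw [Set.disjoint_left]; intro τ h1 h2
    simp only [Set.mem_Ioi, Set.mem_Iio] at h1 h2; linarith

section PairInteraction

variable {H : Type*} [NormedAddCommGroup H] [InnerProductSpace ℂ H] [CompleteSpace H]

lemma sq_setLIntegral_le {g : ℝ → ℝ≥0∞} (hg : Measurable g) (A : Set ℝ) :
    (∫⁻ t in A, g t) ^ 2 ≤ volume A * ∫⁻ t in A, g t ^ 2 := by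
  have h := ENNReal.lintegral_mul_le_Lp_mul_Lq (volume.restrict A) Real.HolderConjugate.two_two
    (f := fun _ => 1) (g := g) aemeasurable_const hg.aemeasurable
  simp only [Pi.mul_apply, one_mul, one_pow, lintegral_const, MeasurableSet.univ,
    Measure.restrict_apply, Set.univ_inter, ENNReal.rpow_ofNat] at h
  calc _ ≤ (volume A ^ (1 / 2 : ℝ) * (∫⁻ t in A, g t ^ 2) ^ (1 / 2 : ℝ)) ^ 2 := by gcongr
    _ = _ := by
      rw [mul_pow, ← ENNReal.rpow_natCast, ← ENNReal.rpow_natCast, ← ENNReal.rpow_mul,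
        ← ENNReal.rpow_mul]
      norm_num

/-- Splitting a bilinear interaction into its part near the diagonal, organised along a grid of
step `J`, and its part away from the diagonal. -/
lemma enorm_inner_integral_le_near_add_far {v w : ℝ → H} (hv : Integrable v) (hw : Integrable w)
    {J : ℝ} (hJ : 0 < J) :
    ‖inner ℂ (∫ t, v t) (∫ t, w t)‖ₑ ≤
      (∑' m : ℤ, ‖∫ t in Set.Ico (m • J) ((m + 1) • J), v t‖ₑ *
        ‖∫ t in Set.Ico ((m - 1) • J) ((m + 2) • J), w t‖ₑ) +
      ∫⁻ t, ∫⁻ s, {τ : ℝ | J < |τ|}.indicator 1 (t - s) * ‖inner ℂ (v t) (w s)‖ₑ := by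
  set W := ∫ t, w t with hW
  have hU : ⋃ m : ℤ, Set.Ico (m • J) ((m + 1) • J) = Set.univ := iUnion_Ico_zsmul hJ
  have hD : Pairwise (Function.onFun Disjoint fun m : ℤ => Set.Ico (m • J) ((m + 1) • J)) :=
    Set.pairwise_disjoint_Ico_zsmul J
  have hs : HasSum (fun m : ℤ => ∫ t in Set.Ico (m • J) ((m + 1) • J), v t) (∫ t, v t) := by
    have := hasSum_integral_iUnion (f := v) (μ := volume) (fun m : ℤ => measurableSet_Ico) hD
      (by rw [hU]; exact hv.integrableOn)
    rwa [hU, setIntegral_univ] at this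
  have hs2 : HasSum (fun m : ℤ => inner ℂ W (∫ t in Set.Ico (m • J) ((m + 1) • J), v t))
      (inner ℂ W (∫ t, v t)) := hs.mapL (innerSL ℂ W)
  have step : ∀ m : ℤ, ‖inner ℂ W (∫ t in Set.Ico (m • J) ((m + 1) • J), v t)‖ₑ ≤
      ‖∫ t in Set.Ico (m • J) ((m + 1) • J), v t‖ₑ *
        ‖∫ t in Set.Ico ((m - 1) • J) ((m + 2) • J), w t‖ₑ +
      ∫⁻ t in Set.Ico (m • J) ((m + 1) • J), ∫⁻ s, {τ : ℝ | J < |τ|}.indicator 1 (t - s) *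
        ‖inner ℂ (v t) (w s)‖ₑ := by
    intro m
    rw [hW, ← integral_add_compl (measurableSet_Ico (a := (m - 1) • J) (b := (m + 2) • J)) hw,
      inner_add_left]
    refine (enorm_add_le _ _).trans (add_le_add ?_ ?_)
    · rw [mul_comm]; exact enorm_inner_le _ _
    · rw [← inner_conj_symm, RCLike.enorm_conj]
      refine (enorm_inner_integral_integral_le hv.integrableOn hw.integrableOn).trans ?_
      refine setLIntegral_mono' measurableSet_Ico fun t ht => ?_
      rw [← lintegral_indicator measurableSet_Ico.compl]
      refine lintegral_mono fun s => ?_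
      by_cases hs : s ∈ (Set.Ico ((m - 1) • J) ((m + 2) • J))ᶜ
      · rw [Set.indicator_of_mem hs]
        have : t - s ∈ {τ : ℝ | J < |τ|} := by
          simp only [Set.mem_Ico, zsmul_eq_mul, Set.mem_compl_iff, not_and_or, not_le,
            not_lt, Int.cast_add, Int.cast_sub, Int.cast_one, Int.cast_ofNat] at ht hs
          show J < |t - s|
          rw [lt_abs]
          rcases hs with hs | hs
          · left; linarith
          · right; linarith
        rw [Set.indicator_of_mem this]; simp
      · rw [Set.indicator_of_notMem hs]; simp
  rw [← inner_conj_symm, RCLike.enorm_conj, ← hs2.tsum_eq]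
  refine (enorm_tsum_le_tsum_enorm).trans ((ENNReal.tsum_le_tsum step).trans ?_)
  rw [ENNReal.tsum_add]
  gcongr
  rw [← lintegral_iUnion (fun m : ℤ => measurableSet_Ico) hD, hU, setLIntegral_univ]

lemma tsum_setLIntegral_Ico_zsmul (f : ℝ → ℝ≥0∞) {J : ℝ} (hJ : 0 < J) :
    ∑' m : ℤ, ∫⁻ t in Set.Ico (m • J) ((m + 1) • J), f t = ∫⁻ t, f t := by
  rw [← lintegral_iUnion (fun m : ℤ => measurableSet_Ico) (Set.pairwise_disjoint_Ico_zsmul J),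
    iUnion_Ico_zsmul hJ, setLIntegral_univ]

lemma tsum_setLIntegral_Ico_zsmul_le (f : ℝ → ℝ≥0∞) {J : ℝ} (hJ : 0 < J) :
    ∑' m : ℤ, ∫⁻ t in Set.Ico ((m - 1) • J) ((m + 2) • J), f t ≤ 3 * ∫⁻ t, f t := by
  have h0 := tsum_setLIntegral_Ico_zsmul f hJ
  have h1 : ∑' m : ℤ, ∫⁻ t in Set.Ico ((m - 1) • J) ((m - 1 + 1) • J), f t = ∫⁻ t, f t := by
    rw [← h0]
    exact (Equiv.subRight (1 : ℤ)).tsum_eq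
      (fun m : ℤ => ∫⁻ t in Set.Ico (m • J) ((m + 1) • J), f t)
  have h2 : ∑' m : ℤ, ∫⁻ t in Set.Ico ((m + 1) • J) ((m + 1 + 1) • J), f t = ∫⁻ t, f t := by
    rw [← h0]
    exact (Equiv.addRight (1 : ℤ)).tsum_eq
      (fun m : ℤ => ∫⁻ t in Set.Ico (m • J) ((m + 1) • J), f t)
  calc _ ≤ ∑' m : ℤ, ((∫⁻ t in Set.Ico ((m - 1) • J) ((m - 1 + 1) • J), f t) +
        (∫⁻ t in Set.Ico (m • J) ((m + 1) • J), f t) +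
        ∫⁻ t in Set.Ico ((m + 1) • J) ((m + 1 + 1) • J), f t) := by
        refine ENNReal.tsum_le_tsum fun m => ?_
        have hsub : Set.Ico ((m - 1) • J) ((m + 2) • J) ⊆
            (Set.Ico ((m - 1) • J) ((m - 1 + 1) • J) ∪ Set.Ico (m • J) ((m + 1) • J)) ∪
            Set.Ico ((m + 1) • J) ((m + 1 + 1) • J) := by
          intro x hx
          simp only [Set.mem_Ico, Set.mem_union, sub_add_cancel] at hx ⊢
          have e : m + 1 + 1 = m + 2 := by ring
          rw [e]
          by_cases a : x < m • J
          · exact Or.inl (Or.inl ⟨hx.1, a⟩)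
          by_cases b : x < (m + 1) • J
          · exact Or.inl (Or.inr ⟨not_lt.1 a, b⟩)
          · exact Or.inr ⟨not_lt.1 b, hx.2⟩
        refine (lintegral_mono_set hsub).trans ((lintegral_union_le _ _ _).trans ?_)
        gcongr
        exact lintegral_union_le _ _ _
    _ = 3 * ∫⁻ t, f t := by
        rw [ENNReal.tsum_add, ENNReal.tsum_add, h0, h1, h2]; ring

lemma ENNReal.mul_le_weighted_sq (x y : ℝ≥0∞) (c : ℝ) :
    x * y ≤ ENNReal.ofReal (Real.exp c) * x ^ 2 + ENNReal.ofReal (Real.exp (-c)) * y ^ 2 := by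
  have h := ENNReal.mul_le_sq_add_sq (ENNReal.ofReal (Real.exp (c / 2)) * x)
    (ENNReal.ofReal (Real.exp (-c / 2)) * y)
  have e1 : ENNReal.ofReal (Real.exp (c / 2)) * ENNReal.ofReal (Real.exp (-c / 2)) = 1 := by
    rw [← ENNReal.ofReal_mul (Real.exp_pos _).le, ← Real.exp_add]
    ring_nf; simp
  have e2 : ∀ z : ℝ, ENNReal.ofReal (Real.exp (z / 2)) ^ 2 = ENNReal.ofReal (Real.exp z) := by
    intro z
    rw [← ENNReal.ofReal_pow (Real.exp_pos _).le, ← Real.exp_nat_mul]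
    congr 2; push_cast; ring
  rw [mul_pow, mul_pow, e2, e2] at h
  calc x * y = (ENNReal.ofReal (Real.exp (c / 2)) * ENNReal.ofReal (Real.exp (-c / 2))) *
        (x * y) := by rw [e1, one_mul]
    _ = _ := by ring
    _ ≤ _ := h

/-- The bilinear estimate behind the endpoint Strichartz inequality: two packets living at
time scales `exp a ≤ exp b` interact with an exponential gain in `b - a`. -/
lemma enorm_inner_integral_le_of_scales {C σ : ℝ} (hC : 0 < C) (hσ : 1 < σ) {a b : ℝ}
    (hab : a ≤ b) {v w : ℝ → H} (hv : Integrable v) (hw : Integrable w) {f g : ℝ → ℝ≥0∞}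
    (hf : Measurable f) (hg : Measurable g)
    (hvf : ∀ t, ‖v t‖ₑ ≤ ENNReal.ofReal (Real.exp (-a / 2)) * f t)
    (hwg : ∀ t, ‖w t‖ₑ ≤ ENNReal.ofReal (Real.exp (-b / 2)) * g t)
    (hvv : ∀ t s, ‖inner ℂ (v t) (v s)‖ₑ ≤ ENNReal.ofReal (C * Real.exp (a * (σ - 1))) *
      ENNReal.ofReal |t - s| ^ (-σ) * (f t * f s))
    (hvw : ∀ t s, ‖inner ℂ (v t) (w s)‖ₑ ≤ ENNReal.ofReal (C * Real.exp ((a + b) / 2 * (σ - 1))) *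
      ENNReal.ofReal |t - s| ^ (-σ) * (f t * g s)) :
    ‖inner ℂ (∫ t, v t) (∫ t, w t)‖ₑ ≤
      ENNReal.ofReal ((13 + 6 * C / (σ - 1)) * Real.exp (-(min (1 / 8) ((σ - 1) / 4) * (b - a)))) *
        ((∫⁻ t, f t ^ 2) + ∫⁻ t, g t ^ 2) := by
  have hσ1 : 0 < σ - 1 := by linarith
  set J := Real.exp ((a + 3 * b) / 4) with hJdef
  have hJ : 0 < J := Real.exp_pos _
  have hmeasK : ∀ R : ℝ, MeasurableSet {τ : ℝ | R < |τ|} := fun R =>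
    measurableSet_lt measurable_const (by fun_prop)
  -- the kernel controlling the interaction of `v` with itself
  have hself : ∀ A : Set ℝ, MeasurableSet A → ‖∫ t in A, v t‖ₑ ^ 2 ≤
      ENNReal.ofReal (2 * (2 + 2 * C / (σ - 1))) * ∫⁻ t in A, f t ^ 2 := by
    intro A hA
    set T := Real.exp a with hT
    set k : ℝ → ℝ≥0∞ := fun τ => (Set.Icc (-T) T).indicator (fun _ => ENNReal.ofReal (Real.exp (-a))) τ
      + {τ : ℝ | T < |τ|}.indicator
        (fun τ => ENNReal.ofReal (C * Real.exp (a * (σ - 1))) * ENNReal.ofReal |τ| ^ (-σ)) τ with hk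
    have hkm : Measurable k := by
      refine Measurable.add (measurable_const.indicator measurableSet_Icc)
        (Measurable.indicator ?_ (hmeasK T))
      fun_prop
    have hki : ∫⁻ τ, k τ = ENNReal.ofReal (2 + 2 * C / (σ - 1)) := by
      rw [hk, lintegral_add_left (measurable_const.indicator measurableSet_Icc),
        lintegral_indicator measurableSet_Icc, lintegral_indicator (hmeasK T),
        lintegral_const_mul _ (by fun_prop), setLIntegral_abs_gt_rpow hσ (Real.exp_pos a),
        setLIntegral_const, Real.volume_Icc, ← ENNReal.ofReal_mul (Real.exp_pos _).le,
        ← ENNReal.ofReal_mul (by positivity), ← ENNReal.ofReal_add]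
      · congr 1
        have e1 : Real.exp (-a) * Real.exp a = 1 := by rw [← Real.exp_add]; simp
        have e2 : Real.exp (a * (σ - 1)) * Real.exp a ^ (1 - σ) = 1 := by
          rw [← Real.exp_mul, ← Real.exp_add]; ring_nf; simp
        rw [show Real.exp (-a) * (T - -T) = 2 * (Real.exp (-a) * Real.exp a) by rw [hT]; ring, e1]
        rw [show C * Real.exp (a * (σ - 1)) * (2 * Real.exp a ^ (1 - σ) / (σ - 1)) =
          2 * C * (Real.exp (a * (σ - 1)) * Real.exp a ^ (1 - σ)) / (σ - 1) by ring, e2]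
        ring
      · rw [hT]; have := Real.exp_pos a; have := Real.exp_pos (-a)
        apply mul_nonneg this.le; linarith
      · positivity
    have := enorm_setIntegral_sq_le hv hkm hf (fun t s => ?_) hA
    · rw [hki] at this
      refine this.trans_eq ?_
      rw [ENNReal.ofReal_mul (p := 2) (by norm_num)]
      simp
    · by_cases hts : |t - s| ≤ T
      · have hm : t - s ∈ Set.Icc (-T) T := abs_le.1 hts
        have h1 : ENNReal.ofReal (Real.exp (-a)) ≤ k (t - s) := by
          simp only [hk, Set.indicator_of_mem hm]; exact le_self_add
        calc _ ≤ ‖v t‖ₑ * ‖v s‖ₑ := enorm_inner_le _ _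
          _ ≤ (ENNReal.ofReal (Real.exp (-a / 2)) * f t) *
              (ENNReal.ofReal (Real.exp (-a / 2)) * f s) := mul_le_mul' (hvf t) (hvf s)
          _ = (ENNReal.ofReal (Real.exp (-a / 2)) * ENNReal.ofReal (Real.exp (-a / 2))) *
              (f t * f s) := by ring
          _ = ENNReal.ofReal (Real.exp (-a)) * (f t * f s) := by
            rw [← ENNReal.ofReal_mul (Real.exp_pos _).le, ← Real.exp_add]; ring_nf
          _ ≤ _ := by gcongr
      · have hm : t - s ∈ {τ : ℝ | T < |τ|} := not_le.1 hts
        refine (hvv t s).trans ?_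
        gcongr
        simp only [hk, Set.indicator_of_mem hm]; exact le_add_self
  have hwA : ∀ m : ℤ, ‖∫ t in Set.Ico ((m - 1) • J) ((m + 2) • J), w t‖ₑ ^ 2 ≤
      ENNReal.ofReal (3 * Real.exp ((a - b) / 4)) *
        ∫⁻ t in Set.Ico ((m - 1) • J) ((m + 2) • J), g t ^ 2 := by
    intro m
    set A := Set.Ico ((m - 1) • J) ((m + 2) • J)
    have h1 : ‖∫ t in A, w t‖ₑ ≤ ENNReal.ofReal (Real.exp (-b / 2)) * ∫⁻ t in A, g t := by
      rw [← lintegral_const_mul _ hg]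
      exact (enorm_integral_le_lintegral_enorm _).trans (lintegral_mono hwg)
    calc _ ≤ (ENNReal.ofReal (Real.exp (-b / 2)) * ∫⁻ t in A, g t) ^ 2 := by gcongr
      _ = ENNReal.ofReal (Real.exp (-b)) * (∫⁻ t in A, g t) ^ 2 := by
        rw [mul_pow, ← ENNReal.ofReal_pow (Real.exp_pos _).le, ← Real.exp_nat_mul]
        congr 3; push_cast; ring
      _ ≤ ENNReal.ofReal (Real.exp (-b)) * (volume A * ∫⁻ t in A, g t ^ 2) := by
        gcongr; exact sq_setLIntegral_le hg A
      _ = _ := by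
        rw [← mul_assoc, Real.volume_Ico, ← ENNReal.ofReal_mul (Real.exp_pos _).le]
        congr 2
        simp only [zsmul_eq_mul, Int.cast_add, Int.cast_sub, Int.cast_one, Int.cast_ofNat]
        rw [show Real.exp (-b) * ((m + 2) * J - (m - 1) * J) = 3 * (Real.exp (-b) * J) by ring, hJdef,
          ← Real.exp_add]
        congr 2; ring
  have hnear : ∑' m : ℤ, ‖∫ t in Set.Ico (m • J) ((m + 1) • J), v t‖ₑ *
        ‖∫ t in Set.Ico ((m - 1) • J) ((m + 2) • J), w t‖ₑ ≤
      ENNReal.ofReal (Real.exp ((a - b) / 8) * (2 * (2 + 2 * C / (σ - 1)))) * (∫⁻ t, f t ^ 2) +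
      ENNReal.ofReal (Real.exp ((a - b) / 8) * 9) * ∫⁻ t, g t ^ 2 := by
    calc _ ≤ ∑' m : ℤ, (ENNReal.ofReal (Real.exp ((a - b) / 8)) *
          (ENNReal.ofReal (2 * (2 + 2 * C / (σ - 1))) *
            ∫⁻ t in Set.Ico (m • J) ((m + 1) • J), f t ^ 2) +
          ENNReal.ofReal (Real.exp (-((a - b) / 8))) *
            (ENNReal.ofReal (3 * Real.exp ((a - b) / 4)) *
              ∫⁻ t in Set.Ico ((m - 1) • J) ((m + 2) • J), g t ^ 2)) := by
          refine ENNReal.tsum_le_tsum fun m => ?_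
          refine (ENNReal.mul_le_weighted_sq _ _ ((a - b) / 8)).trans ?_
          gcongr
          · exact hself _ measurableSet_Ico
          · exact hwA m
      _ = ENNReal.ofReal (Real.exp ((a - b) / 8)) *
          (ENNReal.ofReal (2 * (2 + 2 * C / (σ - 1))) * ∫⁻ t, f t ^ 2) +
          ENNReal.ofReal (Real.exp (-((a - b) / 8))) *
            (ENNReal.ofReal (3 * Real.exp ((a - b) / 4)) *
              ∑' m : ℤ, ∫⁻ t in Set.Ico ((m - 1) • J) ((m + 2) • J), g t ^ 2) := by
          rw [ENNReal.tsum_add, ENNReal.tsum_mul_left, ENNReal.tsum_mul_left,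
            ENNReal.tsum_mul_left, ENNReal.tsum_mul_left, tsum_setLIntegral_Ico_zsmul _ hJ]
      _ ≤ ENNReal.ofReal (Real.exp ((a - b) / 8)) *
          (ENNReal.ofReal (2 * (2 + 2 * C / (σ - 1))) * ∫⁻ t, f t ^ 2) +
          ENNReal.ofReal (Real.exp (-((a - b) / 8))) *
            (ENNReal.ofReal (3 * Real.exp ((a - b) / 4)) * (3 * ∫⁻ t, g t ^ 2)) := by
          gcongr
          exact tsum_setLIntegral_Ico_zsmul_le _ hJ
      _ = _ := by
          rw [← mul_assoc, ← ENNReal.ofReal_mul (Real.exp_pos _).le]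
          congr 1
          rw [show (3 : ℝ≥0∞) = ENNReal.ofReal 3 by simp, ← mul_assoc, ← mul_assoc,
            ← ENNReal.ofReal_mul (Real.exp_pos _).le, ← ENNReal.ofReal_mul (by positivity)]
          congr 2
          rw [show Real.exp (-((a - b) / 8)) * (3 * Real.exp ((a - b) / 4)) * 3 =
            9 * (Real.exp (-((a - b) / 8)) * Real.exp ((a - b) / 4)) by ring, ← Real.exp_add,
            mul_comm]
          congr 2; ring
  have hfar : ∫⁻ t, ∫⁻ s, {τ : ℝ | J < |τ|}.indicator 1 (t - s) * ‖inner ℂ (v t) (w s)‖ₑ ≤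
      ENNReal.ofReal (2 * C / (σ - 1) * Real.exp (-((σ - 1) / 4 * (b - a)))) *
        ((∫⁻ t, f t ^ 2) + ∫⁻ t, g t ^ 2) := by
    set k : ℝ → ℝ≥0∞ := {τ : ℝ | J < |τ|}.indicator (fun τ =>
      ENNReal.ofReal (C * Real.exp ((a + b) / 2 * (σ - 1))) * ENNReal.ofReal |τ| ^ (-σ)) with hk
    have hkm : Measurable k := Measurable.indicator (by fun_prop) (hmeasK J)
    have hki : ∫⁻ τ, k τ =
        ENNReal.ofReal (2 * C / (σ - 1) * Real.exp (-((σ - 1) / 4 * (b - a)))) := by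
      rw [hk, lintegral_indicator (hmeasK J), lintegral_const_mul _ (by fun_prop),
        setLIntegral_abs_gt_rpow hσ hJ, ← ENNReal.ofReal_mul (by positivity)]
      congr 1
      rw [hJdef, ← Real.exp_mul]
      rw [show C * Real.exp ((a + b) / 2 * (σ - 1)) *
        (2 * Real.exp ((a + 3 * b) / 4 * (1 - σ)) / (σ - 1)) = 2 * C / (σ - 1) *
        (Real.exp ((a + b) / 2 * (σ - 1)) * Real.exp ((a + 3 * b) / 4 * (1 - σ))) by ring,
        ← Real.exp_add]
      congr 2; ring
    rw [← hki]
    refine le_trans (lintegral_mono fun t => lintegral_mono fun s => ?_)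
      (lintegral_convolution_schur hkm hf hg)
    by_cases hts : t - s ∈ {τ : ℝ | J < |τ|}
    · simp only [hk, Set.indicator_of_mem hts, Pi.one_apply, one_mul]
      exact hvw t s
    · simp [Set.indicator_of_notMem hts]
  set ε := min (1 / 8) ((σ - 1) / 4) with hε
  have hE1 : Real.exp ((a - b) / 8) ≤ Real.exp (-(ε * (b - a))) := by
    apply Real.exp_le_exp.2
    have : ε * (b - a) ≤ 1 / 8 * (b - a) :=
      mul_le_mul_of_nonneg_right (min_le_left _ _) (by linarith)
    linarith
  have hE2 : Real.exp (-((σ - 1) / 4 * (b - a))) ≤ Real.exp (-(ε * (b - a))) := by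
    apply Real.exp_le_exp.2
    have : ε * (b - a) ≤ (σ - 1) / 4 * (b - a) :=
      mul_le_mul_of_nonneg_right (min_le_right _ _) (by linarith)
    linarith
  set E := Real.exp (-(ε * (b - a))) with hE
  have hE0 : 0 < E := Real.exp_pos _
  set K := C / (σ - 1) with hK
  have hK0 : 0 < K := div_pos hC hσ1
  refine (enorm_inner_integral_le_near_add_far hv hw hJ).trans ((add_le_add hnear hfar).trans ?_)
  have e7 : 2 * C / (σ - 1) = 2 * K := by rw [hK]; ring
  have e6 : (13 + 6 * C / (σ - 1)) * E = (13 + 4 * K) * E + 2 * K * E := by rw [hK]; ring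
  rw [e6, ENNReal.ofReal_add (by positivity) (by positivity), add_mul]
  refine add_le_add ?_ (mul_le_mul_left (ENNReal.ofReal_le_ofReal ?_) _)
  swap
  · rw [e7]; exact mul_le_mul_of_nonneg_left hE2 (by positivity)
  rw [mul_add (ENNReal.ofReal _)]
  have m1 : Real.exp ((a - b) / 8) * (2 * (2 + 2 * C / (σ - 1))) ≤ (13 + 4 * K) * E := by
    rw [show 2 * C / (σ - 1) = 2 * K by rw [hK]; ring]
    calc _ ≤ E * (2 * (2 + 2 * K)) := mul_le_mul_of_nonneg_right hE1 (by positivity)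
      _ ≤ _ := by nlinarith
  have m2 : Real.exp ((a - b) / 8) * 9 ≤ (13 + 4 * K) * E := by
    calc _ ≤ E * 9 := mul_le_mul_of_nonneg_right hE1 (by positivity)
      _ ≤ _ := by nlinarith [mul_pos hK0 hE0]
  gcongr

end PairInteraction

/-- The phase `z / |z|` of a complex number, with value `0` at `0`. -/
noncomputable def phase (z : ℂ) : ℂ := z / (‖z‖ : ℂ)

lemma measurable_phase : Measurable phase := by
  unfold phase; fun_prop

lemma enorm_phase_le (z : ℂ) : ‖phase z‖ₑ ≤ 1 := by
  rw [← ofReal_norm]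
  refine ENNReal.ofReal_le_one.2 ?_
  rw [phase, norm_div, Complex.norm_real, norm_norm]
  exact div_self_le_one _

lemma conj_phase_mul_self (z : ℂ) : (starRingEnd ℂ) (phase z) * z = (‖z‖ : ℂ) := by
  by_cases hz : z = 0
  · simp [hz]
  have : (‖z‖ : ℂ) ≠ 0 := by simpa using hz
  rw [phase, map_div₀, Complex.conj_ofReal, div_mul_eq_mul_div, Complex.conj_mul', div_eq_iff this]
  ring

lemma enorm_toReal_mul_phase_le (c : ℝ≥0∞) (z : ℂ) : ‖(c.toReal : ℂ) * phase z‖ₑ ≤ c := by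
  rw [enorm_mul]
  calc _ ≤ ‖(c.toReal : ℂ)‖ₑ * 1 := by gcongr; exact enorm_phase_le z
    _ ≤ c := by
      rw [mul_one, ← ofReal_norm, Complex.norm_real, Real.norm_of_nonneg ENNReal.toReal_nonneg]
      exact ENNReal.ofReal_toReal_le

/-- Testing `g` against a superposition of vectors whose coefficients are aligned with the
phases of the inner products. -/
lemma inner_integral_phase_smul {H : Type*} [NormedAddCommGroup H] [InnerProductSpace ℂ H]
    [CompleteSpace H] {Z : Type*} [MeasurableSpace Z] {ν : Measure Z} {h : Z → H} {g : H}
    {c : Z → ℝ≥0∞} (hc : ∀ z, c z ≠ ∞)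
    (hi : Integrable (fun z => (((c z).toReal : ℂ) * phase (inner ℂ (h z) g)) • h z) ν) :
    ∃ I : ℝ, 0 ≤ I ∧ ENNReal.ofReal I = ∫⁻ z, c z * ‖inner ℂ (h z) g‖ₑ ∂ν ∧
      inner ℂ (∫ z, (((c z).toReal : ℂ) * phase (inner ℂ (h z) g)) • h z ∂ν) g = (I : ℂ) := by
  have e : ∀ z, inner ℂ ((((c z).toReal : ℂ) * phase (inner ℂ (h z) g)) • h z) g =
      (((c z).toReal * ‖inner ℂ (h z) g‖ : ℝ) : ℂ) := by
    intro z
    rw [inner_smul_left, map_mul, Complex.conj_ofReal, mul_assoc, conj_phase_mul_self]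
    push_cast; rfl
  have hintegrable : Integrable (fun z => (c z).toReal * ‖inner ℂ (h z) g‖) ν := by
    have := hi.inner_const (𝕜 := ℂ) g
    simp_rw [e] at this
    exact this.re
  refine ⟨∫ z, (c z).toReal * ‖inner ℂ (h z) g‖ ∂ν, integral_nonneg fun z => by positivity, ?_, ?_⟩
  · rw [ofReal_integral_eq_lintegral_ofReal hintegrable (Eventually.of_forall fun z => by positivity)]
    refine lintegral_congr fun z => ?_
    rw [ENNReal.ofReal_mul ENNReal.toReal_nonneg, ENNReal.ofReal_toReal (hc z), ofReal_norm]
  · rw [← inner_conj_symm, ← integral_inner hi, ← integral_conj]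
    simp_rw [inner_conj_symm, e]
    exact integral_ofReal

lemma Finset.sum_sum_convolution_le (s : Finset ℤ) (c S : ℤ → ℝ≥0∞) :
    ∑ n ∈ s, ∑ l ∈ s, c (n - l) * (S n + S l) ≤ 2 * (∑' m, c m) * ∑ n ∈ s, S n := by
  have h1 : ∀ n, ∑ l ∈ s, c (n - l) ≤ ∑' m, c m := fun n =>
    (ENNReal.sum_le_tsum s).trans_eq ((Equiv.subLeft n).tsum_eq c)
  have h2 : ∀ l, ∑ n ∈ s, c (n - l) ≤ ∑' m, c m := fun l =>
    (ENNReal.sum_le_tsum s).trans_eq ((Equiv.subRight l).tsum_eq c)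
  simp_rw [mul_add, Finset.sum_add_distrib]
  rw [Finset.sum_comm (f := fun n l => c (n - l) * S l), two_mul, add_mul]
  simp_rw [← Finset.sum_mul, Finset.mul_sum]
  gcongr with n _ n _
  · exact h1 n
  · exact h2 n

lemma tsum_exp_neg_mul_abs_ne_top {ε : ℝ} (hε : 0 < ε) :
    ∑' m : ℤ, ENNReal.ofReal (Real.exp (-(ε * |(m : ℝ)|))) ≠ ∞ := by
  have key : Summable fun n : ℕ => Real.exp (-(ε * n)) := by
    have h2 : Summable fun n : ℕ => Real.exp (-ε) ^ n :=
      summable_geometric_of_lt_one (Real.exp_pos _).le (Real.exp_lt_one_iff.2 (by linarith))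
    refine h2.congr fun n => ?_
    rw [← Real.exp_nat_mul]; ring_nf
  have : Summable fun m : ℤ => Real.exp (-(ε * |(m : ℝ)|)) := by
    refine Summable.of_nat_of_neg ?_ ?_
    · simpa using key
    · simpa using key
  exact this.tsum_ofReal_ne_top

section EndpointPackets

variable {H : Type*} [NormedAddCommGroup H] [InnerProductSpace ℂ H]

lemma enorm_sum_sq_le_of_pairwise (s : Finset ℤ) (V : ℤ → H) (c S : ℤ → ℝ≥0∞)
    (h : ∀ n l, ‖inner ℂ (V n) (V l)‖ₑ ≤ c (n - l) * (S n + S l)) :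
    ‖∑ n ∈ s, V n‖ₑ ^ 2 ≤ 2 * (∑' m, c m) * ∑ n ∈ s, S n := by
  rw [enorm_sq_eq_enorm_inner, sum_inner]
  simp_rw [inner_sum]
  refine (enorm_sum_le _ _).trans ((Finset.sum_le_sum fun n _ => (enorm_sum_le _ _).trans
    (Finset.sum_le_sum fun l _ => h n l)).trans (Finset.sum_sum_convolution_le s c S))

/-- Almost orthogonality of the packets at dyadic heights in the endpoint Strichartz estimate. -/
lemma exists_enorm_sum_integral_packets_sq_le {C σ : ℝ} (hC : 0 < C) (hσ : 1 < σ) :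
    ∃ K : ℝ≥0∞, K ≠ ∞ ∧ ∀ {H : Type*} [NormedAddCommGroup H] [InnerProductSpace ℂ H]
      [CompleteSpace H] (s : Finset ℤ) (v : ℤ → ℝ → H) (f : ℤ → ℝ → ℝ≥0∞),
      (∀ n, Integrable (v n)) → (∀ n, Measurable (f n)) →
      (∀ n t, ‖v n t‖ₑ ≤ 2 ^ ((n : ℝ) / (σ - 1)) * f n t) →
      (∀ n l t s, ‖inner ℂ (v n t) (v l s)‖ₑ ≤ ENNReal.ofReal C * ENNReal.ofReal |t - s| ^ (-σ) *
        ((2 ^ (-n : ℝ) * f n t) * (2 ^ (-l : ℝ) * f l s))) →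
      ‖∑ n ∈ s, ∫ t, v n t‖ₑ ^ 2 ≤ K * ∑ n ∈ s, ∫⁻ t, f n t ^ 2 := by
  have hσ1 : 0 < σ - 1 := by linarith
  have hlog : 0 < Real.log 2 := Real.log_pos (by norm_num)
  set ε := min (1 / 8) ((σ - 1) / 4) * (2 * Real.log 2 / (σ - 1)) with hε
  have hε0 : 0 < ε := mul_pos (lt_min (by norm_num) (by positivity)) (by positivity)
  set c : ℤ → ℝ≥0∞ := fun m => ENNReal.ofReal (13 + 6 * C / (σ - 1)) *
    ENNReal.ofReal (Real.exp (-(ε * |(m : ℝ)|))) with hc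
  refine ⟨2 * ∑' m, c m, ?_, ?_⟩
  · rw [hc, ENNReal.tsum_mul_left]
    exact ENNReal.mul_ne_top (by simp) (ENNReal.mul_ne_top ENNReal.ofReal_ne_top
      (tsum_exp_neg_mul_abs_ne_top hε0))
  intro H _ _ _ s v f hv hf hvf hvv
  have two_rpow : ∀ x : ℝ, (2 : ℝ≥0∞) ^ x = ENNReal.ofReal (Real.exp (Real.log 2 * x)) := by
    intro x
    rw [← Real.rpow_def_of_pos (by norm_num), ← ENNReal.ofReal_rpow_of_pos (by norm_num)]
    simp
  have main : ∀ n l : ℤ, l ≤ n → ‖inner ℂ (∫ t, v n t) (∫ t, v l t)‖ₑ ≤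
      c (n - l) * ((∫⁻ t, f n t ^ 2) + ∫⁻ t, f l t ^ 2) := by
    intro n l hnl
    have hnl' : (l : ℝ) ≤ n := by exact_mod_cast hnl
    have hnorm : ∀ (m : ℤ) t, ‖v m t‖ₑ ≤
        ENNReal.ofReal (Real.exp (-(-(2 * Real.log 2 / (σ - 1)) * m) / 2)) * f m t := by
      intro m t
      refine (hvf m t).trans_eq ?_
      rw [two_rpow]
      congr 3
      ring
    have hpair : ∀ (m k : ℤ) t s, ‖inner ℂ (v m t) (v k s)‖ₑ ≤
        ENNReal.ofReal (C * Real.exp ((-(2 * Real.log 2 / (σ - 1)) * m +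
          -(2 * Real.log 2 / (σ - 1)) * k) / 2 * (σ - 1))) *
          ENNReal.ofReal |t - s| ^ (-σ) * (f m t * f k s) := by
      intro m k t s
      refine (hvv m k t s).trans_eq ?_
      have : (2 : ℝ≥0∞) ^ (-m : ℝ) * 2 ^ (-k : ℝ) = ENNReal.ofReal (Real.exp
          ((-(2 * Real.log 2 / (σ - 1)) * m +
          -(2 * Real.log 2 / (σ - 1)) * k) / 2 * (σ - 1))) := by
        rw [two_rpow, two_rpow, ← ENNReal.ofReal_mul (Real.exp_pos _).le, ← Real.exp_add]
        congr 2
        field_simp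
      rw [ENNReal.ofReal_mul hC.le, ← this]
      ring
    have := enorm_inner_integral_le_of_scales hC hσ (a := -(2 * Real.log 2 / (σ - 1)) * n)
      (b := -(2 * Real.log 2 / (σ - 1)) * l) (by
        have : 0 < 2 * Real.log 2 / (σ - 1) := by positivity
        nlinarith) (hv n) (hv l) (hf n) (hf l) (hnorm n) (hnorm l)
      (fun t s => by
        have := hpair n n t s
        rwa [add_self_div_two] at this)
      (fun t s => hpair n l t s)
    refine this.trans_eq ?_
    rw [hc]
    dsimp only
    rw [← ENNReal.ofReal_mul (by positivity)]
    congr 4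
    rw [Int.cast_sub, abs_of_nonneg (by linarith), hε]
    ring
  refine enorm_sum_sq_le_of_pairwise s (fun n => ∫ t, v n t) c (fun n => ∫⁻ t, f n t ^ 2) ?_
  intro n l
  rcases le_total l n with h | h
  · exact main n l h
  · rw [← inner_conj_symm, RCLike.enorm_conj, add_comm]
    refine (main l n h).trans_eq ?_
    congr 1
    simp only [hc, Int.cast_sub, abs_sub_comm]

end EndpointPackets

section DyadicLevels

variable {X : Type*}

/-- The set where the ratio `φ / N` has size about `2 ^ n`. -/
def dyadicLevel (φ : X → ℝ≥0∞) (N : ℝ≥0∞) (n : ℤ) : Set X :=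
  {x | φ x / N ∈ Set.Ico ((2 : ℝ≥0∞) ^ (n : ℝ)) (2 ^ ((n : ℝ) + 1))}

lemma two_rpow_pos (x : ℝ) : 0 < (2 : ℝ≥0∞) ^ x := ENNReal.rpow_pos (by simp) (by simp)

lemma two_rpow_ne_top (x : ℝ) : (2 : ℝ≥0∞) ^ x ≠ ∞ := ENNReal.rpow_ne_top_of_ne_zero (by simp) (by simp)

lemma dyadicLevel_zero (φ : X → ℝ≥0∞) (n : ℤ) : dyadicLevel φ 0 n = ∅ := by
  ext x
  simp only [dyadicLevel, Set.mem_Ico, Set.mem_empty_iff_false, iff_false]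
  rintro ⟨h1, h2⟩
  by_cases h0 : φ x = 0
  · rw [h0, ENNReal.zero_div] at h1
    exact (two_rpow_pos n).not_ge h1
  · rw [ENNReal.div_zero h0] at h2
    exact not_top_lt h2

lemma two_rpow_mul_le_of_mem_dyadicLevel {φ : X → ℝ≥0∞} {N : ℝ≥0∞} {n : ℤ} {x : X}
    (hx : x ∈ dyadicLevel φ N n) : 2 ^ (n : ℝ) * N ≤ φ x :=
  ENNReal.mul_le_of_le_div hx.1

variable [MeasurableSpace X] {μ : Measure X}

lemma measurableSet_dyadicLevel {φ : X → ℝ≥0∞} (hφ : Measurable φ) (N : ℝ≥0∞) (n : ℤ) :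
    MeasurableSet (dyadicLevel φ N n) :=
  (hφ.div_const N) measurableSet_Ico

lemma rpow_mul_measure_dyadicLevel_le_one {φ : X → ℝ≥0∞} (hφ : Measurable φ) {N : ℝ≥0∞}
    (hNt : N ≠ ∞) {p : ℝ} (hp : 0 < p) (hN : N = 0 ∨ N ^ p = ∫⁻ x, φ x ^ p ∂μ) (n : ℤ) :
    (2 : ℝ≥0∞) ^ (n * p) * μ (dyadicLevel φ N n) ≤ 1 := by
  by_cases h0 : N = 0
  · rw [h0, dyadicLevel_zero]; simp
  have hNp : N ^ p = ∫⁻ x, φ x ^ p ∂μ := hN.resolve_left h0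
  have h1 : N ^ p * (2 ^ (n * p) * μ (dyadicLevel φ N n)) ≤ N ^ p * 1 := by
    calc _ = ∫⁻ _ in dyadicLevel φ N n, (2 ^ (n : ℝ) * N) ^ p ∂μ := by
          rw [setLIntegral_const, ENNReal.mul_rpow_of_nonneg _ _ hp.le, ← ENNReal.rpow_mul]
          ring
      _ ≤ ∫⁻ x in dyadicLevel φ N n, φ x ^ p ∂μ := by
          refine setLIntegral_mono' (measurableSet_dyadicLevel hφ N n) fun x hx => ?_
          exact ENNReal.rpow_le_rpow (two_rpow_mul_le_of_mem_dyadicLevel hx) hp.le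
      _ ≤ ∫⁻ x, φ x ^ p ∂μ := setLIntegral_le_lintegral _ _
      _ = _ := by rw [hNp, mul_one]
  exact (ENNReal.mul_le_mul_iff_right (by simp [h0, hNt, hp]) (by simp [hNt, h0])).1 h1

lemma sq_le_tsum_dyadicLevel {φ : X → ℝ≥0∞} (hφ : Measurable φ) (hφt : ∀ x, φ x ≠ ∞) {N : ℝ≥0∞}
    (hNt : N ≠ ∞) {p : ℝ} (hp : 0 < p) (hN : N = 0 ∨ N ^ p = ∫⁻ x, φ x ^ p ∂μ) :
    N ^ 2 ≤ 2 ^ p * ∑' n : ℤ, N ^ 2 * (2 ^ (n * p) * μ (dyadicLevel φ N n)) := by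
  by_cases h0 : N = 0
  · simp [h0]
  have hNp : N ^ p = ∫⁻ x, φ x ^ p ∂μ := hN.resolve_left h0
  have hpt : ∀ x, φ x ^ p ≤ ∑' n : ℤ, (dyadicLevel φ N n).indicator
      (fun _ => (2 ^ ((n : ℝ) + 1) * N) ^ p) x := by
    intro x
    by_cases hx : φ x = 0
    · simp [hx, hp]
    obtain ⟨n, hn⟩ := ENNReal.exists_mem_Ico_zpow (x := φ x / N) (y := 2)
      (by simp [hx, hNt]) (ENNReal.div_ne_top (hφt x) h0) (by norm_num) (by simp)
    have hmem : x ∈ dyadicLevel φ N n := by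
      rw [← ENNReal.rpow_intCast, ← ENNReal.rpow_intCast] at hn
      simpa [dyadicLevel] using hn
    refine le_trans ?_ (ENNReal.le_tsum n)
    rw [Set.indicator_of_mem hmem]
    refine ENNReal.rpow_le_rpow ?_ hp.le
    exact (ENNReal.div_le_iff h0 hNt).1 hmem.2.le
  have h1 : N ^ p * 1 ≤ N ^ p * (2 ^ p * ∑' n : ℤ, (2 ^ (n * p) * μ (dyadicLevel φ N n))) := by
    calc _ = ∫⁻ x, φ x ^ p ∂μ := by rw [mul_one, hNp]
      _ ≤ ∫⁻ x, ∑' n : ℤ, (dyadicLevel φ N n).indicator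
            (fun _ => (2 ^ ((n : ℝ) + 1) * N) ^ p) x ∂μ := lintegral_mono hpt
      _ = ∑' n : ℤ, (2 ^ ((n : ℝ) + 1) * N) ^ p * μ (dyadicLevel φ N n) := by
          rw [lintegral_tsum fun n => (measurable_const.indicator
            (measurableSet_dyadicLevel hφ N n)).aemeasurable]
          refine tsum_congr fun n => ?_
          rw [lintegral_indicator_const (measurableSet_dyadicLevel hφ N n)]
      _ = _ := by
          rw [← mul_assoc, ← ENNReal.tsum_mul_left]
          refine tsum_congr fun n => ?_
          rw [ENNReal.mul_rpow_of_nonneg _ _ hp.le, ← ENNReal.rpow_mul, add_mul, one_mul,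
            ENNReal.rpow_add _ _ (by simp) (by simp)]
          ring
  have h2 := (ENNReal.mul_le_mul_iff_right (by simp [h0, hNt, hp])
    (by simp [hNt, h0])).1 h1
  calc N ^ 2 = N ^ 2 * 1 := (mul_one _).symm
    _ ≤ N ^ 2 * (2 ^ p * ∑' n : ℤ, (2 ^ (n * p) * μ (dyadicLevel φ N n))) := by gcongr
    _ = _ := by rw [ENNReal.tsum_mul_left]; ring

end DyadicLevels

lemma setLIntegral_Icc_le_imp {f : ℝ → ℝ≥0∞} {A : ℝ≥0∞}
    (hR : ∀ R : ℕ, ∫⁻ t in Set.Icc (-R : ℝ) R, f t ≤ A) : ∫⁻ t, f t ≤ A := by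
  have hmono : Monotone fun R : ℕ => Set.Icc (-R : ℝ) R := by
    intro a b hab
    have : (a : ℝ) ≤ b := by exact_mod_cast hab
    exact Set.Icc_subset_Icc (by linarith) this
  have hU : ⋃ R : ℕ, Set.Icc (-R : ℝ) R = Set.univ := by
    refine Set.eq_univ_of_forall fun t => Set.mem_iUnion.2 ?_
    obtain ⟨R, hR⟩ := exists_nat_ge |t|
    exact ⟨R, abs_le.1 hR⟩
  rw [← setLIntegral_univ, ← hU, setLIntegral_iUnion_of_directed _ hmono.directed_le]
  exact iSup_le hR

lemma ENNReal.tsum_le_of_forall_sum_le {ι : Type*} {f : ι → ℝ≥0∞} {A : ℝ≥0∞}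
    (h : ∀ s : Finset ι, ∑ n ∈ s, f n ≤ A) : ∑' n, f n ≤ A := by
  rw [ENNReal.tsum_eq_iSup_sum]
  exact iSup_le h

/-- A bounded measurable family of vectors `h t x` whose synthesis operators at each time are
contractive from `L²`, and whose Gram kernel decays like `|t - s| ^ (-σ)`. -/
structure IsDispersiveFamily {X : Type*} [MeasurableSpace X] (μ : Measure X) {H : Type*}
    [NormedAddCommGroup H] [InnerProductSpace ℂ H] (h : ℝ → X → H) (C σ : ℝ) (B : ℝ≥0∞) :
    Prop where
  stronglyMeasurable : StronglyMeasurable (Function.uncurry h)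
  ne_top : B ≠ ∞
  enorm_le : ∀ t x, ‖h t x‖ₑ ≤ B
  bessel : ∀ t (g : H), ∫⁻ x, ‖inner ℂ (h t x) g‖ₑ ^ 2 ∂μ ≤ ‖g‖ₑ ^ 2
  decay : ∀ t s x y, ‖inner ℂ (h t x) (h s y)‖ₑ ≤
    ENNReal.ofReal C * ENNReal.ofReal |t - s| ^ (-σ)

section Endpoint

variable {X : Type*} [MeasurableSpace X] {μ : Measure X} {H : Type*}
  [NormedAddCommGroup H] [InnerProductSpace ℂ H] {h : ℝ → X → H} {C σ : ℝ} {B : ℝ≥0∞}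

lemma IsDispersiveFamily.measurable_inner (hd : IsDispersiveFamily μ h C σ B) (g : H) :
    Measurable fun z : ℝ × X => inner ℂ (h z.1 z.2) g :=
  (hd.stronglyMeasurable.inner (stronglyMeasurable_const (b := g))).measurable

lemma IsDispersiveFamily.enorm_inner_le (hd : IsDispersiveFamily μ h C σ B) (g : H) (t : ℝ)
    (x : X) : ‖inner ℂ (h t x) g‖ₑ ≤ B * ‖g‖ₑ :=
  (_root_.enorm_inner_le _ _).trans (by gcongr; exact hd.enorm_le t x)

lemma IsDispersiveFamily.lintegral_rpow_le (hd : IsDispersiveFamily μ h C σ B) (g : H) (t : ℝ)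
    {p : ℝ} (hp : 2 ≤ p) :
    ∫⁻ x, ‖inner ℂ (h t x) g‖ₑ ^ p ∂μ ≤ (B * ‖g‖ₑ) ^ (p - 2) * ‖g‖ₑ ^ 2 := by
  have hm : Measurable fun x => inner ℂ (h t x) g := (hd.measurable_inner g).comp measurable_prodMk_left
  calc _ ≤ ∫⁻ x, (B * ‖g‖ₑ) ^ (p - 2) * ‖inner ℂ (h t x) g‖ₑ ^ 2 ∂μ := by
        refine lintegral_mono fun x => ?_
        rw [← ENNReal.rpow_two]
        calc _ = ‖inner ℂ (h t x) g‖ₑ ^ ((p - 2) + 2) := by ring_nf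
          _ = ‖inner ℂ (h t x) g‖ₑ ^ (p - 2) * ‖inner ℂ (h t x) g‖ₑ ^ (2 : ℝ) :=
              ENNReal.rpow_add_of_nonneg _ _ (by linarith) (by norm_num)
          _ ≤ _ := mul_le_mul_left
              (ENNReal.rpow_le_rpow (hd.enorm_inner_le g t x) (by linarith)) _
    _ ≤ _ := by
        rw [lintegral_const_mul _ (by fun_prop)]
        gcongr
        exact hd.bessel t g

variable [CompleteSpace H]

lemma IsDispersiveFamily.enorm_inner_integral_smul_le (hd : IsDispersiveFamily μ h C σ B)
    {t s : ℝ} {F G : X → ℂ} (hF : Integrable (fun x => F x • h t x) μ)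
    (hG : Integrable (fun x => G x • h s x) μ) (hFm : Measurable F) (hGm : Measurable G) :
    ‖inner ℂ (∫ x, F x • h t x ∂μ) (∫ y, G y • h s y ∂μ)‖ₑ ≤
      ENNReal.ofReal C * ENNReal.ofReal |t - s| ^ (-σ) *
        ((∫⁻ x, ‖F x‖ₑ ∂μ) * ∫⁻ y, ‖G y‖ₑ ∂μ) := by
  refine (enorm_inner_integral_integral_le hF hG).trans ?_
  set D := ENNReal.ofReal C * ENNReal.ofReal |t - s| ^ (-σ)
  calc _ ≤ ∫⁻ x, ∫⁻ y, D * ‖F x‖ₑ * ‖G y‖ₑ ∂μ ∂μ := by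
        refine lintegral_mono fun x => lintegral_mono fun y => ?_
        rw [inner_smul_left, inner_smul_right, enorm_mul, enorm_mul, RCLike.enorm_conj]
        calc _ = ‖inner ℂ (h t x) (h s y)‖ₑ * ‖F x‖ₑ * ‖G y‖ₑ := by ring
          _ ≤ _ := by gcongr; exact hd.decay t s x y
    _ = _ := by
        simp_rw [lintegral_const_mul _ hGm.enorm]
        rw [lintegral_mul_const _ (by fun_prop), lintegral_const_mul _ hFm.enorm]
        ring

/-- The endpoint estimate tested on finitely many dyadic packets. -/
lemma IsDispersiveFamily.sum_packets_le [SFinite μ] (hd : IsDispersiveFamily μ h C σ B) (hσ : 1 < σ)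
    {K : ℝ≥0∞} (hK : ∀ (s : Finset ℤ) (v : ℤ → ℝ → H) (f : ℤ → ℝ → ℝ≥0∞),
      (∀ n, Integrable (v n)) → (∀ n, Measurable (f n)) →
      (∀ n t, ‖v n t‖ₑ ≤ 2 ^ ((n : ℝ) / (σ - 1)) * f n t) →
      (∀ n l t s, ‖inner ℂ (v n t) (v l s)‖ₑ ≤ ENNReal.ofReal C * ENNReal.ofReal |t - s| ^ (-σ) *
        ((2 ^ (-n : ℝ) * f n t) * (2 ^ (-l : ℝ) * f l s))) →
      ‖∑ n ∈ s, ∫ t, v n t‖ₑ ^ 2 ≤ K * ∑ n ∈ s, ∫⁻ t, f n t ^ 2)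
    (g : H) {p : ℝ} (hp : p = 2 * σ / (σ - 1)) {N : ℝ → ℝ≥0∞} (hNm : Measurable N)
    {M : ℝ≥0∞} (hM : M ≠ ∞) (hNM : ∀ t, N t ≤ M) {E : Set ℝ} (hE : volume E ≠ ∞)
    (hEm : MeasurableSet E) (hNE : ∀ t, t ∉ E → N t = 0)
    (hN : ∀ t, N t = 0 ∨ N t ^ p = ∫⁻ x, ‖inner ℂ (h t x) g‖ₑ ^ p ∂μ) (s : Finset ℤ) :
    ∑ n ∈ s, ∫⁻ t, N t ^ 2 * (2 ^ (n * p) *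
      μ (dyadicLevel (fun x => ‖inner ℂ (h t x) g‖ₑ) (N t) n)) ≤ K * ‖g‖ₑ ^ 2 := by
  have hσ1 : 0 < σ - 1 := by linarith
  have hp0 : 0 < p := by rw [hp]; positivity
  set φ : ℝ → X → ℝ≥0∞ := fun t x => ‖inner ℂ (h t x) g‖ₑ with hφ
  have hφm : Measurable fun z : ℝ × X => φ z.1 z.2 := (hd.measurable_inner g).enorm
  have hφtm : ∀ t, Measurable (φ t) := fun t => hφm.comp measurable_prodMk_left
  have hNt : ∀ t, N t ≠ ∞ := fun t => ((hNM t).trans_lt hM.lt_top).ne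
  set L : ℤ → Set (ℝ × X) := fun n => {z | z.2 ∈ dyadicLevel (φ z.1) (N z.1) n} with hL
  have hLm : ∀ n, MeasurableSet (L n) := fun n =>
    (hφm.div (hNm.comp measurable_fst)) measurableSet_Ico
  set m : ℤ → ℝ → ℝ≥0∞ := fun n t => μ (dyadicLevel (φ t) (N t) n) with hm
  have hmm : ∀ n, Measurable (m n) := fun n => measurable_measure_prodMk_left (hLm n)
  set a : ℤ → ℝ → ℝ≥0∞ := fun n t => 2 ^ (n * p) * m n t with ha
  have ham : ∀ n, Measurable (a n) := fun n => (hmm n).const_mul _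
  have ha1 : ∀ n t, a n t ≤ 1 := fun n t =>
    rpow_mul_measure_dyadicLevel_le_one (hφtm t) (hNt t) hp0 (hN t) n
  set f : ℤ → ℝ → ℝ≥0∞ := fun n t => N t * a n t ^ (1 / 2 : ℝ) with hf
  have hfm : ∀ n, Measurable (f n) := fun n => hNm.mul ((ham n).pow_const _)
  have hf2 : ∀ n t, f n t ^ 2 = N t ^ 2 * a n t := by
    intro n t
    rw [hf]
    dsimp only
    rw [mul_pow, ← ENNReal.rpow_natCast (a n t ^ _), ← ENNReal.rpow_mul]
    norm_num
  set c : ℤ → ℝ × X → ℝ≥0∞ := fun n => (L n).indicator (fun z => 2 ^ (n * (p - 1)) * N z.1) with hc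
  have hcm : ∀ n, Measurable (c n) := fun n =>
    Measurable.indicator ((hNm.comp measurable_fst).const_mul _) (hLm n)
  have hct : ∀ n z, c n z ≠ ∞ := by
    intro n z
    by_cases hz : z ∈ L n
    · simp only [hc, Set.indicator_of_mem hz]
      exact ENNReal.mul_ne_top (two_rpow_ne_top _) (hNt _)
    · simp [hc, hz]
  have hcpt : ∀ n t x, c n (t, x) = (dyadicLevel (φ t) (N t) n).indicator
      (fun _ => 2 ^ (n * (p - 1)) * N t) x := by
    intro n t x
    by_cases hz : x ∈ dyadicLevel (φ t) (N t) n
    · have : (t, x) ∈ L n := hz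
      simp only [hc, Set.indicator_of_mem this, Set.indicator_of_mem hz]
    · have : (t, x) ∉ L n := hz
      simp only [hc, Set.indicator_of_notMem this, Set.indicator_of_notMem hz]
  have hlev := fun t n => measurableSet_dyadicLevel (hφtm t) (N t) n
  have hc1 : ∀ n t, ∫⁻ x, c n (t, x) ∂μ = 2 ^ (-n : ℝ) * (N t * a n t) := by
    intro n t
    simp_rw [hcpt]
    rw [lintegral_indicator_const (hlev t n)]
    have : (2 : ℝ≥0∞) ^ (n * (p - 1)) = 2 ^ (-n : ℝ) * 2 ^ (n * p) := by
      rw [← ENNReal.rpow_add _ _ (by simp) (by simp)]; ring_nf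
    rw [this, ha]
    ring
  have hc1' : ∀ n t, ∫⁻ x, c n (t, x) ∂μ ≤ 2 ^ (-n : ℝ) * f n t := by
    intro n t
    rw [hc1]
    refine mul_le_mul' le_rfl (mul_le_mul' le_rfl ?_)
    calc a n t = a n t ^ (1 : ℝ) := by simp
      _ ≤ a n t ^ (1 / 2 : ℝ) := ENNReal.rpow_le_rpow_of_exponent_ge (ha1 n t) (by norm_num)
  have hc2 : ∀ n t, (∫⁻ x, c n (t, x) ^ 2 ∂μ) ^ (1 / 2 : ℝ) = 2 ^ ((n : ℝ) / (σ - 1)) * f n t := by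
    intro n t
    have : ∀ x, c n (t, x) ^ 2 = (dyadicLevel (φ t) (N t) n).indicator
        (fun _ => (2 ^ (n * (p - 1)) * N t) ^ 2) x := by
      intro x
      rw [hcpt]
      by_cases hz : x ∈ dyadicLevel (φ t) (N t) n <;> simp [hz]
    simp_rw [this]
    rw [lintegral_indicator_const (hlev t n), ENNReal.mul_rpow_of_nonneg _ _ (by norm_num),
      ← ENNReal.rpow_natCast, ← ENNReal.rpow_mul, Nat.cast_ofNat, mul_one_div_cancel two_ne_zero,
      ENNReal.rpow_one, hf]
    dsimp only
    rw [ha]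
    dsimp only
    rw [ENNReal.mul_rpow_of_nonneg (2 ^ (n * p)) _ (by norm_num), ← ENNReal.rpow_mul 2 (n * p)]
    have e1 : (2 : ℝ≥0∞) ^ (n * (p - 1)) = 2 ^ ((n : ℝ) / (σ - 1)) * 2 ^ (n * p * (1 / 2)) := by
      rw [← ENNReal.rpow_add _ _ (by simp) (by simp)]
      congr 1
      rw [hp]; field_simp; ring
    rw [e1]
    ring
  set F : ℤ → ℝ × X → ℂ := fun n z => ((c n z).toReal : ℂ) * phase (inner ℂ (h z.1 z.2) g) with hF
  have hFm : ∀ n, Measurable (F n) := fun n =>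
    (Complex.measurable_ofReal.comp (hcm n).ennreal_toReal).mul
      (measurable_phase.comp (hd.measurable_inner g))
  have hFtm : ∀ n t, Measurable fun x => F n (t, x) := fun n t => (hFm n).comp measurable_prodMk_left
  have hFc : ∀ n z, ‖F n z‖ₑ ≤ c n z := fun n z => enorm_toReal_mul_phase_le _ _
  have hhm := hd.stronglyMeasurable
  have hhtm : ∀ t, StronglyMeasurable (h t) := fun t => hhm.comp_measurable measurable_prodMk_left
  have hFi : ∀ n t, Integrable (fun x => F n (t, x) • h t x) μ := by
    intro n t
    refine ⟨((hFtm n t).stronglyMeasurable.smul (hhtm t)).aestronglyMeasurable, ?_⟩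
    refine (hasFiniteIntegral_iff_enorm).2 (lt_of_le_of_lt
      (lintegral_mono (g := fun x => c n (t, x) * B) fun x => ?_) ?_)
    · rw [enorm_smul]; exact mul_le_mul' (hFc n _) (hd.enorm_le t x)
    · have hcmt : Measurable fun x => c n (t, x) := (hcm n).comp measurable_prodMk_left
      rw [lintegral_mul_const _ hcmt, hc1]
      refine ENNReal.mul_lt_top (ENNReal.mul_lt_top (two_rpow_ne_top _).lt_top
        (ENNReal.mul_lt_top (hNt t).lt_top ((ha1 n t).trans_lt ENNReal.one_lt_top))) hd.ne_top.lt_top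
  have hFi2 : ∀ n, Integrable (fun z : ℝ × X => F n z • h z.1 z.2) (volume.prod μ) := by
    intro n
    refine ⟨((hFm n).stronglyMeasurable.smul hhm).aestronglyMeasurable, ?_⟩
    refine (hasFiniteIntegral_iff_enorm).2 (lt_of_le_of_lt
      (lintegral_mono (g := fun z => c n z * B) fun z => ?_) ?_)
    · rw [enorm_smul]; exact mul_le_mul' (hFc n _) (hd.enorm_le _ _)
    · rw [lintegral_mul_const _ (hcm n), lintegral_prod _ (hcm n).aemeasurable]
      refine ENNReal.mul_lt_top ?_ hd.ne_top.lt_top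
      simp_rw [hc1]
      rw [lintegral_const_mul _ (by fun_prop)]
      refine ENNReal.mul_lt_top (two_rpow_ne_top _).lt_top ?_
      calc _ ≤ ∫⁻ t, E.indicator (fun _ => M) t := by
            refine lintegral_mono fun t => ?_
            by_cases ht : t ∈ E
            · simp only [Set.indicator_of_mem ht]
              calc _ ≤ M * 1 := mul_le_mul' (hNM t) (ha1 n t)
                _ = M := mul_one M
            · simp [hNE t ht]
        _ = M * volume E := lintegral_indicator_const hEm _
        _ < ∞ := ENNReal.mul_lt_top hM.lt_top hE.lt_top
  have hf2lt : ∀ n, ∫⁻ t, f n t ^ 2 < ∞ := by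
    intro n
    calc _ ≤ ∫⁻ t, E.indicator (fun _ => M ^ 2) t := by
            refine lintegral_mono fun t => ?_
            rw [hf2]
            by_cases ht : t ∈ E
            · simp only [Set.indicator_of_mem ht]
              calc _ ≤ M ^ 2 * 1 := mul_le_mul' (pow_le_pow_left' (hNM t) 2) (ha1 n t)
                _ = M ^ 2 := mul_one _
            · simp [hNE t ht]
        _ = M ^ 2 * volume E := lintegral_indicator_const hEm _
        _ < ∞ := ENNReal.mul_lt_top (by simp [hM.lt_top]) hE.lt_top
  set v : ℤ → ℝ → H := fun n t => ∫ x, F n (t, x) • h t x ∂μ with hv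
  have hvi : ∀ n, Integrable (v n) := fun n => (hFi2 n).integral_prod_left
  have hG := hK s v f hvi hfm
    (fun n t => by
      rw [← hc2]
      refine (enorm_integral_smul_le (hd.bessel t) (hFi n t) (hFtm n t).aemeasurable
        (hhtm t).aestronglyMeasurable).trans ?_
      gcongr with x
      exact hFc n _)
    (fun n l t s => by
      refine (hd.enorm_inner_integral_smul_le (hFi n t) (hFi l s) (hFtm n t) (hFtm l s)).trans ?_
      gcongr
      · exact (lintegral_mono fun x => hFc n _).trans (hc1' n t)
      · exact (lintegral_mono fun x => hFc l _).trans (hc1' l s))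
  set G := ∑ n ∈ s, ∫ t, v n t with hGdef
  set S := ∑ n ∈ s, ∫⁻ t, f n t ^ 2 with hS
  have hSG : S ≤ ‖inner ℂ G g‖ₑ := by
    choose I hI0 hI1 hI2 using fun n => inner_integral_phase_smul (g := g) (hct n) (hFi2 n)
    have e1 : ∀ n, ∫ t, v n t = ∫ z, F n z • h z.1 z.2 ∂(volume.prod μ) := fun n =>
      (integral_prod _ (hFi2 n)).symm
    have e2 : inner ℂ G g = ((∑ n ∈ s, I n : ℝ) : ℂ) := by
      rw [hGdef, sum_inner]
      push_cast
      refine Finset.sum_congr rfl fun n _ => ?_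
      rw [e1, ← hI2 n]
    rw [e2, ← ofReal_norm, Complex.norm_real,
      Real.norm_of_nonneg (Finset.sum_nonneg fun n _ => hI0 n),
      ENNReal.ofReal_sum_of_nonneg fun n _ => hI0 n]
    refine Finset.sum_le_sum fun n _ => ?_
    rw [hI1, lintegral_prod (fun z : ℝ × X => c n z * ‖inner ℂ (h z.1 z.2) g‖ₑ)
      ((hcm n).mul hφm).aemeasurable]
    refine lintegral_mono fun t => ?_
    rw [hf2]
    calc N t ^ 2 * a n t = ∫⁻ x, (dyadicLevel (φ t) (N t) n).indicator
          (fun _ => (2 ^ (n * (p - 1)) * N t) * (2 ^ (n : ℝ) * N t)) x ∂μ := by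
          rw [lintegral_indicator_const (hlev t n)]
          have : (2 : ℝ≥0∞) ^ (n * p) = 2 ^ (n * (p - 1)) * 2 ^ (n : ℝ) := by
            rw [← ENNReal.rpow_add _ _ (by simp) (by simp)]; ring_nf
          rw [ha]
          dsimp only
          rw [this]
          ring
      _ ≤ _ := by
          refine lintegral_mono fun x => ?_
          rw [hcpt]
          by_cases hz : x ∈ dyadicLevel (φ t) (N t) n
          · simp only [Set.indicator_of_mem hz]
            gcongr
            exact two_rpow_mul_le_of_mem_dyadicLevel hz
          · simp [hz]
  have hSt : S ≠ ∞ := (ENNReal.sum_lt_top.2 fun n _ => hf2lt n).ne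
  have hSe : ∑ n ∈ s, ∫⁻ t, N t ^ 2 * (2 ^ (n * p) * μ (dyadicLevel (φ t) (N t) n)) = S := by
    rw [hS]; simp_rw [hf2]; rfl
  rw [hSe]
  by_cases hS0 : S = 0
  · simp [hS0]
  have hfin : S * S ≤ S * (K * ‖g‖ₑ ^ 2) := by
    calc S * S ≤ (‖G‖ₑ * ‖g‖ₑ) * (‖G‖ₑ * ‖g‖ₑ) := by
          have := hSG.trans (_root_.enorm_inner_le G g)
          gcongr
      _ = ‖G‖ₑ ^ 2 * ‖g‖ₑ ^ 2 := by ring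
      _ ≤ K * S * ‖g‖ₑ ^ 2 := by gcongr
      _ = _ := by ring
  exact (ENNReal.mul_le_mul_iff_right hS0 hSt).1 hfin

/-- The endpoint Strichartz estimate of Keel and Tao for dispersive families. -/
theorem exists_endpoint_strichartz {C σ : ℝ} (hC : 0 < C) (hσ : 1 < σ) :
    ∃ K : ℝ≥0∞, K ≠ ∞ ∧ ∀ {X : Type*} [MeasurableSpace X] {μ : Measure X} [SFinite μ] {H : Type*}
      [NormedAddCommGroup H] [InnerProductSpace ℂ H] [CompleteSpace H] {h : ℝ → X → H} {B : ℝ≥0∞},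
      IsDispersiveFamily μ h C σ B → ∀ g : H,
      ∫⁻ t, (∫⁻ x, ‖inner ℂ (h t x) g‖ₑ ^ (2 * σ / (σ - 1)) ∂μ) ^ (2 / (2 * σ / (σ - 1))) ≤
        K * ‖g‖ₑ ^ 2 := by
  have hσ1 : 0 < σ - 1 := by linarith
  obtain ⟨K, hKt, hK⟩ := exists_enorm_sum_integral_packets_sq_le hC hσ
  set p := 2 * σ / (σ - 1) with hp
  have hp2 : 2 ≤ p := by rw [hp, le_div_iff₀ hσ1]; linarith
  have hp0 : 0 < p := by linarith
  refine ⟨2 ^ p * K, ENNReal.mul_ne_top (two_rpow_ne_top p) hKt, ?_⟩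
  intro X _ μ _ H _ _ _ h B hd g
  set N₀ : ℝ → ℝ≥0∞ := fun t => (∫⁻ x, ‖inner ℂ (h t x) g‖ₑ ^ p ∂μ) ^ (1 / p) with hN₀
  have hN₀m : Measurable N₀ :=
    (Measurable.lintegral_prod_right' ((hd.measurable_inner g).enorm.pow_const p)).pow_const _
  set M : ℝ≥0∞ := ((B * ‖g‖ₑ) ^ (p - 2) * ‖g‖ₑ ^ 2) ^ (1 / p) with hM
  have hMt : M ≠ ∞ := by
    refine ENNReal.rpow_ne_top_of_nonneg (by positivity) (ENNReal.mul_ne_top ?_ (by simp))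
    exact ENNReal.rpow_ne_top_of_nonneg (by linarith) (ENNReal.mul_ne_top hd.ne_top enorm_ne_top)
  have hN₀M : ∀ t, N₀ t ≤ M := fun t =>
    ENNReal.rpow_le_rpow (hd.lintegral_rpow_le g t hp2) (by positivity)
  have hE : ∀ t, (∫⁻ x, ‖inner ℂ (h t x) g‖ₑ ^ p ∂μ) ^ (2 / p) = N₀ t ^ 2 := by
    intro t
    rw [hN₀]
    dsimp only
    rw [← ENNReal.rpow_natCast, ← ENNReal.rpow_mul]
    congr 1
    push_cast; ring
  simp_rw [hE]
  have hR : ∀ R : ℕ, ∫⁻ t in Set.Icc (-R : ℝ) R, N₀ t ^ 2 ≤ 2 ^ p * K * ‖g‖ₑ ^ 2 := by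
    intro R
    set E := Set.Icc (-R : ℝ) R with hEdef
    set N : ℝ → ℝ≥0∞ := E.indicator N₀ with hN
    have hNm : Measurable N := hN₀m.indicator measurableSet_Icc
    have hNp : ∀ t, N t = 0 ∨ N t ^ p = ∫⁻ x, ‖inner ℂ (h t x) g‖ₑ ^ p ∂μ := by
      intro t
      by_cases ht : t ∈ E
      · right
        rw [hN, Set.indicator_of_mem ht, hN₀]
        dsimp only
        rw [← ENNReal.rpow_mul, one_div_mul_cancel hp0.ne', ENNReal.rpow_one]
      · left; simp [hN, ht]
    have hNM : ∀ t, N t ≤ M := by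
      intro t
      by_cases ht : t ∈ E
      · rw [hN, Set.indicator_of_mem ht]; exact hN₀M t
      · simp [hN, ht]
    have hpack := hd.sum_packets_le hσ (fun s v f => hK s v f) g hp hNm hMt hNM (E := E)
      (by simp [hEdef]) measurableSet_Icc (fun t ht => by simp [hN, ht]) hNp
    have hsum : ∑' n : ℤ, ∫⁻ t, N t ^ 2 * (2 ^ (n * p) *
        μ (dyadicLevel (fun x => ‖inner ℂ (h t x) g‖ₑ) (N t) n)) ≤ K * ‖g‖ₑ ^ 2 :=
      ENNReal.tsum_le_of_forall_sum_le hpack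
    have hmm : ∀ n : ℤ, Measurable fun t => N t ^ 2 * (2 ^ (n * p) *
        μ (dyadicLevel (fun x => ‖inner ℂ (h t x) g‖ₑ) (N t) n)) := by
      intro n
      refine (hNm.pow_const 2).mul (Measurable.const_mul ?_ _)
      exact measurable_measure_prodMk_left (s := {z : ℝ × X |
        ‖inner ℂ (h z.1 z.2) g‖ₑ / N z.1 ∈ Set.Ico ((2 : ℝ≥0∞) ^ (n : ℝ)) (2 ^ ((n : ℝ) + 1))})
        (((hd.measurable_inner g).enorm.div (hNm.comp measurable_fst)) measurableSet_Ico)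
    rw [← lintegral_indicator measurableSet_Icc]
    calc _ ≤ ∫⁻ t, 2 ^ p * ∑' n : ℤ, N t ^ 2 * (2 ^ (n * p) *
          μ (dyadicLevel (fun x => ‖inner ℂ (h t x) g‖ₑ) (N t) n)) := by
          refine lintegral_mono fun t => ?_
          have : E.indicator (fun t => N₀ t ^ 2) t = N t ^ 2 := by
            by_cases ht : t ∈ E <;> simp [hN, ht]
          rw [this]
          exact sq_le_tsum_dyadicLevel ((hd.measurable_inner g).enorm.comp measurable_prodMk_left)
            (fun x => enorm_ne_top) ((hNM t).trans_lt hMt.lt_top).ne hp0 (hNp t)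
      _ = 2 ^ p * ∑' n : ℤ, ∫⁻ t, N t ^ 2 * (2 ^ (n * p) *
          μ (dyadicLevel (fun x => ‖inner ℂ (h t x) g‖ₑ) (N t) n)) := by
          rw [lintegral_const_mul _ (Measurable.tsum hmm),
            lintegral_tsum fun n => (hmm n).aemeasurable]
      _ ≤ 2 ^ p * (K * ‖g‖ₑ ^ 2) := by gcongr
      _ = _ := by ring
  exact setLIntegral_Icc_le_imp hR

end Endpoint

lemma setLIntegral_abs_le_rpow_le {σ J : ℝ} (hσ : σ < 1) (hJ : 0 < J) :
    ∫⁻ τ in {τ : ℝ | |τ| ≤ J}, ENNReal.ofReal |τ| ^ (-σ) ≤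
      ENNReal.ofReal (2 * J ^ (1 - σ) / (1 - σ)) := by
  have e : {τ : ℝ | |τ| ≤ J} ⊆ {0} ∪ (Set.Ioc 0 J ∪ Set.Ico (-J) 0) := by
    intro τ hτ
    have := abs_le.1 (show |τ| ≤ J from hτ)
    simp only [Set.mem_union, Set.mem_singleton_iff, Set.mem_Ioc, Set.mem_Ico]
    rcases lt_trichotomy τ 0 with h | h | h
    · exact Or.inr (Or.inr ⟨this.1, h⟩)
    · exact Or.inl h
    · exact Or.inr (Or.inl ⟨h, this.2⟩)
  have hσ1 : 0 < 1 - σ := by linarith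
  have h1 : ∫⁻ τ in Set.Ioc 0 J, ENNReal.ofReal |τ| ^ (-σ) =
      ENNReal.ofReal (J ^ (1 - σ) / (1 - σ)) := by
    have : ∫⁻ τ in Set.Ioc 0 J, ENNReal.ofReal |τ| ^ (-σ) =
        ∫⁻ τ in Set.Ioc 0 J, ENNReal.ofReal (τ ^ (-σ)) := by
      refine setLIntegral_congr_fun measurableSet_Ioc fun τ hτ => ?_
      have h0 : 0 < τ := hτ.1
      rw [abs_of_pos h0, ENNReal.ofReal_rpow_of_pos h0]
    rw [this, ← ofReal_integral_eq_lintegral_ofReal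
      ((intervalIntegrable_iff_integrableOn_Ioc_of_le hJ.le).1
        (intervalIntegral.intervalIntegrable_rpow' (by linarith)))]
    · rw [← intervalIntegral.integral_of_le hJ.le, integral_rpow (Or.inl (by linarith)),
        Real.zero_rpow (by linarith), sub_zero, neg_add_eq_sub]
    · filter_upwards [ae_restrict_mem measurableSet_Ioc] with τ hτ
      exact Real.rpow_nonneg hτ.1.le _
  have h2 : ∫⁻ τ in Set.Ico (-J) 0, ENNReal.ofReal |τ| ^ (-σ) =
      ENNReal.ofReal (J ^ (1 - σ) / (1 - σ)) := by
    rw [← h1, ← lintegral_indicator measurableSet_Ico, ← lintegral_indicator measurableSet_Ioc,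
      ← lintegral_neg_eq_self]
    refine lintegral_congr fun τ => ?_
    simp only [Set.indicator_apply, Set.mem_Ico, Set.mem_Ioc, abs_neg, neg_le_neg_iff,
      Left.neg_neg_iff, and_comm]
  have hJ' := Real.rpow_pos_of_pos hJ (1 - σ)
  calc _ ≤ ∫⁻ τ in {0} ∪ (Set.Ioc 0 J ∪ Set.Ico (-J) 0), ENNReal.ofReal |τ| ^ (-σ) :=
        lintegral_mono_set e
    _ ≤ (∫⁻ τ in {(0 : ℝ)}, ENNReal.ofReal |τ| ^ (-σ)) +
        ((∫⁻ τ in Set.Ioc 0 J, ENNReal.ofReal |τ| ^ (-σ)) +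
          ∫⁻ τ in Set.Ico (-J) 0, ENNReal.ofReal |τ| ^ (-σ)) :=
        (lintegral_union_le _ _ _).trans (add_le_add le_rfl (lintegral_union_le _ _ _))
    _ = _ := by
        rw [h1, h2, setLIntegral_measure_zero _ _ (by simp), zero_add,
          ← ENNReal.ofReal_add (by positivity) (by positivity)]
        congr 1; ring

/-- Among sets of given measure, the integral of `|t - s| ^ (-σ)` scales as for intervals. -/
lemma setLIntegral_abs_sub_rpow_le {σ : ℝ} (hσ0 : 0 < σ) (hσ : σ < 1) (E : Set ℝ) (t : ℝ) :
    ∫⁻ s in E, ENNReal.ofReal |t - s| ^ (-σ) ≤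
      ENNReal.ofReal (2 / (1 - σ) + 1) * volume E ^ (1 - σ) := by
  have hσ1 : 0 < 1 - σ := by linarith
  by_cases h0 : volume E = 0
  · rw [setLIntegral_measure_zero _ _ h0]; exact zero_le
  by_cases ht : volume E = ∞
  · rw [ht, ENNReal.top_rpow_of_pos hσ1, ENNReal.mul_top]
    · exact le_top
    · rw [Ne, ENNReal.ofReal_eq_zero, not_le]; positivity
  set J := (volume E).toReal with hJ
  have hJ0 : 0 < J := ENNReal.toReal_pos h0 ht
  have hEJ : volume E = ENNReal.ofReal J := (ENNReal.ofReal_toReal ht).symm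
  set k : ℝ → ℝ≥0∞ := {τ : ℝ | |τ| ≤ J}.indicator (fun τ => ENNReal.ofReal |τ| ^ (-σ)) with hk
  have hms : MeasurableSet {τ : ℝ | |τ| ≤ J} := measurableSet_le (by fun_prop) (by fun_prop)
  have hkm : Measurable k := Measurable.indicator (by fun_prop) hms
  calc _ ≤ ∫⁻ s in E, (k (t - s) + ENNReal.ofReal J ^ (-σ)) := by
        refine lintegral_mono fun s => ?_
        by_cases h : |t - s| ≤ J
        · have : (t - s) ∈ {τ : ℝ | |τ| ≤ J} := h
          rw [hk, Set.indicator_of_mem this]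
          exact le_self_add
        · refine le_trans ?_ le_add_self
          rw [ENNReal.rpow_neg, ENNReal.rpow_neg, ENNReal.inv_le_inv]
          gcongr
          exact (not_le.1 h).le
    _ = (∫⁻ s in E, k (t - s)) + ENNReal.ofReal J ^ (-σ) * volume E := by
        rw [lintegral_add_right _ measurable_const, setLIntegral_const]
    _ ≤ (∫⁻ s, k (t - s)) + ENNReal.ofReal J ^ (-σ) * volume E := by
        gcongr; exact Measure.restrict_le_self
    _ ≤ ENNReal.ofReal (2 * J ^ (1 - σ) / (1 - σ)) + ENNReal.ofReal (J ^ (1 - σ)) := by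
        gcongr
        · rw [lintegral_sub_left_eq_self k t, hk, lintegral_indicator hms]
          exact setLIntegral_abs_le_rpow_le hσ hJ0
        · rw [hEJ, ENNReal.ofReal_rpow_of_pos hJ0, ← ENNReal.ofReal_mul (by positivity)]
          apply le_of_eq
          congr 1
          rw [show 1 - σ = -σ + 1 by ring, Real.rpow_add hJ0, Real.rpow_one]
    _ = _ := by
        have hJ' := Real.rpow_pos_of_pos hJ0 (1 - σ)
        rw [hEJ, ENNReal.ofReal_rpow_of_pos hJ0, ← ENNReal.ofReal_add (by positivity)
          (by positivity), ← ENNReal.ofReal_mul (by positivity)]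
        congr 1; ring

/-- The Hardy-Littlewood-Sobolev inequality for indicator functions. -/
lemma lintegral_lintegral_abs_sub_rpow_le {σ : ℝ} (hσ0 : 0 < σ) (hσ : σ < 1) (E F : Set ℝ) :
    ∫⁻ t in E, ∫⁻ s in F, ENNReal.ofReal |t - s| ^ (-σ) ≤
      ENNReal.ofReal (2 / (1 - σ) + 1) * (volume E * volume F ^ (1 - σ)) := by
  calc _ ≤ ∫⁻ t in E, ENNReal.ofReal (2 / (1 - σ) + 1) * volume F ^ (1 - σ) :=
        lintegral_mono fun t => setLIntegral_abs_sub_rpow_le hσ0 hσ F t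
    _ = _ := by rw [setLIntegral_const]; ring

section SubcriticalDecay

variable {H : Type*} [NormedAddCommGroup H] [InnerProductSpace ℂ H] [CompleteSpace H]

lemma enorm_inner_integral_packet_le {h : ℝ → H} {C σ : ℝ} (hσ0 : 0 < σ) (hσ : σ < 1)
    (hdec : ∀ t s, ‖inner ℂ (h t) (h s)‖ₑ ≤ ENNReal.ofReal C * ENNReal.ofReal |t - s| ^ (-σ))
    {E F : Set ℝ} (hE : MeasurableSet E) (hF : MeasurableSet F) {a b : ℝ≥0∞} {f g : ℝ → ℂ}
    (hf : ∀ t, ‖f t‖ₑ ≤ E.indicator (fun _ => a) t) (hg : ∀ t, ‖g t‖ₑ ≤ F.indicator (fun _ => b) t)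
    (hfi : Integrable fun t => f t • h t) (hgi : Integrable fun t => g t • h t) :
    ‖inner ℂ (∫ t, f t • h t) (∫ s, g s • h s)‖ₑ ≤
      ENNReal.ofReal C * ENNReal.ofReal (2 / (1 - σ) + 1) *
        (a * b * (volume E * volume F ^ (1 - σ))) := by
  refine (enorm_inner_integral_integral_le hfi hgi).trans ?_
  calc _ ≤ ∫⁻ t, E.indicator (fun t => ENNReal.ofReal C * (a * b) *
        ∫⁻ s in F, ENNReal.ofReal |t - s| ^ (-σ)) t := by
        refine lintegral_mono fun t => ?_
        by_cases ht : t ∈ E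
        · rw [Set.indicator_of_mem ht, ← lintegral_const_mul _ (by fun_prop),
            ← lintegral_indicator hF]
          refine lintegral_mono fun s => ?_
          have h1 := hf t
          have h2 := hg s
          rw [Set.indicator_of_mem ht] at h1
          rw [inner_smul_left, inner_smul_right, enorm_mul, enorm_mul, RCLike.enorm_conj]
          by_cases hs : s ∈ F
          · rw [Set.indicator_of_mem hs] at h2 ⊢
            calc _ ≤ a * (b * (ENNReal.ofReal C * ENNReal.ofReal |t - s| ^ (-σ))) := by
                  gcongr; exact hdec t s
              _ = _ := by ring
          · rw [Set.indicator_of_notMem hs, nonpos_iff_eq_zero] at h2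
            simp [h2]
        · have h1 := hf t
          rw [Set.indicator_of_notMem ht, nonpos_iff_eq_zero, enorm_eq_zero] at h1
          simp [h1]
    _ = ENNReal.ofReal C * (a * b) * ∫⁻ t in E, ∫⁻ s in F, ENNReal.ofReal |t - s| ^ (-σ) := by
        rw [lintegral_indicator hE, lintegral_const_mul]
        exact Measurable.lintegral_prod_right' (f := fun z : ℝ × ℝ =>
          ENNReal.ofReal |z.1 - z.2| ^ (-σ)) (by fun_prop)
    _ ≤ ENNReal.ofReal C * (a * b) *
        (ENNReal.ofReal (2 / (1 - σ) + 1) * (volume E * volume F ^ (1 - σ))) := by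
        gcongr; exact lintegral_lintegral_abs_sub_rpow_le hσ0 hσ E F
    _ = _ := by ring

lemma exists_lintegral_inner_rpow_le_of_ne_top (C : ℝ) {σ : ℝ} (hσ0 : 0 < σ) (hσ : σ < 1) :
    ∃ K : ℝ≥0∞, K ≠ ∞ ∧ ∀ {H : Type*} [NormedAddCommGroup H] [InnerProductSpace ℂ H]
      [CompleteSpace H] {h : ℝ → H} {B : ℝ≥0∞}, StronglyMeasurable h → B ≠ ∞ →
      (∀ t, ‖h t‖ₑ ≤ B) →
      (∀ t s, ‖inner ℂ (h t) (h s)‖ₑ ≤ ENNReal.ofReal C * ENNReal.ofReal |t - s| ^ (-σ)) →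
      ∀ g : H, ∫⁻ t, ‖inner ℂ (h t) g‖ₑ ^ (2 / σ) ≠ ∞ →
      (∫⁻ t, ‖inner ℂ (h t) g‖ₑ ^ (2 / σ)) ^ σ ≤ K * ‖g‖ₑ ^ 2 := by
  have hlog : 0 < Real.log 2 := Real.log_pos (by norm_num)
  set D := ENNReal.ofReal C * ENNReal.ofReal (2 / (1 - σ) + 1) with hD
  set e : ℤ → ℝ≥0∞ := fun m => ENNReal.ofReal (Real.exp (-(Real.log 2 * |(m : ℝ)|))) with he
  set K := 2 * ∑' m, D * e m with hK
  have hKt : K ≠ ∞ := by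
    rw [hK, ENNReal.tsum_mul_left]
    exact ENNReal.mul_ne_top (by simp) (ENNReal.mul_ne_top
      (ENNReal.mul_ne_top ENNReal.ofReal_ne_top ENNReal.ofReal_ne_top)
      (tsum_exp_neg_mul_abs_ne_top hlog))
  set r := 2 / σ with hr
  have hr0 : 0 < r := by positivity
  refine ⟨2 ^ r * K, ENNReal.mul_ne_top (two_rpow_ne_top r) hKt, ?_⟩
  intro H _ _ _ h B hm hB hhB hdec g hT
  set φ : ℝ → ℝ≥0∞ := fun t => ‖inner ℂ (h t) g‖ₑ with hφ
  have him : Measurable fun t => inner ℂ (h t) g :=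
    (hm.inner (stronglyMeasurable_const (b := g))).measurable
  have hφm : Measurable φ := him.enorm
  set N := (∫⁻ t, φ t ^ r) ^ (1 / r) with hN
  have hNt : N ≠ ∞ := ENNReal.rpow_ne_top_of_nonneg (by positivity) hT
  have hNr : N ^ r = ∫⁻ t, φ t ^ r := by
    rw [hN, ← ENNReal.rpow_mul, one_div_mul_cancel hr0.ne', ENNReal.rpow_one]
  have hN2 : (∫⁻ t, φ t ^ r) ^ σ = N ^ 2 := by
    rw [hN, ← ENNReal.rpow_natCast, ← ENNReal.rpow_mul]
    congr 1
    rw [hr]; push_cast; field_simp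
  rw [hN2]
  set E : ℤ → Set ℝ := dyadicLevel φ N with hE
  have hEm : ∀ n, MeasurableSet (E n) := measurableSet_dyadicLevel hφm N
  set a : ℤ → ℝ≥0∞ := fun n => 2 ^ (n * r) * volume (E n) with ha
  have ha1 : ∀ n, a n ≤ 1 := rpow_mul_measure_dyadicLevel_le_one hφm hNt hr0 (Or.inr hNr)
  have hEa : ∀ n, volume (E n) = 2 ^ (-(n * r)) * a n := by
    intro n
    rw [ha]
    dsimp only
    rw [← mul_assoc, ← ENNReal.rpow_add _ _ (by simp) (by simp)]
    simp
  have hEt : ∀ n, volume (E n) ≠ ∞ := fun n => by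
    rw [hEa]
    exact ENNReal.mul_ne_top (two_rpow_ne_top _) ((ha1 n).trans_lt ENNReal.one_lt_top).ne
  set c : ℤ → ℝ → ℝ≥0∞ := fun n => (E n).indicator (fun _ => 2 ^ (n * (r - 1))) with hc
  have hcm : ∀ n, Measurable (c n) := fun n => measurable_const.indicator (hEm n)
  have hct : ∀ n t, c n t ≠ ∞ := fun n t => by
    by_cases ht : t ∈ E n
    · simp only [hc, Set.indicator_of_mem ht]; exact two_rpow_ne_top _
    · simp [hc, ht]
  set F : ℤ → ℝ → ℂ := fun n t => ((c n t).toReal : ℂ) * phase (inner ℂ (h t) g) with hF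
  have hFc : ∀ n t, ‖F n t‖ₑ ≤ c n t := fun n t => enorm_toReal_mul_phase_le _ _
  have hFm : ∀ n, Measurable (F n) := fun n =>
    (Complex.measurable_ofReal.comp (hcm n).ennreal_toReal).mul (measurable_phase.comp him)
  have hFi : ∀ n, Integrable fun t => F n t • h t := by
    intro n
    refine ⟨((hFm n).stronglyMeasurable.smul hm).aestronglyMeasurable, ?_⟩
    refine (hasFiniteIntegral_iff_enorm).2 (lt_of_le_of_lt
      (lintegral_mono (g := fun t => c n t * B) fun t => ?_) ?_)
    · rw [enorm_smul]; exact mul_le_mul' (hFc n t) (hhB t)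
    · rw [lintegral_mul_const _ (hcm n), hc]
      dsimp only
      rw [lintegral_indicator_const (hEm n)]
      exact ENNReal.mul_lt_top (ENNReal.mul_lt_top (two_rpow_ne_top _).lt_top (hEt n).lt_top)
        hB.lt_top
  set G : ℤ → H := fun n => ∫ t, F n t • h t with hG
  have hpair : ∀ n l, l ≤ n → ‖inner ℂ (G n) (G l)‖ₑ ≤ D * e (n - l) * a n := by
    intro n l hln
    refine (enorm_inner_integral_packet_le hσ0 hσ hdec (hEm n) (hEm l) (hFc n) (hFc l)
      (hFi n) (hFi l)).trans ?_
    rw [hEa n, hEa l, ENNReal.mul_rpow_of_nonneg _ _ (by linarith), ← ENNReal.rpow_mul]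
    have e1 : (2 : ℝ≥0∞) ^ (n * (r - 1)) * 2 ^ (l * (r - 1)) *
        (2 ^ (-(n * r)) * 2 ^ (-(l * r) * (1 - σ))) = e (n - l) := by
      rw [← ENNReal.rpow_add _ _ (by simp) (by simp), ← ENNReal.rpow_add _ _ (by simp) (by simp),
        ← ENNReal.rpow_add _ _ (by simp) (by simp), he]
      dsimp only
      have h0 : (0 : ℝ) ≤ n - l := by
        have : (l : ℝ) ≤ n := by exact_mod_cast hln
        linarith
      push_cast
      rw [abs_of_nonneg h0, ← mul_neg (Real.log 2), Real.exp_mul, Real.exp_log (by norm_num),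
        ← ENNReal.ofReal_rpow_of_pos (by norm_num), ENNReal.ofReal_ofNat]
      congr 1
      have : r * σ = 2 := by rw [hr]; field_simp
      linear_combination (l : ℝ) * this
    calc _ = D * ((2 : ℝ≥0∞) ^ (n * (r - 1)) * 2 ^ (l * (r - 1)) *
          (2 ^ (-(n * r)) * 2 ^ (-(l * r) * (1 - σ)))) * a n * a l ^ (1 - σ) := by ring
      _ ≤ D * e (n - l) * a n * 1 := by
          rw [e1]
          gcongr
          exact ENNReal.rpow_le_one (ha1 l) (by linarith)
      _ = _ := mul_one _
  have hes : ∀ m, e (-m) = e m := fun m => by simp [he]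
  have hpair' : ∀ n l, ‖inner ℂ (G n) (G l)‖ₑ ≤ D * e (n - l) * (a n + a l) := by
    intro n l
    rcases le_total l n with hln | hln
    · exact (hpair n l hln).trans (by gcongr; exact le_self_add)
    · rw [← inner_conj_symm, RCLike.enorm_conj, ← hes, neg_sub]
      exact (hpair l n hln).trans (by gcongr; exact le_add_self)
  have hfin : ∀ s : Finset ℤ, ∑ n ∈ s, N ^ 2 * a n ≤ K * ‖g‖ₑ ^ 2 := by
    intro s
    have hGs := enorm_sum_sq_le_of_pairwise s G (fun m => D * e m) a hpair'
    set A := ∑ n ∈ s, a n with hA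
    have hAt : A ≠ ∞ := (ENNReal.sum_lt_top.2 fun n _ => (ha1 n).trans_lt ENNReal.one_lt_top).ne
    rw [← Finset.mul_sum, ← hA]
    have hSG : N * A ≤ ‖∑ n ∈ s, G n‖ₑ * ‖g‖ₑ := by
      refine le_trans ?_ (_root_.enorm_inner_le _ _)
      choose I hI0 hI1 hI2 using fun n => inner_integral_phase_smul (g := g) (hct n) (hFi n)
      have e2 : inner ℂ (∑ n ∈ s, G n) g = ((∑ n ∈ s, I n : ℝ) : ℂ) := by
        rw [sum_inner]
        push_cast
        exact Finset.sum_congr rfl fun n _ => hI2 n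
      rw [e2, ← ofReal_norm, Complex.norm_real,
        Real.norm_of_nonneg (Finset.sum_nonneg fun n _ => hI0 n),
        ENNReal.ofReal_sum_of_nonneg fun n _ => hI0 n, hA, Finset.mul_sum]
      refine Finset.sum_le_sum fun n _ => ?_
      rw [hI1]
      calc N * a n = ∫⁻ t, (E n).indicator (fun _ => 2 ^ (n * (r - 1)) * (2 ^ (n : ℝ) * N)) t := by
            rw [lintegral_indicator_const (hEm n)]
            have : (2 : ℝ≥0∞) ^ (n * r) = 2 ^ (n * (r - 1)) * 2 ^ (n : ℝ) := by
              rw [← ENNReal.rpow_add _ _ (by simp) (by simp)]; ring_nf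
            rw [ha]
            dsimp only
            rw [this]
            ring
        _ ≤ _ := by
            refine lintegral_mono fun t => ?_
            by_cases ht : t ∈ E n
            · simp only [hc, Set.indicator_of_mem ht]
              gcongr
              exact two_rpow_mul_le_of_mem_dyadicLevel ht
            · simp [ht]
    by_cases hA0 : A = 0
    · simp [hA0]
    refine (ENNReal.mul_le_mul_iff_right hA0 hAt).1 ?_
    calc A * (N ^ 2 * A) = (N * A) ^ 2 := by ring
      _ ≤ (‖∑ n ∈ s, G n‖ₑ * ‖g‖ₑ) ^ 2 := by gcongr
      _ = ‖∑ n ∈ s, G n‖ₑ ^ 2 * ‖g‖ₑ ^ 2 := by ring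
      _ ≤ K * A * ‖g‖ₑ ^ 2 := by gcongr
      _ = _ := by ring
  calc N ^ 2 ≤ 2 ^ r * ∑' n : ℤ, N ^ 2 * a n :=
        sq_le_tsum_dyadicLevel hφm (fun t => enorm_ne_top) hNt hr0 (Or.inr hNr)
    _ ≤ 2 ^ r * (K * ‖g‖ₑ ^ 2) := by gcongr; exact ENNReal.tsum_le_of_forall_sum_le hfin
    _ = _ := by ring

/-- The Strichartz estimate in time for a single orbit whose Gram kernel decays like
`|t - s| ^ (-σ)` with `σ < 1`. -/
theorem exists_lintegral_inner_rpow_le (C : ℝ) {σ : ℝ} (hσ0 : 0 < σ) (hσ : σ < 1) :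
    ∃ K : ℝ≥0∞, K ≠ ∞ ∧ ∀ {H : Type*} [NormedAddCommGroup H] [InnerProductSpace ℂ H]
      [CompleteSpace H] {h : ℝ → H} {B : ℝ≥0∞}, StronglyMeasurable h → B ≠ ∞ →
      (∀ t, ‖h t‖ₑ ≤ B) →
      (∀ t s, ‖inner ℂ (h t) (h s)‖ₑ ≤ ENNReal.ofReal C * ENNReal.ofReal |t - s| ^ (-σ)) →
      ∀ g : H, ∫⁻ t, ‖inner ℂ (h t) g‖ₑ ^ (2 / σ) ≤ (K * ‖g‖ₑ ^ 2) ^ (1 / σ) := by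
  obtain ⟨K, hKt, hK⟩ := exists_lintegral_inner_rpow_le_of_ne_top C hσ0 hσ
  refine ⟨K, hKt, ?_⟩
  intro H _ _ _ h B hm hB hhB hdec g
  refine setLIntegral_Icc_le_imp fun R => ?_
  set S := Set.Icc (-R : ℝ) R with hS
  have hSm : MeasurableSet S := measurableSet_Icc
  have hr0 : 0 < 2 / σ := by positivity
  have e : ∫⁻ t in S, ‖inner ℂ (h t) g‖ₑ ^ (2 / σ) =
      ∫⁻ t, ‖inner ℂ (S.indicator h t) g‖ₑ ^ (2 / σ) := by
    rw [← lintegral_indicator hSm]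
    refine lintegral_congr fun t => ?_
    by_cases ht : t ∈ S <;> simp [ht, hr0]
  have hle : ∀ t, ‖S.indicator h t‖ₑ ≤ B := fun t => by
    by_cases ht : t ∈ S <;> simp [ht, hhB t]
  have hfin : ∫⁻ t, ‖inner ℂ (S.indicator h t) g‖ₑ ^ (2 / σ) ≠ ∞ := by
    rw [← e]
    refine ne_top_of_le_ne_top ?_ (setLIntegral_mono' (g := fun _ => (B * ‖g‖ₑ) ^ (2 / σ)) hSm
      fun t _ => ENNReal.rpow_le_rpow
        ((_root_.enorm_inner_le _ _).trans (mul_le_mul' (hhB t) le_rfl)) hr0.le)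
    rw [setLIntegral_const]
    refine ENNReal.mul_ne_top (ENNReal.rpow_ne_top_of_nonneg hr0.le
      (ENNReal.mul_ne_top hB enorm_ne_top)) (by simp [hS])
  have := hK (hm.indicator hSm) hB hle (fun t s => by
    by_cases ht : t ∈ S <;> by_cases hs : s ∈ S <;> simp [ht, hs, hdec t s]) g hfin
  rw [e]
  calc _ = ((∫⁻ t, ‖inner ℂ (S.indicator h t) g‖ₑ ^ (2 / σ)) ^ σ) ^ (1 / σ) := by
        rw [← ENNReal.rpow_mul, mul_one_div_cancel hσ0.ne', ENNReal.rpow_one]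
    _ ≤ _ := ENNReal.rpow_le_rpow this (by positivity)

lemma exists_measurable_partialSups_eq {φ : ℕ → ℝ → ℝ≥0∞} (hφ : ∀ m, Measurable (φ m)) (M : ℕ) :
    ∃ y : ℝ → ℕ, Measurable y ∧ ∀ t, φ (y t) t = partialSups (fun m => φ m t) M := by
  classical
  induction M with
  | zero => exact ⟨fun _ => 0, measurable_const, fun t => by simp⟩
  | succ M ih =>
    obtain ⟨y, hy, hyφ⟩ := ih
    have hm : Measurable fun t => φ (y t) t := by
      have : Measurable fun z : ℕ × ℝ => φ z.1 z.2 := measurable_from_prod_countable_right hφ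
      exact this.comp (hy.prodMk measurable_id)
    refine ⟨fun t => if φ (y t) t ≤ φ (M + 1) t then M + 1 else y t,
      Measurable.ite (measurableSet_le hm (hφ _)) measurable_const hy, fun t => ?_⟩
    rw [partialSups_add_one, ← hyφ]
    dsimp only
    split_ifs with h
    · exact (sup_of_le_right h).symm
    · exact (sup_of_le_left (not_le.1 h).le).symm

/-- The maximal form of the Strichartz estimate for slowly decaying Gram kernels. -/
theorem exists_lintegral_iSup_inner_rpow_le (C : ℝ) {σ : ℝ} (hσ0 : 0 < σ) (hσ : σ < 1) :
    ∃ K : ℝ≥0∞, K ≠ ∞ ∧ ∀ {X : Type*} [MeasurableSpace X] {μ : Measure X} {H : Type*}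
      [NormedAddCommGroup H] [InnerProductSpace ℂ H] [CompleteSpace H] {h : ℝ → X → H} {B : ℝ≥0∞},
      IsDispersiveFamily μ h C σ B → ∀ (g : H) (x : ℕ → X),
      ∫⁻ t, (⨆ m, ‖inner ℂ (h t (x m)) g‖ₑ) ^ (2 / σ) ≤ (K * ‖g‖ₑ ^ 2) ^ (1 / σ) := by
  obtain ⟨K, hKt, hK⟩ := exists_lintegral_inner_rpow_le C hσ0 hσ
  refine ⟨K, hKt, ?_⟩
  intro X _ μ H _ _ _ h B hd g x
  have hr0 : 0 < 2 / σ := by positivity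
  set φ : ℕ → ℝ → ℝ≥0∞ := fun m t => ‖inner ℂ (h t (x m)) g‖ₑ with hφ
  have hφm : ∀ m, Measurable (φ m) := fun m =>
    ((hd.measurable_inner g).comp (measurable_id.prodMk (measurable_const (a := x m)))).enorm
  choose y hy hyφ using exists_measurable_partialSups_eq hφm
  have e : ∀ t, (⨆ m, ‖inner ℂ (h t (x m)) g‖ₑ) ^ (2 / σ) = ⨆ M, φ (y M t) t ^ (2 / σ) := by
    intro t
    rw [← iSup_partialSups_eq, ← ENNReal.orderIsoRpow_apply _ hr0, OrderIso.map_iSup]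
    simp_rw [hyφ]
    rfl
  simp_rw [e]
  have hxy : ∀ M, Measurable fun t => x (y M t) := fun M => measurable_from_top.comp (hy M)
  rw [lintegral_iSup]
  · refine iSup_le fun M => ?_
    exact hK (h := fun t => h t (x (y M t)))
      (hd.stronglyMeasurable.comp_measurable (measurable_id.prodMk (hxy M))) hd.ne_top
      (fun t => hd.enorm_le _ _) (fun t s => hd.decay _ _ _ _) g
  · intro M
    exact (((hd.measurable_inner g).comp (measurable_id.prodMk (hxy M))).enorm).pow_const _
  · intro M M' hMM t
    dsimp only
    refine ENNReal.rpow_le_rpow ?_ hr0.le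
    rw [hyφ, hyφ]
    exact (partialSups _).monotone hMM

end SubcriticalDecay

section Interpolation

variable {X : Type*} [MeasurableSpace X] {μ : Measure X}

lemma lintegral_rpow_le_interpolate {φ : X → ℝ≥0∞} (hφ : AEMeasurable φ μ) {p p₁ θ : ℝ}
    (hp : 0 < p) (hp₁ : 0 < p₁) (hθ0 : 0 ≤ θ) (hθ1 : θ ≤ 1) (h : 1 / p = (1 - θ) / 2 + θ / p₁) :
    (∫⁻ x, φ x ^ p ∂μ) ^ (1 / p) ≤
      ((∫⁻ x, φ x ^ (2 : ℝ) ∂μ) ^ (1 / 2 : ℝ)) ^ (1 - θ) * ((∫⁻ x, φ x ^ p₁ ∂μ) ^ (1 / p₁)) ^ θ := by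
  have ha : 0 ≤ (1 - θ) * p / 2 := by
    have : 0 ≤ 1 - θ := by linarith
    positivity
  have hb : 0 ≤ θ * p / p₁ := by positivity
  have hab : (1 - θ) * p / 2 + θ * p / p₁ = 1 := by
    calc _ = p * ((1 - θ) / 2 + θ / p₁) := by ring
      _ = 1 := by rw [← h, mul_one_div_cancel hp.ne']
  have key := ENNReal.lintegral_mul_norm_pow_le (hφ.pow_const (2 : ℝ)) (hφ.pow_const p₁) ha hb hab
  have e : ∀ x, (φ x ^ (2 : ℝ)) ^ ((1 - θ) * p / 2) * (φ x ^ p₁) ^ (θ * p / p₁) = φ x ^ p := by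
    intro x
    rw [← ENNReal.rpow_mul, ← ENNReal.rpow_mul, ← ENNReal.rpow_add_of_nonneg _ _ (by positivity)
      (by positivity)]
    congr 1
    field_simp
    ring
  simp_rw [e] at key
  calc _ ≤ ((∫⁻ x, φ x ^ (2 : ℝ) ∂μ) ^ ((1 - θ) * p / 2) *
        (∫⁻ x, φ x ^ p₁ ∂μ) ^ (θ * p / p₁)) ^ (1 / p) :=
        ENNReal.rpow_le_rpow key (by positivity)
    _ = _ := by
        rw [ENNReal.mul_rpow_of_nonneg _ _ (by positivity), ← ENNReal.rpow_mul,
          ← ENNReal.rpow_mul, ← ENNReal.rpow_mul, ← ENNReal.rpow_mul]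
        congr 2 <;> field_simp

lemma lintegral_rpow_le_interpolate_iSup {φ : X → ℝ≥0∞} {A : ℝ≥0∞} (hA : ∀ x, φ x ≤ A)
    (hφ : AEMeasurable φ μ) {p : ℝ} (hp : 2 ≤ p) :
    (∫⁻ x, φ x ^ p ∂μ) ^ (1 / p) ≤
      ((∫⁻ x, φ x ^ (2 : ℝ) ∂μ) ^ (1 / 2 : ℝ)) ^ (2 / p) * A ^ (1 - 2 / p) := by
  have hp0 : 0 < p := by linarith
  calc _ ≤ (∫⁻ x, A ^ (p - 2) * φ x ^ (2 : ℝ) ∂μ) ^ (1 / p) := by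
        refine ENNReal.rpow_le_rpow (lintegral_mono fun x => ?_) (by positivity)
        calc φ x ^ p = φ x ^ ((p - 2) + 2) := by ring_nf
          _ = φ x ^ (p - 2) * φ x ^ (2 : ℝ) :=
              ENNReal.rpow_add_of_nonneg _ _ (by linarith) (by norm_num)
          _ ≤ _ := mul_le_mul_left (ENNReal.rpow_le_rpow (hA x) (by linarith)) _
    _ = _ := by
        rw [lintegral_const_mul'' _ (hφ.pow_const _), ENNReal.mul_rpow_of_nonneg _ _ (by positivity),
          ← ENNReal.rpow_mul, ← ENNReal.rpow_mul, mul_comm]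
        congr 2 <;> field_simp

lemma timeNorm_le_of_interpolate {n A : ℝ → ℝ≥0∞} {G K : ℝ≥0∞} (hG : G ≠ ∞) {r : ℝ≥0∞}
    (hr0 : r ≠ 0) (hrt : r ≠ ∞) {θ : ℝ} (hθ0 : 0 ≤ θ) (hθ1 : θ ≤ 1)
    (hn : ∀ t, n t ≤ G ^ (1 - θ) * A t ^ θ)
    (hA : ∫⁻ t, A t ^ (θ * r.toReal) ≤ K * G ^ (θ * r.toReal)) :
    timeNorm r n ≤ K ^ (1 / r.toReal) * G := by
  have hr : 0 < r.toReal := ENNReal.toReal_pos hr0 hrt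
  have h1θ : 0 ≤ 1 - θ := by linarith
  rw [timeNorm, if_neg hrt]
  calc _ ≤ (∫⁻ t, G ^ ((1 - θ) * r.toReal) * A t ^ (θ * r.toReal)) ^ (1 / r.toReal) := by
        refine ENNReal.rpow_le_rpow (lintegral_mono fun t => ?_) (by positivity)
        rw [ENNReal.rpow_mul, ENNReal.rpow_mul, ← ENNReal.mul_rpow_of_nonneg _ _ hr.le]
        exact ENNReal.rpow_le_rpow (hn t) hr.le
    _ ≤ (G ^ ((1 - θ) * r.toReal) * (K * G ^ (θ * r.toReal))) ^ (1 / r.toReal) := by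
        rw [lintegral_const_mul' _ _ (ENNReal.rpow_ne_top_of_nonneg (by positivity) hG)]
        gcongr
    _ = (K * G ^ r.toReal) ^ (1 / r.toReal) := by
        congr 1
        rw [mul_left_comm, ← ENNReal.rpow_add_of_nonneg _ _ (by positivity) (by positivity)]
        congr 2
        ring
    _ = _ := by
        rw [ENNReal.mul_rpow_of_nonneg _ _ (by positivity), ← ENNReal.rpow_mul,
          mul_one_div_cancel hr.ne', ENNReal.rpow_one]

end Interpolation

section Strichartz

lemma IsDispersiveFamily.lintegral_rpow_two_le {X : Type*} [MeasurableSpace X] {μ : Measure X}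
    {H : Type*} [NormedAddCommGroup H] [InnerProductSpace ℂ H] {h : ℝ → X → H} {C σ : ℝ} {B : ℝ≥0∞}
    (hd : IsDispersiveFamily μ h C σ B) (g : H) (t : ℝ) :
    (∫⁻ x, ‖inner ℂ (h t x) g‖ₑ ^ (2 : ℝ) ∂μ) ^ (1 / 2 : ℝ) ≤ ‖g‖ₑ := by
  calc _ ≤ (‖g‖ₑ ^ (2 : ℝ)) ^ (1 / 2 : ℝ) := by
        refine ENNReal.rpow_le_rpow ?_ (by norm_num)
        simpa using hd.bessel t g
    _ = _ := by rw [← ENNReal.rpow_mul]; norm_num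

lemma IsDispersiveFamily.eLpNorm_two_le {X : Type*} [MeasurableSpace X] {μ : Measure X}
    {H : Type*} [NormedAddCommGroup H] [InnerProductSpace ℂ H] {h : ℝ → X → H} {C σ : ℝ} {B : ℝ≥0∞}
    (hd : IsDispersiveFamily μ h C σ B) (g : H) (t : ℝ) :
    eLpNorm (fun x => inner ℂ (h t x) g) 2 μ ≤ ‖g‖ₑ := by
  rw [eLpNorm_eq_lintegral_rpow_enorm_toReal (by simp) (by simp)]
  simpa using hd.lintegral_rpow_two_le g t

lemma eq_two_of_inv_toReal_eq {p : ℝ≥0∞} (h : (p⁻¹).toReal = 1 / 2) : p = 2 := by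
  have h1 : p⁻¹ ≠ ∞ := by rintro h'; simp [h'] at h
  have h2 : p⁻¹ = 2⁻¹ := by
    rw [← ENNReal.ofReal_toReal h1, h, one_div, ENNReal.ofReal_inv_of_pos two_pos,
      ENNReal.ofReal_ofNat]
  exact inv_injective h2

/-- Strichartz estimates for dispersive families with integrable decay away from the diagonal. -/
theorem exists_timeNorm_le_of_one_lt {C σ : ℝ} (hC : 0 < C) (hσ : 1 < σ) {p r : ℝ≥0∞} (hp : 2 ≤ p)
    (hr : 2 ≤ r) (hpr : (r⁻¹).toReal = σ * (1 / 2 - (p⁻¹).toReal)) :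
    ∃ K : ℝ≥0∞, K ≠ ∞ ∧ ∀ {X : Type*} [MeasurableSpace X] {μ : Measure X} [SFinite μ] {H : Type*}
      [NormedAddCommGroup H] [InnerProductSpace ℂ H] [CompleteSpace H] {h : ℝ → X → H} {B : ℝ≥0∞},
      IsDispersiveFamily μ h C σ B → ∀ g : H,
      timeNorm r (fun t => eLpNorm (fun x => inner ℂ (h t x) g) p μ) ≤ K * ‖g‖ₑ := by
  have hσ1 : 0 < σ - 1 := by linarith
  by_cases hrt : r = ∞
  · have hp2 : p = 2 := by
      refine eq_two_of_inv_toReal_eq ?_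
      rw [hrt, ENNReal.inv_top, ENNReal.toReal_zero, eq_comm, mul_eq_zero] at hpr
      rcases hpr with h | h <;> linarith
    refine ⟨1, by simp, ?_⟩
    intro X _ μ _ H _ _ _ h B hd g
    rw [timeNorm, if_pos hrt, hp2, one_mul]
    exact essSup_le_of_ae_le _ (Filter.Eventually.of_forall fun t => hd.eLpNorm_two_le g t)
  have hr0 : r ≠ 0 := (lt_of_lt_of_le (by simp) hr).ne'
  have hr2 : 2 ≤ r.toReal := by
    simpa using ENNReal.toReal_mono hrt hr
  have hp0 : p ≠ 0 := (lt_of_lt_of_le (by simp) hp).ne'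
  rw [ENNReal.toReal_inv] at hpr
  have hrle : (r.toReal)⁻¹ ≤ 1 / 2 := by
    rw [one_div]; exact inv_anti₀ (by norm_num) hr2
  have hpt : p ≠ ∞ := by
    rintro rfl
    simp only [ENNReal.inv_top, ENNReal.toReal_zero, sub_zero] at hpr
    linarith
  have hp2 : 2 ≤ p.toReal := by simpa using ENNReal.toReal_mono hpt hp
  rw [ENNReal.toReal_inv] at hpr
  obtain ⟨K, hKt, hK⟩ := exists_endpoint_strichartz hC hσ
  refine ⟨K ^ (1 / r.toReal), ENNReal.rpow_ne_top_of_nonneg (by positivity) hKt, ?_⟩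
  intro X _ μ _ H _ _ _ h B hd g
  have hθr : 2 / r.toReal * r.toReal = 2 := by field_simp
  refine timeNorm_le_of_interpolate (θ := 2 / r.toReal)
    (A := fun t => (∫⁻ x, ‖inner ℂ (h t x) g‖ₑ ^ (2 * σ / (σ - 1)) ∂μ) ^ (1 / (2 * σ / (σ - 1))))
    enorm_ne_top hr0 hrt (by positivity) ?_ (fun t => ?_) ?_
  · rw [div_eq_mul_inv]; linarith
  · rw [eLpNorm_eq_lintegral_rpow_enorm_toReal hp0 hpt]
    have hm : Measurable fun x => inner ℂ (h t x) g :=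
      (hd.measurable_inner g).comp measurable_prodMk_left
    refine (lintegral_rpow_le_interpolate (θ := 2 / r.toReal) (p₁ := 2 * σ / (σ - 1))
      hm.enorm.aemeasurable (by linarith) (by positivity)
      (by positivity) ?_ ?_).trans (mul_le_mul_left (ENNReal.rpow_le_rpow
        (hd.lintegral_rpow_two_le g t) ?_) _)
    · rw [div_eq_mul_inv]; linarith
    · rw [div_eq_mul_inv 2, hpr]; field_simp; ring
    · rw [div_eq_mul_inv]; linarith
  · rw [hθr, ENNReal.rpow_two]
    simp_rw [← ENNReal.rpow_mul, one_div_mul_eq_div]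
    exact hK hd g

/-- Strichartz estimates for dispersive families with locally integrable decay. -/
theorem exists_timeNorm_le_of_lt_one (C : ℝ) {σ : ℝ} (hσ0 : 0 < σ) (hσ : σ < 1) {p r : ℝ≥0∞}
    (hp : 2 ≤ p) (hr : 2 ≤ r) (hpr : (r⁻¹).toReal = σ * (1 / 2 - (p⁻¹).toReal)) :
    ∃ K : ℝ≥0∞, K ≠ ∞ ∧ ∀ {X : Type*} [MeasurableSpace X] [TopologicalSpace X]
      [TopologicalSpace.SeparableSpace X] [Nonempty X] {μ : Measure X} {H : Type*}
      [NormedAddCommGroup H] [InnerProductSpace ℂ H] [CompleteSpace H] {h : ℝ → X → H} {B : ℝ≥0∞},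
      IsDispersiveFamily μ h C σ B → (∀ t, Continuous (h t)) → ∀ g : H,
      timeNorm r (fun t => eLpNorm (fun x => inner ℂ (h t x) g) p μ) ≤ K * ‖g‖ₑ := by
  by_cases hrt : r = ∞
  · have hp2 : p = 2 := by
      refine eq_two_of_inv_toReal_eq ?_
      rw [hrt, ENNReal.inv_top, ENNReal.toReal_zero, eq_comm, mul_eq_zero] at hpr
      rcases hpr with h | h <;> linarith
    refine ⟨1, by simp, ?_⟩
    intro X _ _ _ _ μ H _ _ _ h B hd _ g
    rw [timeNorm, if_pos hrt, hp2, one_mul]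
    exact essSup_le_of_ae_le _ (Filter.Eventually.of_forall fun t => hd.eLpNorm_two_le g t)
  have hr0 : r ≠ 0 := (lt_of_lt_of_le (by simp) hr).ne'
  have hr2 : 2 ≤ r.toReal := by
    simpa using ENNReal.toReal_mono hrt hr
  have hp0 : p ≠ 0 := (lt_of_lt_of_le (by simp) hp).ne'
  rw [ENNReal.toReal_inv] at hpr
  obtain ⟨K, hKt, hK⟩ := exists_lintegral_iSup_inner_rpow_le C hσ0 hσ
  refine ⟨(K ^ (1 / σ)) ^ (1 / r.toReal), ENNReal.rpow_ne_top_of_nonneg (by positivity)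
    (ENNReal.rpow_ne_top_of_nonneg (by positivity) hKt), ?_⟩
  intro X _ _ _ _ μ H _ _ _ h B hd hcont g
  set θ := 2 / σ / r.toReal with hθ
  have hθr : θ * r.toReal = 2 / σ := by rw [hθ]; field_simp
  have hθp : θ = 1 - 2 * (p⁻¹).toReal := by
    rw [hθ, div_div, mul_comm, ← div_div, div_eq_mul_inv 2 r.toReal, hpr]; field_simp
  have hsup : ∀ t x, ‖inner ℂ (h t x) g‖ₑ ≤
      ⨆ m, ‖inner ℂ (h t (TopologicalSpace.denseSeq X m)) g‖ₑ := by
    intro t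
    have hc : Continuous fun x => ‖inner ℂ (h t x) g‖ₑ :=
      ((hcont t).inner continuous_const).enorm
    have hcl : IsClosed {x | ‖inner ℂ (h t x) g‖ₑ ≤
        ⨆ m, ‖inner ℂ (h t (TopologicalSpace.denseSeq X m)) g‖ₑ} :=
      isClosed_le hc continuous_const
    have hsub : Set.range (TopologicalSpace.denseSeq X) ⊆ {x | ‖inner ℂ (h t x) g‖ₑ ≤
        ⨆ m, ‖inner ℂ (h t (TopologicalSpace.denseSeq X m)) g‖ₑ} := by
      rintro _ ⟨m, rfl⟩
      exact le_iSup (fun m => ‖inner ℂ (h t (TopologicalSpace.denseSeq X m)) g‖ₑ) m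
    intro x
    exact hcl.closure_subset_iff.2 hsub (TopologicalSpace.denseRange_denseSeq X x)
  refine timeNorm_le_of_interpolate (θ := θ)
    (A := fun t => ⨆ m, ‖inner ℂ (h t (TopologicalSpace.denseSeq X m)) g‖ₑ)
    enorm_ne_top hr0 hrt (by positivity) ?_ (fun t => ?_) ?_
  · rw [hθp]
    have : 0 ≤ (p⁻¹).toReal := ENNReal.toReal_nonneg
    linarith
  · have hm : Measurable fun x => inner ℂ (h t x) g :=
      (hd.measurable_inner g).comp measurable_prodMk_left
    by_cases hpt : p = ∞
    · have : θ = 1 := by rw [hθp, hpt]; simp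
      rw [this, hpt, sub_self, ENNReal.rpow_zero, one_mul, ENNReal.rpow_one, eLpNorm_exponent_top]
      exact essSup_le_of_ae_le _ (Filter.Eventually.of_forall (hsup t))
    · have hp2 : 2 ≤ p.toReal := by simpa using ENNReal.toReal_mono hpt hp
      have hθp' : θ = 1 - 2 / p.toReal := by
        rw [hθp, ENNReal.toReal_inv, div_eq_mul_inv]
      rw [eLpNorm_eq_lintegral_rpow_enorm_toReal hp0 hpt, hθp', sub_sub_cancel]
      exact (lintegral_rpow_le_interpolate_iSup (hsup t) hm.enorm.aemeasurable hp2).trans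
        (mul_le_mul_left (ENNReal.rpow_le_rpow (hd.lintegral_rpow_two_le g t) (by positivity)) _)
  · rw [hθr]
    refine (hK hd g _).trans_eq ?_
    rw [ENNReal.mul_rpow_of_nonneg _ _ (by positivity), ← ENNReal.rpow_two, ← ENNReal.rpow_mul,
      mul_one_div]

end Strichartz

/-- The half-open cube `(-N, N]^d`. -/
def halfOpenCube (d : ℕ) (N : ℝ) : Set (Sp d) := {ξ | ∀ i, ξ i ∈ Set.Ioc (-N) N}

/-- The phase `2π⟨x, ξ⟩ + tφ(ξ)` of the oscillating plane wave solving the dispersive equation. -/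
noncomputable def planePhase {d : ℕ} (α β γ t : ℝ) (x ξ : Sp d) : ℝ :=
  2 * Real.pi * inner ℝ ξ x + dispersion α β γ ξ * t

lemma firstCoord_eq {d : ℕ} (hd : 0 < d) (ξ : Sp d) : firstCoord ξ = ξ ⟨0, hd⟩ := by
  rw [firstCoord, dif_pos hd]; rfl

lemma planePhase_toLp {d : ℕ} (hd : 0 < d) (α β γ t : ℝ) (x : Sp d) (v : Fin d → ℝ) :
    planePhase α β γ t x (WithLp.toLp 2 v) = ∑ i, (2 * Real.pi * x i * v i +
      t * (α * v i ^ 2 + (if i = ⟨0, hd⟩ then β else 0) * v i ^ 3 +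
        (if i = ⟨0, hd⟩ then γ else 0) * v i ^ 4)) := by
  simp only [planePhase, dispersion, firstCoord_eq hd, EuclideanSpace.norm_sq_eq,
    PiLp.inner_apply, Real.norm_eq_abs, sq_abs, Finset.sum_add_distrib, ← Finset.mul_sum, ite_mul,
    zero_mul, Finset.sum_ite_eq', Finset.mem_univ, if_true]
  simp only [RCLike.inner_apply, conj_trivial, mul_assoc, ← Finset.mul_sum]
  ring

lemma norm_setIntegral_halfOpenCube_le {d : ℕ} (hd : 0 < d) {α β γ : ℝ} (hα : α ≠ 0)
    (hβγ : (β, γ) ≠ (0, 0)) :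
    ∃ C : ℝ, 0 < C ∧ ∀ (N t : ℝ) (x : Sp d), 0 ≤ N → t ≠ 0 →
      ‖∫ ξ in halfOpenCube d N, Complex.exp (Complex.I * (planePhase α β γ t x ξ : ℝ))‖ ≤
        C * |t| ^ (-(dEff d γ / 2)) := by
  obtain ⟨C₁, hC₁, h₁⟩ := oscillatory_higher α β γ hβγ
  obtain ⟨C₂, hC₂, h₂⟩ := oscillatory_quadratic α hα
  refine ⟨C₁ * C₂ ^ (d - 1), by positivity, ?_⟩
  intro N t x hN ht
  have hpre : WithLp.toLp 2 ⁻¹' halfOpenCube d N = Set.pi Set.univ fun _ => Set.Ioc (-N) N := by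
    ext v; simp [halfOpenCube, Set.mem_pi]
  rw [← (PiLp.volume_preserving_toLp (Fin d)).setIntegral_preimage_emb
    (MeasurableEquiv.toLp 2 (Fin d → ℝ)).measurableEmbedding, hpre, volume_pi,
    Measure.restrict_pi_pi]
  set f : Fin d → ℝ → ℂ := fun i v => Complex.exp (Complex.I * ((2 * Real.pi * x i * v +
      t * (α * v ^ 2 + (if i = ⟨0, hd⟩ then β else 0) * v ^ 3 +
        (if i = ⟨0, hd⟩ then γ else 0) * v ^ 4) : ℝ) : ℂ)) with hf
  have hprod : ∀ v : Fin d → ℝ,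
      Complex.exp (Complex.I * (planePhase α β γ t x (WithLp.toLp 2 v) : ℝ)) = ∏ i, f i (v i) := by
    intro v
    rw [planePhase_toLp hd, Complex.ofReal_sum, Finset.mul_sum, Complex.exp_sum]
  simp_rw [hprod]
  rw [integral_fintype_prod_eq_prod, norm_prod, ← Finset.mul_prod_erase _ _ (Finset.mem_univ
    (⟨0, hd⟩ : Fin d))]
  have hNN : -N ≤ N := by linarith
  have ht0 : 0 < |t| := abs_pos.2 ht
  have e₁ : ‖∫ v in Set.Ioc (-N) N, f ⟨0, hd⟩ v‖ ≤ C₁ * |t| ^ (-(1/2 - (cgam γ)⁻¹/2)) := by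
    rw [← intervalIntegral.integral_of_le hNN]
    simpa [hf] using h₁ t (2 * Real.pi * x ⟨0, hd⟩) (-N) N ht hNN
  have e₂ : ∀ i ∈ Finset.univ.erase (⟨0, hd⟩ : Fin d),
      ‖∫ v in Set.Ioc (-N) N, f i v‖ ≤ C₂ * |t| ^ (-(1/2) : ℝ) := by
    intro i hi
    have hi' := Finset.ne_of_mem_erase hi
    rw [← intervalIntegral.integral_of_le hNN]
    simpa [hf, hi'] using h₂ t (2 * Real.pi * x i) (-N) N ht hNN
  calc _ ≤ (C₁ * |t| ^ (-(1/2 - (cgam γ)⁻¹/2))) *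
        ∏ i ∈ Finset.univ.erase (⟨0, hd⟩ : Fin d), (C₂ * |t| ^ (-(1/2) : ℝ)) :=
      mul_le_mul e₁ (Finset.prod_le_prod (fun _ _ => norm_nonneg _) e₂)
        (Finset.prod_nonneg fun _ _ => norm_nonneg _) (by positivity)
    _ = _ := by
      rw [Finset.prod_const, Finset.card_erase_of_mem (Finset.mem_univ _), Finset.card_fin,
        mul_pow, ← Real.rpow_natCast (|t| ^ (-(1/2) : ℝ)), ← Real.rpow_mul ht0.le,
        mul_mul_mul_comm, ← Real.rpow_add ht0, Nat.cast_sub hd, dEff]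
      congr 2
      push_cast
      ring

lemma continuous_dispersion {d : ℕ} (α β γ : ℝ) :
    Continuous (dispersion α β γ : Sp d → ℝ) := by
  have h : Continuous (firstCoord : Sp d → ℝ) := by
    by_cases hd : 0 < d
    · rw [show (firstCoord : Sp d → ℝ) = fun ξ => ξ ⟨0, hd⟩ from funext (firstCoord_eq hd)]
      fun_prop
    · rw [show (firstCoord : Sp d → ℝ) = fun _ => 0 from funext fun _ => dif_neg hd]
      exact continuous_const
  unfold dispersion
  fun_prop

lemma continuous_planePhase {d : ℕ} (α β γ t : ℝ) (x : Sp d) :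
    Continuous (planePhase α β γ t x) := by
  have := continuous_dispersion (d := d) α β γ
  unfold planePhase
  fun_prop

lemma planePhase_sub {d : ℕ} (α β γ t s : ℝ) (x y ξ : Sp d) :
    planePhase α β γ (t - s) (x - y) ξ = planePhase α β γ t x ξ - planePhase α β γ s y ξ := by
  simp only [planePhase, inner_sub_right]; ring

lemma measurableSet_halfOpenCube (d : ℕ) (N : ℝ) : MeasurableSet (halfOpenCube d N) := by
  have : halfOpenCube d N = ⋂ i, (fun ξ : Sp d => ξ i) ⁻¹' Set.Ioc (-N) N := by
    ext; simp [halfOpenCube]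
  rw [this]
  exact MeasurableSet.iInter fun i => (by fun_prop : Measurable fun ξ : Sp d => ξ i) measurableSet_Ioc

lemma isBounded_halfOpenCube (d : ℕ) (N : ℝ) : Bornology.IsBounded (halfOpenCube d N) := by
  refine (Metric.isBounded_closedBall (x := (0 : Sp d)) (r := √(∑ _i : Fin d, N ^ 2))).subset ?_
  intro ξ hξ
  rw [mem_closedBall_zero_iff, EuclideanSpace.norm_eq]
  refine Real.sqrt_le_sqrt (Finset.sum_le_sum fun i _ => ?_)
  rw [Real.norm_eq_abs]
  have := hξ i
  exact pow_le_pow_left₀ (abs_nonneg _) (abs_le.2 ⟨this.1.le, this.2⟩) 2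

instance isFiniteMeasure_restrict_halfOpenCube (d : ℕ) (N : ℝ) :
    IsFiniteMeasure ((volume : Measure (Sp d)).restrict (halfOpenCube d N)) :=
  ⟨by simpa using (isBounded_halfOpenCube d N).measure_lt_top⟩

/-- The conjugated plane wave `exp(-i(2π⟨x, ξ⟩ + tφ(ξ)))`. -/
noncomputable def planeWave {d : ℕ} (α β γ t : ℝ) (x ξ : Sp d) : ℂ :=
  Complex.exp (Complex.I * ((-planePhase α β γ t x ξ : ℝ) : ℂ))

lemma norm_planeWave {d : ℕ} (α β γ t : ℝ) (x ξ : Sp d) : ‖planeWave α β γ t x ξ‖ = 1 :=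
  norm_exp_I_mul_ofReal' _

lemma continuous_planeWave {d : ℕ} (α β γ t : ℝ) (x : Sp d) :
    Continuous (planeWave α β γ t x) := by
  have := continuous_planePhase α β γ t x
  unfold planeWave
  fun_prop

lemma conj_planeWave {d : ℕ} (α β γ t : ℝ) (x ξ : Sp d) :
    (starRingEnd ℂ) (planeWave α β γ t x ξ) =
      Complex.exp (Complex.I * (planePhase α β γ t x ξ : ℝ)) := by
  rw [planeWave, ← Complex.exp_conj]; simp

lemma memLp_planeWave {d : ℕ} (α β γ t : ℝ) (x : Sp d) (N : ℝ) :
    MemLp (planeWave α β γ t x) 2 (volume.restrict (halfOpenCube d N)) :=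
  MemLp.of_bound (continuous_planeWave α β γ t x).aestronglyMeasurable 1
    (ae_of_all _ fun ξ => (norm_planeWave α β γ t x ξ).le)

/-- The plane wave restricted to a cube, as an element of `L²`. -/
noncomputable def planeWaveLp {d : ℕ} (α β γ N t : ℝ) (x : Sp d) :
    Lp ℂ 2 ((volume : Measure (Sp d)).restrict (halfOpenCube d N)) :=
  (memLp_planeWave α β γ t x N).toLp

lemma norm_exp_I_mul_sub_le (a b : ℝ) :
    ‖Complex.exp (Complex.I * (a : ℂ)) - Complex.exp (Complex.I * (b : ℂ))‖ ≤ |a - b| := by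
  have h : Complex.exp (Complex.I * (a : ℂ)) - Complex.exp (Complex.I * (b : ℂ)) =
      Complex.exp (Complex.I * (b : ℂ)) * (Complex.exp (Complex.I * ((a - b : ℝ) : ℂ)) - 1) := by
    rw [mul_sub, ← Complex.exp_add]; congr 2 <;> push_cast <;> ring_nf
  rw [h, norm_mul, norm_exp_I_mul_ofReal', one_mul]
  exact Real.norm_exp_I_mul_ofReal_sub_one_le

lemma continuous_planeWaveLp {d : ℕ} (α β γ N : ℝ) :
    Continuous (Function.uncurry (planeWaveLp (d := d) α β γ N)) := by
  obtain ⟨M, hM⟩ : ∃ M : ℝ, ∀ ξ ∈ halfOpenCube d N, 2 * Real.pi * ‖ξ‖ + |dispersion α β γ ξ| ≤ M := by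
    have hc : Continuous fun ξ : Sp d => 2 * Real.pi * ‖ξ‖ + |dispersion α β γ ξ| := by
      have := continuous_dispersion (d := d) α β γ
      fun_prop
    obtain ⟨M, hM⟩ := (isBounded_halfOpenCube d N).isCompact_closure.bddAbove_image hc.continuousOn
    exact ⟨M, fun ξ hξ => hM ⟨ξ, subset_closure hξ, rfl⟩⟩
  set V := measureUnivNNReal ((volume : Measure (Sp d)).restrict (halfOpenCube d N)) ^
    (2 : ℝ≥0∞).toReal⁻¹ with hV
  refine (LipschitzWith.of_dist_le_mul (K := V * M.toNNReal) fun z w => ?_).continuous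
  rw [Function.uncurry, Function.uncurry, dist_eq_norm, NNReal.coe_mul, mul_assoc]
  refine Lp.norm_le_of_ae_bound (by positivity) ?_
  filter_upwards [Lp.coeFn_sub (planeWaveLp α β γ N z.1 z.2) (planeWaveLp α β γ N w.1 w.2),
    (memLp_planeWave α β γ z.1 z.2 N).coeFn_toLp, (memLp_planeWave α β γ w.1 w.2 N).coeFn_toLp,
    ae_restrict_mem (measurableSet_halfOpenCube d N)] with ξ h₁ h₂ h₃ hξ
  rw [h₁, Pi.sub_apply, planeWaveLp, planeWaveLp, h₂, h₃]
  refine (norm_exp_I_mul_sub_le _ _).trans ?_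
  have hz₁ : |z.1 - w.1| ≤ dist z w := le_max_left (dist z.1 w.1) _
  have hz₂ : ‖z.2 - w.2‖ ≤ dist z w := by
    rw [← dist_eq_norm]; exact le_max_right _ _
  have e : |-planePhase α β γ z.1 z.2 ξ - -planePhase α β γ w.1 w.2 ξ| =
      |planePhase α β γ (z.1 - w.1) (z.2 - w.2) ξ| := by
    rw [planePhase_sub, ← abs_neg]; congr 1; ring
  rw [e]
  calc |planePhase α β γ (z.1 - w.1) (z.2 - w.2) ξ|
      ≤ 2 * Real.pi * (‖ξ‖ * ‖z.2 - w.2‖) + |dispersion α β γ ξ| * |z.1 - w.1| := by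
        refine (abs_add_le _ _).trans ?_
        rw [abs_mul (2 * Real.pi), abs_mul (dispersion α β γ ξ), abs_of_pos Real.two_pi_pos]
        gcongr
        exact abs_real_inner_le_norm _ _
    _ ≤ 2 * Real.pi * (‖ξ‖ * dist z w) + |dispersion α β γ ξ| * dist z w := by gcongr
    _ = (2 * Real.pi * ‖ξ‖ + |dispersion α β γ ξ|) * dist z w := by ring
    _ ≤ M.toNNReal * dist z w := by
        gcongr
        exact (hM ξ hξ).trans (Real.le_coe_toNNReal M)

lemma inner_planeWaveLp {d : ℕ} (α β γ N t : ℝ) (x : Sp d)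
    (g : Lp ℂ 2 ((volume : Measure (Sp d)).restrict (halfOpenCube d N))) :
    inner ℂ (planeWaveLp α β γ N t x) g = 𝓕⁻ ((halfOpenCube d N).indicator fun ξ =>
      Complex.exp (Complex.I * ((dispersion α β γ ξ * t : ℝ) : ℂ)) * g ξ) x := by
  rw [L2.inner_def, Real.fourierInv_eq']
  have : ∀ ξ : Sp d, Complex.exp (((2 * Real.pi * inner ℝ ξ x : ℝ) : ℂ) * Complex.I) •
      (halfOpenCube d N).indicator (fun ξ =>
        Complex.exp (Complex.I * ((dispersion α β γ ξ * t : ℝ) : ℂ)) * g ξ) ξ =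
      (halfOpenCube d N).indicator (fun ξ =>
        Complex.exp (Complex.I * (planePhase α β γ t x ξ : ℝ)) * g ξ) ξ := by
    intro ξ
    by_cases hξ : ξ ∈ halfOpenCube d N
    · rw [Set.indicator_of_mem hξ, Set.indicator_of_mem hξ, smul_eq_mul, ← mul_assoc,
        ← Complex.exp_add, planePhase]
      congr 2; push_cast; ring
    · simp [hξ]
  simp_rw [this]
  rw [integral_indicator (measurableSet_halfOpenCube d N)]
  refine integral_congr_ae ?_
  filter_upwards [(memLp_planeWave α β γ t x N).coeFn_toLp] with ξ hξ
  rw [RCLike.inner_apply, planeWaveLp, hξ, conj_planeWave, mul_comm]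

lemma inner_planeWaveLp_planeWaveLp {d : ℕ} (α β γ N t s : ℝ) (x y : Sp d) :
    inner ℂ (planeWaveLp α β γ N t x) (planeWaveLp α β γ N s y) =
      ∫ ξ in halfOpenCube d N,
        Complex.exp (Complex.I * (planePhase α β γ (t - s) (x - y) ξ : ℝ)) := by
  rw [L2.inner_def]
  refine integral_congr_ae ?_
  filter_upwards [(memLp_planeWave α β γ t x N).coeFn_toLp,
    (memLp_planeWave α β γ s y N).coeFn_toLp] with ξ h₁ h₂
  rw [RCLike.inner_apply, planeWaveLp, planeWaveLp, h₁, h₂, conj_planeWave, planeWave,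
    ← Complex.exp_add, planePhase_sub]
  congr 1; push_cast; ring

lemma memLp_indicator_halfOpenCube {d : ℕ} (α β γ N t : ℝ)
    (g : Lp ℂ 2 ((volume : Measure (Sp d)).restrict (halfOpenCube d N))) :
    MemLp (fun ξ => Complex.exp (Complex.I * ((dispersion α β γ ξ * t : ℝ) : ℂ)) * g ξ) 2
      (volume.restrict (halfOpenCube d N)) := by
  have hc : Continuous fun ξ : Sp d =>
      Complex.exp (Complex.I * ((dispersion α β γ ξ * t : ℝ) : ℂ)) := by
    have := continuous_dispersion (d := d) α β γ
    fun_prop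
  refine (Lp.memLp g).of_le (hc.aestronglyMeasurable.mul (Lp.aestronglyMeasurable g))
    (ae_of_all _ fun ξ => ?_)
  rw [norm_mul, norm_exp_I_mul_ofReal', one_mul]

lemma lintegral_inner_planeWaveLp_sq {d : ℕ} (α β γ N t : ℝ)
    (g : Lp ℂ 2 ((volume : Measure (Sp d)).restrict (halfOpenCube d N))) :
    ∫⁻ x, ‖inner ℂ (planeWaveLp α β γ N t x) g‖ₑ ^ 2 = ‖g‖ₑ ^ 2 := by
  have hm := memLp_indicator_halfOpenCube α β γ N t g
  have hK := measurableSet_halfOpenCube d N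
  simp_rw [inner_planeWaveLp]
  have h2 : ∀ (μ : Measure (Sp d)) (f : Sp d → ℂ), ∫⁻ x, ‖f x‖ₑ ^ 2 ∂μ = eLpNorm f 2 μ ^ 2 := by
    intro μ f
    rw [eLpNorm_eq_lintegral_rpow_enorm_toReal (by simp) (by simp), ← ENNReal.rpow_natCast,
      ← ENNReal.rpow_mul]
    simp
  rw [h2, eLpNorm_fourierInv_two ((integrable_indicator_iff hK).2 (hm.integrable (by norm_num)))
    ((memLp_indicator_iff_restrict hK).2 hm), eLpNorm_indicator_eq_eLpNorm_restrict hK,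
    Lp.enorm_def]
  congr 1
  refine eLpNorm_congr_norm_ae (ae_of_all _ fun ξ => ?_)
  rw [norm_mul, norm_exp_I_mul_ofReal', one_mul]

lemma enorm_planeWaveLp_le {d : ℕ} (α β γ N t : ℝ) (x : Sp d) :
    ‖planeWaveLp α β γ N t x‖ₑ ≤ volume (halfOpenCube d N) ^ (2 : ℝ≥0∞).toReal⁻¹ := by
  rw [Lp.enorm_def, planeWaveLp, eLpNorm_congr_ae (memLp_planeWave α β γ t x N).coeFn_toLp]
  refine (eLpNorm_le_of_ae_bound (C := 1)
    (ae_of_all _ fun ξ => (norm_planeWave α β γ t x ξ).le)).trans ?_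
  simp

lemma isDispersiveFamily_planeWaveLp {d : ℕ} (hd : 0 < d) {α β γ : ℝ} (hα : α ≠ 0)
    (hβγ : (β, γ) ≠ (0, 0)) (hσ : 0 < dEff d γ) :
    ∃ C : ℝ, 0 < C ∧ ∀ N : ℝ, 0 ≤ N →
      IsDispersiveFamily volume (planeWaveLp (d := d) α β γ N) C (dEff d γ / 2)
        (volume (halfOpenCube d N) ^ (2 : ℝ≥0∞).toReal⁻¹) := by
  obtain ⟨C, hC, h⟩ := norm_setIntegral_halfOpenCube_le hd hα hβγ
  refine ⟨C, hC, fun N hN => ⟨(continuous_planeWaveLp α β γ N).stronglyMeasurable, ?_,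
    fun t x => enorm_planeWaveLp_le α β γ N t x,
    fun t g => (lintegral_inner_planeWaveLp_sq α β γ N t g).le, fun t s x y => ?_⟩⟩
  · exact ENNReal.rpow_ne_top_of_nonneg (by positivity)
      (isBounded_halfOpenCube d N).measure_lt_top.ne
  · rcases eq_or_ne t s with rfl | hts
    · rw [sub_self, abs_zero, ENNReal.ofReal_zero, ENNReal.zero_rpow_of_neg (by linarith),
        ENNReal.mul_top (by simpa using hC)]
      exact le_top
    · have hts' : t - s ≠ 0 := sub_ne_zero.2 hts
      rw [inner_planeWaveLp_planeWaveLp, ENNReal.ofReal_rpow_of_pos (abs_pos.2 hts'),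
        ← ENNReal.ofReal_mul hC.le, ← ofReal_norm]
      exact ENNReal.ofReal_le_ofReal (h N (t - s) (x - y) hN hts')

lemma cgam_inv_pos_lt (γ : ℝ) : 0 < (cgam γ)⁻¹ ∧ (cgam γ)⁻¹ < 1 := by
  unfold cgam; split_ifs <;> norm_num

lemma exists_timeNorm_planeWaveLp_le {d : ℕ} (hd : 2 ≤ d) {α β γ : ℝ} (hα : α ≠ 0)
    (hβγ : (β, γ) ≠ (0, 0)) {p r : ℝ≥0∞} (hadm : Admissible d γ p r) :
    ∃ K : ℝ≥0∞, K ≠ ∞ ∧ ∀ N : ℝ, 0 ≤ N →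
      ∀ g : Lp ℂ 2 ((volume : Measure (Sp d)).restrict (halfOpenCube d N)),
      timeNorm r (fun t => eLpNorm (fun x => inner ℂ (planeWaveLp α β γ N t x) g) p volume) ≤
        K * ‖g‖ₑ := by
  obtain ⟨hp, hr, hpr⟩ := hadm
  obtain ⟨hc₀, hc₁⟩ := cgam_inv_pos_lt γ
  have hd' : (2 : ℝ) ≤ d := by exact_mod_cast hd
  have hE : 0 < dEff d γ := by rw [dEff]; linarith
  have hpr' : (r⁻¹).toReal = dEff d γ / 2 * (1 / 2 - (p⁻¹).toReal) := by linarith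
  obtain ⟨C, hC, h⟩ := isDispersiveFamily_planeWaveLp (by omega : 0 < d) hα hβγ hE
  rcases hd.eq_or_lt with hd2 | hd3
  · have hlt : dEff d γ / 2 < 1 := by rw [dEff, ← hd2]; push_cast; linarith
    obtain ⟨K, hK, hK'⟩ := exists_timeNorm_le_of_lt_one C (by linarith) hlt hp hr hpr'
    exact ⟨K, hK, fun N hN => hK' (h N hN)
      fun t => Continuous.uncurry_left t (continuous_planeWaveLp α β γ N)⟩
  · have hd3' : (3 : ℝ) ≤ d := by exact_mod_cast hd3
    have hlt : 1 < dEff d γ / 2 := by rw [dEff]; linarith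
    obtain ⟨K, hK, hK'⟩ := exists_timeNorm_le_of_one_lt hC hlt hp hr hpr'
    exact ⟨K, hK, fun N hN g => hK' (h N hN) g⟩

theorem exists_timeNorm_fourierInv_le {d : ℕ} (hd : 2 ≤ d) {α β γ : ℝ} (hα : α ≠ 0)
    (hβγ : (β, γ) ≠ (0, 0)) {p r : ℝ≥0∞} (hadm : Admissible d γ p r) :
    ∃ K : ℝ≥0∞, K ≠ ∞ ∧ ∀ g : Sp d → ℂ, Continuous g → HasCompactSupport g →
      timeNorm r (fun t => eLpNorm (𝓕⁻ fun ξ =>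
        Complex.exp (Complex.I * ((dispersion α β γ ξ * t : ℝ) : ℂ)) * g ξ) p volume) ≤
          K * eLpNorm g 2 volume := by
  obtain ⟨K, hK, h⟩ := exists_timeNorm_planeWaveLp_le hd hα hβγ hadm
  refine ⟨K, hK, fun g hg hgs => ?_⟩
  obtain ⟨R, hR₀, hR⟩ := hgs.isBounded.subset_closedBall_lt 0 (0 : Sp d)
  have hsub : ∀ ξ, ξ ∉ halfOpenCube d (R + 1) → g ξ = 0 := by
    intro ξ hξ
    by_contra hne
    refine hξ fun i => ?_
    have h₁ := mem_closedBall_zero_iff.1 (hR (subset_tsupport g hne))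
    have h₂ := abs_le.1 ((PiLp.norm_apply_le ξ i).trans h₁)
    constructor <;> linarith [h₂.1, h₂.2]
  have hm : MemLp g 2 volume := hg.memLp_of_hasCompactSupport hgs
  have hm' := hm.restrict (halfOpenCube d (R + 1))
  have key := h (R + 1) (by linarith) hm'.toLp
  have hfun : ∀ t x, inner ℂ (planeWaveLp α β γ (R + 1) t x) hm'.toLp = 𝓕⁻ (fun ξ =>
      Complex.exp (Complex.I * ((dispersion α β γ ξ * t : ℝ) : ℂ)) * g ξ) x := by
    intro t x
    rw [inner_planeWaveLp, Real.fourierInv_eq, Real.fourierInv_eq]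
    refine integral_congr_ae ?_
    filter_upwards [(ae_restrict_iff' (measurableSet_halfOpenCube d (R + 1))).1 hm'.coeFn_toLp]
      with ξ hξ
    by_cases hmem : ξ ∈ halfOpenCube d (R + 1)
    · rw [Set.indicator_of_mem hmem, hξ hmem]
    · rw [Set.indicator_of_notMem hmem, hsub ξ hmem, mul_zero]
  simp_rw [hfun] at key
  refine key.trans ?_
  gcongr
  rw [Lp.enorm_toLp]
  exact eLpNorm_mono_measure g Measure.restrict_le_self

lemma fourierInv_of_not_integrable {d : ℕ} {f : Sp d → ℂ} (hf : ¬ Integrable f) :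
    𝓕⁻ f = 0 := by
  ext x
  rw [Real.fourierInv_eq_fourier_neg, Real.fourier_eq, Pi.zero_apply]
  exact integral_undef fun h => hf ((Real.fourierIntegral_convergent_iff (-x)).1 h)

lemma fourier_of_not_integrable {d : ℕ} {f : Sp d → ℂ} (hf : ¬ Integrable f) :
    𝓕 f = 0 := by
  ext x
  rw [Real.fourier_eq, Pi.zero_apply]
  exact integral_undef fun h => hf ((Real.fourierIntegral_convergent_iff x).1 h)

lemma boxOp_zero {d : ℕ} (P : BoxPartition d) (k : Fin d → ℤ) : boxOp P k 0 = 0 := by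
  ext x; simp [boxOp]

lemma timeNorm_zero {r : ℝ≥0∞} (hr : r ≠ 0) : timeNorm r (fun _ => 0) = 0 := by
  unfold timeNorm
  split_ifs with h
  · exact essSup_const_bot
  · have := ENNReal.toReal_pos hr h
    simp [ENNReal.zero_rpow_of_pos, this]

lemma continuous_fourier_of_integrable {d : ℕ} {f : Sp d → ℂ} (hf : Integrable f) :
    Continuous (𝓕 f) := by
  rw [show 𝓕 f = fun x => 𝓕⁻ f (-x) by
    ext x; rw [Real.fourierInv_eq_fourier_neg, neg_neg]]
  exact (continuous_fourierInv_of_integrable hf).comp continuous_neg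

lemma propagator_eq_zero {d : ℕ} (α β γ t : ℝ) {f : Sp d → ℂ}
    (hf : ¬ (Integrable f ∧ Integrable (𝓕 f))) : propagator α β γ t f = 0 := by
  rw [not_and_or] at hf
  rcases hf with hf | hf
  · rw [propagator, fourier_of_not_integrable hf]
    ext x
    simp [Real.fourierInv_eq]
  · refine fourierInv_of_not_integrable fun h => hf ?_
    have hc : Continuous fun ξ : Sp d =>
        Complex.exp (Complex.I * ((-(dispersion α β γ ξ * t) : ℝ) : ℂ)) := by
      have := continuous_dispersion (d := d) α β γ
      fun_prop
    refine (h.bdd_mul (c := 1) hc.aestronglyMeasurable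
      (ae_of_all _ fun ξ => (norm_exp_I_mul_ofReal' _).le)).congr (ae_of_all _ fun ξ => ?_)
    simp only []
    rw [← mul_assoc, ← Complex.exp_add]
    push_cast
    rw [mul_neg, neg_add_cancel, Complex.exp_zero, one_mul]

theorem exists_timeNorm_boxOp_propagator_le {d : ℕ} (hd : 2 ≤ d) {α β γ : ℝ} (hα : α ≠ 0)
    (hβγ : (β, γ) ≠ (0, 0)) {p r : ℝ≥0∞} (hadm : Admissible d γ p r) (P : BoxPartition d) :
    ∃ K : ℝ≥0∞, K ≠ ∞ ∧ ∀ (k : Fin d → ℤ) (f : Sp d → ℂ),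
      timeNorm r (fun t => eLpNorm (boxOp P k (propagator α β γ t f)) p volume) ≤
        K * eLpNorm (boxOp P k f) 2 volume := by
  obtain ⟨K, hK, h⟩ := exists_timeNorm_fourierInv_le hd hα hβγ hadm
  refine ⟨K, hK, fun k f => ?_⟩
  by_cases hf : Integrable f ∧ Integrable (𝓕 f)
  · obtain ⟨hf, hF⟩ := hf
    have hcont : Continuous fun ξ => P.σ k ξ * 𝓕 f ξ :=
      (P.continuous k).mul (continuous_fourier_of_integrable hf)
    have hsupp : HasCompactSupport fun ξ => P.σ k ξ * 𝓕 f ξ := (P.hasCompactSupport k).mul_right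
    have hc : ∀ t, Continuous fun ξ : Sp d =>
        Complex.exp (Complex.I * ((dispersion α β γ ξ * t : ℝ) : ℂ)) := by
      have := continuous_dispersion (d := d) α β γ
      fun_prop
    have hW : ∀ t, boxOp P k (propagator α β γ t f) = 𝓕⁻ fun ξ =>
        Complex.exp (Complex.I * ((dispersion α β γ ξ * t : ℝ) : ℂ)) * (P.σ k ξ * 𝓕 f ξ) := by
      intro t
      rw [propagator, boxOp_fourierInv P k (hF.bdd_mul (c := 1) (hc t).aestronglyMeasurable
        (ae_of_all _ fun ξ => (norm_exp_I_mul_ofReal' _).le))]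
      congr 1
      ext ξ
      ring
    simp_rw [hW]
    rw [boxOp_of_integrable P k hf, eLpNorm_fourierInv_two
      (hcont.integrable_of_hasCompactSupport hsupp) (hcont.memLp_of_hasCompactSupport hsupp)]
    exact h _ hcont hsupp
  · simp_rw [propagator_eq_zero α β γ _ hf, boxOp_zero, eLpNorm_zero]
    rw [timeNorm_zero (two_pos.trans_le hadm.2.1).ne']
    exact zero_le

lemma lqNorm_le_mul {ι : Type*} {q : ℝ≥0∞} (hq : 1 ≤ q) {a b : ι → ℝ≥0∞} {K : ℝ≥0∞}
    (h : ∀ k, a k ≤ K * b k) : lqNorm q a ≤ K * lqNorm q b := by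
  unfold lqNorm
  split_ifs with hqt
  · rw [ENNReal.mul_iSup]
    exact iSup_mono h
  · have hq0 : 0 < q.toReal := ENNReal.toReal_pos (one_pos.trans_le hq).ne' hqt
    calc (∑' k, a k ^ q.toReal) ^ (1 / q.toReal)
        ≤ (∑' k, K ^ q.toReal * b k ^ q.toReal) ^ (1 / q.toReal) := by
          gcongr with k
          rw [← ENNReal.mul_rpow_of_nonneg _ _ hq0.le]
          gcongr
          exact h k
      _ = K * (∑' k, b k ^ q.toReal) ^ (1 / q.toReal) := by
          rw [ENNReal.tsum_mul_left, ENNReal.mul_rpow_of_nonneg _ _ (by positivity),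
            ← ENNReal.rpow_mul, mul_one_div_cancel hq0.ne', ENNReal.rpow_one]

/-- homogeneous Strichartz estimate in Planchon-type spaces:
for an admissible pair `(p, r)`, any `q ∈ [1,∞]` and `s ∈ ℝ`,
`‖W(t)u₀‖_{l^{s,q}_□(L^r_t L^p_x)} ≲ ‖u₀‖_{M^s_{2,q}}`. -/
theorem stmt7 (d : ℕ) (hd : 2 ≤ d) (α β γ : ℝ) (hα : α ≠ 0) (hβγ : (β, γ) ≠ (0, 0))
    (p r : ℝ≥0∞) (hadm : Admissible d γ p r)
    (q : ℝ≥0∞) (hq1 : 1 ≤ q) (s : ℝ) (P : BoxPartition d) :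
    ∃ C : ℝ, 0 < C ∧ ∀ u₀ : Sp d → ℂ, modNorm P s 2 q u₀ < ∞ →
      planchonNorm P s q r p (fun t => propagator α β γ t u₀) ≤
        ENNReal.ofReal C * modNorm P s 2 q u₀ := by
  obtain ⟨K, hK, h⟩ := exists_timeNorm_boxOp_propagator_le hd hα hβγ hadm P
  refine ⟨K.toReal + 1, by positivity, fun u₀ _ => lqNorm_le_mul hq1 fun k => ?_⟩
  calc jbr k s * timeNorm r (fun t => eLpNorm (boxOp P k (propagator α β γ t u₀)) p volume)
      ≤ jbr k s * (ENNReal.ofReal (K.toReal + 1) * eLpNorm (boxOp P k u₀) 2 volume) := by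
        gcongr
        refine (h k u₀).trans ?_
        gcongr
        exact (ENNReal.le_ofReal_iff_toReal_le hK (by positivity)).2 (by linarith)
    _ = _ := mul_left_comm _ _ _
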